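/- Let (F₁,F₂) be a nonsingular pair of quadratic forms in s variables with integer coefficients. There is a constant C = C(F₁,F₂) such that for all q, d ∈ ℕ with d | q, all primitive c ∈ ℤ² and all u ∈ ℤ^s: |S_{q, dc}(u)| ≤ C d^{1/2} q^{s/2 + 3/2}. -/

import Mathlib

open MeasureTheory Real Matrix Finset

noncomputable section

/-- `e(x) = exp(2πix)`. -/
def e2pi (x : ℝ) : ℂ := Complex.exp (2 * Real.pi * Complex.I * x)

/-- Euclidean norm on `ℝ²`. -/
def nrm2 (x : ℝ × ℝ) : ℝ := Real.sqrt (x.1 ^ 2 + x.2 ^ 2)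

/-- Dot product on `ℝ²`. -/
def dot2 (x y : ℝ × ℝ) : ℝ := x.1 * y.1 + x.2 * y.2

/-- `x^⊥ = (x₂, -x₁)`. -/
def perp2 (x : ℝ × ℝ) : ℝ × ℝ := (x.2, -x.1)

/-- `δ_n` for `n ∈ ℤ²`. -/
def deltaInt (n : ℤ × ℤ) : ℂ := if n = 0 then 1 else 0

/-- `h(y,z) = Σ_{j ≥ 1} (1/(yj)) (ω(yj) − ω(|z|/(yj)))`. -/
def hFun (ω : ℝ → ℝ) (y z : ℝ) : ℝ :=
  ∑' j : ℕ+, (1 / (y * ((j : ℕ) : ℝ))) *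
    (ω (y * ((j : ℕ) : ℝ)) - ω (|z| / (y * ((j : ℕ) : ℝ))))

/-- `c = (∫_{ℝ²} ω(|x|) dx)⁻¹`. -/
def cConst (ω : ℝ → ℝ) : ℝ := (∫ x : ℝ × ℝ, ω (nrm2 x))⁻¹

/-- The function `p_{1,q}`. -/
def p1 (ω ω₀ : ℝ → ℝ) (Q : ℝ) (q : ℕ) (w : ℝ × ℝ) : ℂ :=
  -(cConst ω / Q : ℝ) * ∫ x : ℝ × ℝ,
    (((ω₀ (nrm2 x / Q ^ ((3 : ℝ) / 2)) *
      ∑' j : ℕ+, (1 / ((q : ℝ) * ((j : ℕ) : ℝ)) ^ 2) *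
        ω (nrm2 x / (((j : ℕ) : ℝ) * (q : ℝ) * Q ^ ((1 : ℝ) / 2)))) : ℝ) : ℂ) *
      e2pi (-(dot2 w x))

/-- The function `p_{2,r,k,q}` (with `q` allowed to be a real parameter). -/
def p2 (ω ω₀ : ℝ → ℝ) (Q : ℝ) (r : ℤ × ℤ) (k : ℕ) (q : ℝ) (w : ℝ × ℝ) : ℂ :=
  ((cConst ω / Q ^ 3 : ℝ) : ℂ) * ∫ x : ℝ × ℝ,
    (((ω₀ (nrm2 x / Q ^ ((3 : ℝ) / 2)) *
      hFun ω ((k : ℝ) * q / Q) (((r.1 : ℝ) * x.1 + (r.2 : ℝ) * x.2) / Q ^ 2)) : ℝ) : ℂ) *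
      e2pi (-(dot2 w x))

/-- The lattice `Λ(a,q) = {k a + q y}` as a subset of `ℤ²`. -/
def Lambda (a : ℤ × ℤ) (q : ℕ) : Set (ℤ × ℤ) :=
  {v | ∃ k : ℤ, ∃ y : ℤ × ℤ, v = (k * a.1 + (q : ℤ) * y.1, k * a.2 + (q : ℤ) * y.2)}

/-- `k(r) = gcd(r₁,r₂)/gcd(gcd(r₁,r₂),q)`. -/
def kOf (r : ℤ × ℤ) (q : ℕ) : ℕ := Int.gcd r.1 r.2 / Nat.gcd (Int.gcd r.1 r.2) q

/-- The function `p_{Λ(a,q)}`. -/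
def pLambda (ω ω₀ : ℝ → ℝ) (Q : ℝ) (q : ℕ) (a : ℤ × ℤ) (w : ℝ × ℝ) : ℂ :=
  p1 ω ω₀ Q q w +
    ∑' r : ℤ × ℤ,
      Set.indicator {r : ℤ × ℤ | r ∈ Lambda a q ∧ r ≠ 0}
        (fun r => ((ω (nrm2 ((r.1 : ℝ), (r.2 : ℝ)) / Q ^ ((1 : ℝ) / 2)) : ℝ) : ℂ) *
          p2 ω ω₀ Q r (kOf r q) (q : ℝ) w) r

/-- Reduced residues `a mod q` (canonical representatives) with `gcd(a₁,a₂,q)=1`. -/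
def residues (q : ℕ) : Finset (ℕ × ℕ) :=
  ((Finset.range q) ×ˢ (Finset.range q)).filter (fun a => Nat.gcd (Nat.gcd a.1 a.2) q = 1)

/-- Normalized directional derivative along `ξ`. -/
def dirDeriv (ξ : ℝ × ℝ) (f : ℝ × ℝ → ℂ) : ℝ × ℝ → ℂ :=
  fun w => fderiv ℝ f w (ξ.1 / nrm2 ξ, ξ.2 / nrm2 ξ)

/-- Fourier transform `ω̂₀(t) = ∫ ω₀(x) e(−xt) dx`. -/
def fourierW0 (ω₀ : ℝ → ℝ) (t : ℝ) : ℂ := ∫ x : ℝ, ((ω₀ x : ℝ) : ℂ) * e2pi (-(x * t))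

/-- `|M(w)x|` for the 3×2 matrix `M(w)`. -/
def Mnorm (Q : ℝ) (w : ℝ × ℝ) (x : ℝ × ℝ) : ℝ :=
  Real.sqrt (x.1 ^ 2 / Q + x.2 ^ 2 / Q + Q ^ 2 * (w.1 * x.2 - w.2 * x.1) ^ 2)

/-- `μ_{M(w)}(Λ(a,q))`: infimum of `|M(w)x|` over nonzero lattice points. -/
def muM (Q : ℝ) (w : ℝ × ℝ) (a : ℤ × ℤ) (q : ℕ) : ℝ :=
  sInf {t : ℝ | ∃ v : ℤ × ℤ, v ∈ Lambda a q ∧ v ≠ 0 ∧ t = Mnorm Q w ((v.1 : ℝ), (v.2 : ℝ))}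

/-- Quadratic form attached to an integer matrix, over any commutative ring. -/
def quadEval {s : ℕ} {R : Type*} [CommRing R] (M : Matrix (Fin s) (Fin s) ℤ)
    (x : Fin s → R) : R :=
  ∑ i, ∑ j, (M i j : R) * x i * x j

/-- `e_q(n) = exp(2πin/q)` for an integer `n`. -/
def eqc (q : ℕ) (n : ℤ) : ℂ := e2pi ((n : ℝ) / (q : ℝ))

/-- The exponential sum `D_q(u)`. -/
def Dq (s : ℕ) (M₁ M₂ : Matrix (Fin s) (Fin s) ℤ) (q : ℕ) (u : Fin s → ℤ) : ℂ :=
  ∑ a ∈ residues q, ∑ b ∈ Fintype.piFinset (fun _ : Fin s => Finset.range q),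
    eqc q ((a.1 : ℤ) * quadEval M₁ (fun i => (b i : ℤ)) +
      (a.2 : ℤ) * quadEval M₂ (fun i => (b i : ℤ)) + ∑ i, (b i : ℤ) * u i)

/-- The exponential sum `S_{q,dc}(u)`. -/
def Sq (s : ℕ) (M₁ M₂ : Matrix (Fin s) (Fin s) ℤ) (q d : ℕ) (c : ℤ × ℤ)
    (u : Fin s → ℤ) : ℂ :=
  ∑ a ∈ (residues q).filter
      (fun a => (q : ℤ) ∣ (d : ℤ) * (c.1 * (a.2 : ℤ) - c.2 * (a.1 : ℤ))),
    ∑ b ∈ Fintype.piFinset (fun _ : Fin s => Finset.range q),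
      eqc q ((a.1 : ℤ) * quadEval M₁ (fun i => (b i : ℤ)) +
        (a.2 : ℤ) * quadEval M₂ (fun i => (b i : ℤ)) + ∑ i, (b i : ℤ) * u i)

/-- The pair of quadratic forms given by `M₁, M₂` is nonsingular: at every nonzero
complex common zero the gradients (equivalently `M₁x`, `M₂x`) are linearly independent. -/
def NonsingularPair (s : ℕ) (M₁ M₂ : Matrix (Fin s) (Fin s) ℤ) : Prop :=
  ∀ x : Fin s → ℂ, x ≠ 0 →
    quadEval M₁ x = 0 → quadEval M₂ x = 0 →
    LinearIndependent ℂ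
      ![(M₁.map (fun z : ℤ => (z : ℂ))).mulVec x, (M₂.map (fun z : ℤ => (z : ℂ))).mulVec x]

/-- Euclidean norm on `Fin m → ℝ`. -/
def enorm' {m : ℕ} (v : Fin m → ℝ) : ℝ := Real.sqrt (∑ i, v i ^ 2)

end

section Pencil

variable {n : Type*} [Fintype n] [DecidableEq n] {R : Type*} [CommRing R]

theorem Polynomial.derivative_matrix_det (M : Matrix n n (Polynomial R)) :
    Polynomial.derivative M.det =
      (M.adjugate * M.map Polynomial.derivative).trace := by
  have h1 : Polynomial.derivative M.det =
      ∑ i, (M.updateCol i (fun j => Polynomial.derivative (M j i))).det := by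
    simp only [Matrix.det_apply, Polynomial.derivative_sum, Polynomial.derivative_smul]
    rw [Finset.sum_comm]
    refine Finset.sum_congr rfl fun σ _ => ?_
    rw [Polynomial.derivative_prod_finset, Finset.smul_sum]
    refine Finset.sum_congr rfl fun i _ => ?_
    congr 1
    rw [← Finset.mul_prod_erase _ _ (Finset.mem_univ i), mul_comm]
    congr 1
    · simp
    · refine Finset.prod_congr rfl fun j hj => ?_
      rw [Matrix.updateCol_ne (Finset.ne_of_mem_erase hj)]
  rw [h1, Matrix.trace]
  refine Finset.sum_congr rfl fun i _ => ?_
  rw [← Matrix.cramer_apply, Matrix.cramer_eq_adjugate_mulVec]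
  rfl

/-- The determinant of the pencil `A + X B`. -/
noncomputable def pencilDet (A B : Matrix n n R) : Polynomial R :=
  ((Polynomial.X : Polynomial R) • B.map Polynomial.C + A.map Polynomial.C).det

theorem eval_pencilDet (A B : Matrix n n R) (x : R) :
    (pencilDet A B).eval x = (A + x • B).det := by
  rw [pencilDet, ← Polynomial.coe_evalRingHom, RingHom.map_det]
  congr 1
  ext i j
  simp [add_comm, mul_comm x]

theorem natDegree_pencilDet_le (A B : Matrix n n R) :
    (pencilDet A B).natDegree ≤ Fintype.card n :=
  Polynomial.natDegree_det_X_add_C_le B A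

theorem map_pencilDet {S : Type*} [CommRing S] (φ : R →+* S) (A B : Matrix n n R) :
    (pencilDet A B).map φ = pencilDet (A.map φ) (B.map φ) := by
  rw [pencilDet, pencilDet, ← Polynomial.coe_mapRingHom, RingHom.map_det]
  congr 1
  ext i j
  simp

theorem eval_derivative_pencilDet (A B : Matrix n n R) (x : R) :
    (Polynomial.derivative (pencilDet A B)).eval x = ((A + x • B).adjugate * B).trace := by
  rw [pencilDet, Polynomial.derivative_matrix_det]
  rw [← Polynomial.coe_evalRingHom, Matrix.trace, map_sum, Matrix.trace]
  refine Finset.sum_congr rfl fun i _ => ?_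
  simp only [Matrix.diag_apply, Matrix.mul_apply, map_sum, map_mul]
  refine Finset.sum_congr rfl fun j _ => ?_
  congr 1
  · have h := congrFun (congrFun (RingHom.map_adjugate (Polynomial.evalRingHom x)
      ((Polynomial.X : Polynomial R) • B.map Polynomial.C + A.map Polynomial.C)) i) j
    have h2 : (Polynomial.evalRingHom x).mapMatrix
        ((Polynomial.X : Polynomial R) • B.map Polynomial.C + A.map Polynomial.C) = A + x • B := by
      ext i j
      simp [add_comm, mul_comm x]
    rw [h2] at h
    rw [← h]
    simp
  · simp

theorem adjugate_mul_apply_of_mulVec_eq_zero {A : Matrix n n R} {h : n → R}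
    (hA : A *ᵥ h = 0) (i j l : n) :
    A.adjugate i j * h l = h i * A.adjugate l j := by
  set M := A.updateRow j (Pi.single i 1) with hM
  have h1 : M *ᵥ h = h i • Pi.single j 1 := by
    ext m
    by_cases hm : m = j
    · subst hm
      simp [hM, Matrix.mulVec]
    · have := congrFun hA m
      simp only [Matrix.mulVec, Pi.zero_apply] at this
      simp [hM, Matrix.mulVec, this, hm]
  have h2 : M.adjugate *ᵥ (M *ᵥ h) = M.det • h := by
    rw [Matrix.mulVec_mulVec, Matrix.adjugate_mul, Matrix.smul_mulVec, Matrix.one_mulVec]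
  rw [h1] at h2
  have h3 := congrFun h2 l
  have h4 : M.adjugate l j = A.adjugate l j := by
    rw [Matrix.adjugate_apply, Matrix.adjugate_apply, hM, Matrix.updateRow_idem]
  have h5 : M.det = A.adjugate i j := by rw [Matrix.adjugate_apply]
  rw [Matrix.mulVec_smul, Matrix.mulVec_single_one] at h3
  simp only [Pi.smul_apply, Matrix.col_apply, smul_eq_mul] at h3
  rw [h4, h5] at h3
  exact h3.symm

theorem mulVec_adjugate_col {A : Matrix n n R} (hA : A.det = 0) (j : n) :
    A *ᵥ (fun i => A.adjugate i j) = 0 := by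
  have := Matrix.mul_adjugate A
  rw [hA, zero_smul] at this
  ext i
  simpa [Matrix.mul_apply, Matrix.mulVec, dotProduct] using congrFun (congrFun this i) j

theorem adjugate_mul_adjugate_of_det_eq_zero {A : Matrix n n R} (hA : A.det = 0) (i j l m : n) :
    A.adjugate i j * A.adjugate l m = A.adjugate i m * A.adjugate l j :=
  adjugate_mul_apply_of_mulVec_eq_zero (mulVec_adjugate_col hA m) i j l

theorem adjugate_col_form {A : Matrix n n R} (hA : A.det = 0) (hs : A.IsSymm) (B : Matrix n n R)
    (j : n) :
    (fun i => A.adjugate i j) ⬝ᵥ B *ᵥ (fun i => A.adjugate i j) =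
      A.adjugate j j * (A.adjugate * B).trace := by
  have hK : ∀ a b, A.adjugate a b = A.adjugate b a := fun a b => by
    have h : A.adjugateᵀ = A.adjugate := by rw [Matrix.adjugate_transpose, hs.eq]
    conv_lhs => rw [← h]
    rfl
  simp only [dotProduct, Matrix.mulVec, Matrix.trace, Matrix.diag_apply, Matrix.mul_apply,
    Finset.mul_sum]
  rw [Finset.sum_comm]
  refine Finset.sum_congr rfl fun a _ => Finset.sum_congr rfl fun b _ => ?_
  have := adjugate_mul_adjugate_of_det_eq_zero hA a j j b
  rw [← hK b j] at this
  linear_combination B b a * this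

end Pencil

section PrimePowerRing

variable {p : ℕ} [hp : Fact p.Prime] {k : ℕ}

theorem ppow_dvd_natCast_iff {i : ℕ} (hi : i ≤ k) (n : ℕ) :
    (p : ZMod (p ^ k)) ^ i ∣ (n : ZMod (p ^ k)) ↔ p ^ i ∣ n := by
  constructor
  · rintro ⟨y, hy⟩
    have h : (n : ZMod (p ^ k)) = ((p ^ i * y.val : ℕ) : ZMod (p ^ k)) := by
      push_cast
      rw [ZMod.natCast_zmod_val, hy]
    rw [ZMod.natCast_eq_natCast_iff] at h
    have h2 := h.of_dvd (pow_dvd_pow p hi)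
    exact (Nat.modEq_zero_iff_dvd).1 (h2.trans
      ((Nat.modEq_zero_iff_dvd).2 (Dvd.intro _ rfl)))
  · rintro ⟨m, rfl⟩
    push_cast
    exact Dvd.intro _ rfl

theorem ppow_dvd_iff_val {i : ℕ} (hi : i ≤ k) (x : ZMod (p ^ k)) :
    (p : ZMod (p ^ k)) ^ i ∣ x ↔ p ^ i ∣ x.val := by
  conv_lhs => rw [← ZMod.natCast_zmod_val x]
  exact ppow_dvd_natCast_iff hi _

omit hp in
theorem ppow_eq_zero : (p : ZMod (p ^ k)) ^ k = 0 := by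
  rw [← Nat.cast_pow, ZMod.natCast_self]

theorem isUnit_iff_not_p_dvd (hk : 1 ≤ k) (x : ZMod (p ^ k)) :
    IsUnit x ↔ ¬ (p : ZMod (p ^ k)) ∣ x := by
  have h := ppow_dvd_iff_val hk x
  rw [pow_one, pow_one] at h
  rw [h]
  conv_lhs => rw [← ZMod.natCast_zmod_val x]
  rw [ZMod.isUnit_iff_coprime, Nat.coprime_pow_right_iff hk, Nat.coprime_comm,
    hp.out.coprime_iff_not_dvd]

theorem not_isUnit_iff_p_dvd (hk : 1 ≤ k) (x : ZMod (p ^ k)) :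
    ¬ IsUnit x ↔ (p : ZMod (p ^ k)) ∣ x := by
  rw [isUnit_iff_not_p_dvd hk, not_not]

theorem isUnit_of_not_p_dvd (x : ZMod (p ^ k)) (h : ¬ (p : ZMod (p ^ k)) ∣ x) : IsUnit x := by
  rcases Nat.eq_zero_or_pos k with rfl | hk
  · have : Subsingleton (ZMod (p ^ 0)) := inferInstanceAs (Subsingleton (ZMod 1))
    exact isUnit_of_subsingleton x
  · exact (isUnit_iff_not_p_dvd hk x).2 h

theorem exists_eq_ppow_mul_unit (x : ZMod (p ^ k)) :
    ∃ i ≤ k, ∃ v : (ZMod (p ^ k))ˣ, x = p ^ i * v := by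
  classical
  have h : ∃ i, i = k ∨ ¬ (p : ZMod (p ^ k)) ^ (i + 1) ∣ x := ⟨k, Or.inl rfl⟩
  have hm : ∀ i < Nat.find h, (p : ZMod (p ^ k)) ^ (i + 1) ∣ x := fun i hi => by
    have := Nat.find_min h hi
    push Not at this
    exact this.2
  have hle : Nat.find h ≤ k := Nat.find_min' h (Or.inl rfl)
  have hd : (p : ZMod (p ^ k)) ^ (Nat.find h) ∣ x := by
    rcases Nat.eq_zero_or_pos (Nat.find h) with h0 | h0
    · rw [h0, pow_zero]; exact one_dvd x
    · have := hm (Nat.find h - 1) (by omega)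
      rwa [Nat.sub_add_cancel h0] at this
  refine ⟨Nat.find h, hle, ?_⟩
  generalize hj : Nat.find h = j at *
  have hs := Nat.find_spec h
  rw [hj] at hs
  obtain ⟨y, hy⟩ := hd
  rcases hs with hk | hk
  · refine ⟨1, ?_⟩
    rw [hy, hk, ppow_eq_zero, zero_mul, zero_mul]
  · have hu : IsUnit y := isUnit_of_not_p_dvd y fun ⟨z, hz⟩ =>
      hk ⟨z, by rw [hy, hz, pow_succ, mul_assoc]⟩
    exact ⟨hu.unit, hy⟩

theorem ppow_mul_eq_zero_iff {i : ℕ} (hi : i ≤ k) (y : ZMod (p ^ k)) :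
    (p : ZMod (p ^ k)) ^ i * y = 0 ↔ (p : ZMod (p ^ k)) ^ (k - i) ∣ y := by
  constructor
  · intro h
    rw [ppow_dvd_iff_val (Nat.sub_le k i)]
    rw [← ZMod.natCast_zmod_val y] at h
    norm_cast at h
    rw [ZMod.natCast_eq_zero_iff] at h
    have hsplit : p ^ k = p ^ i * p ^ (k - i) := by rw [← pow_add, Nat.add_sub_of_le hi]
    generalize y.val = t at *
    rw [hsplit] at h
    have := Nat.dvd_of_mul_dvd_mul_left (pow_pos hp.out.pos i) h
    exact this
  · rintro ⟨z, rfl⟩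
    rw [← mul_assoc, ← pow_add, Nat.add_sub_of_le hi, ppow_eq_zero, zero_mul]

theorem card_filter_ppow_dvd {i : ℕ} (hi : i ≤ k) :
    #{x : ZMod (p ^ k) | (p : ZMod (p ^ k)) ^ i ∣ x} = p ^ (k - i) := by
  have hinj : Function.Injective (fun t : Fin (p ^ (k - i)) => ((p ^ i * t : ℕ) : ZMod (p ^ k))) := by
    intro a b hab
    simp only at hab
    have hsplit : p ^ k = p ^ i * p ^ (k - i) := by rw [← pow_add, Nat.add_sub_of_le hi]
    rw [ZMod.natCast_eq_natCast_iff', hsplit, Nat.mul_mod_mul_left,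
      Nat.mul_mod_mul_left] at hab
    have := Nat.eq_of_mul_eq_mul_left (pow_pos hp.out.pos i) hab
    rw [Nat.mod_eq_of_lt a.2, Nat.mod_eq_of_lt b.2] at this
    exact Fin.ext this
  have : (Finset.univ.filter fun x : ZMod (p ^ k) => (p : ZMod (p ^ k)) ^ i ∣ x) =
      Finset.univ.image (fun t : Fin (p ^ (k - i)) => ((p ^ i * t : ℕ) : ZMod (p ^ k))) := by
    ext x
    simp only [mem_filter, Finset.mem_univ, true_and, Finset.mem_image]
    constructor
    · intro h
      rw [ppow_dvd_iff_val hi] at h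
      obtain ⟨m, hm⟩ := h
      have hlt : m < p ^ (k - i) := by
        have h1 := ZMod.val_lt x
        rw [hm] at h1
        conv_rhs at h1 => rw [← Nat.add_sub_of_le hi, pow_add]
        exact Nat.lt_of_mul_lt_mul_left h1
      exact ⟨⟨m, hlt⟩, by simp only; rw [← hm, ZMod.natCast_zmod_val]⟩
    · rintro ⟨t, rfl⟩
      exact (ppow_dvd_natCast_iff hi _).2 (Dvd.intro _ rfl)
  rw [this, Finset.card_image_of_injective _ hinj]
  simp

theorem card_filter_ppow_mul_eq_zero {i : ℕ} (hi : i ≤ k) :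
    #{x : ZMod (p ^ k) | (p : ZMod (p ^ k)) ^ i * x = 0} = p ^ i := by
  have := card_filter_ppow_dvd (p := p) (Nat.sub_le k i)
  rw [Nat.sub_sub_self hi] at this
  rw [← this]
  congr 1
  ext x
  simp [ppow_mul_eq_zero_iff hi]

theorem card_zmod_units_prime_pow (hk : 1 ≤ k) :
    Fintype.card (ZMod (p ^ k))ˣ = p ^ k - p ^ (k - 1) := by
  rw [ZMod.card_units_eq_totient, Nat.totient_prime_pow hp.out hk, Nat.mul_sub, mul_one]
  congr 1
  rw [← pow_succ, Nat.sub_add_cancel hk]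

theorem isUnit_natCast_of_not_dvd (n : ℕ) (h : ¬ p ∣ n) : IsUnit (n : ZMod (p ^ k)) := by
  rw [ZMod.isUnit_iff_coprime]
  exact Nat.Coprime.pow_right k ((hp.out.coprime_iff_not_dvd.2 h).symm)

theorem isUnit_add_of_p_dvd (hk : 1 ≤ k) {x y : ZMod (p ^ k)} (hx : IsUnit x)
    (hy : (p : ZMod (p ^ k)) ∣ y) : IsUnit (x + y) := by
  rw [isUnit_iff_not_p_dvd hk] at *
  exact fun h => hx ((dvd_add_left hy).1 h)

variable (p k) in
/-- Reduction modulo `p`. -/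
noncomputable def red (hk : 1 ≤ k) : ZMod (p ^ k) →+* ZMod p :=
  ZMod.castHom (dvd_pow_self p (by omega)) (ZMod p)

theorem red_natCast (hk : 1 ≤ k) (n : ℕ) : red p k hk n = n := map_natCast _ n

theorem red_surjective (hk : 1 ≤ k) : Function.Surjective (red p k hk) := fun x =>
  ⟨(x.val : ZMod (p ^ k)), by rw [red_natCast, ZMod.natCast_zmod_val]⟩

theorem red_eq_zero_iff (hk : 1 ≤ k) (x : ZMod (p ^ k)) :
    red p k hk x = 0 ↔ (p : ZMod (p ^ k)) ∣ x := by
  have h := ppow_dvd_iff_val hk x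
  rw [pow_one, pow_one] at h
  rw [h]
  conv_lhs => rw [← ZMod.natCast_zmod_val x, red_natCast]
  exact ZMod.natCast_eq_zero_iff _ _

theorem isUnit_red_iff (hk : 1 ≤ k) (x : ZMod (p ^ k)) :
    IsUnit (red p k hk x) ↔ IsUnit x := by
  rw [isUnit_iff_not_p_dvd hk, ← red_eq_zero_iff hk, isUnit_iff_ne_zero]

theorem ppow_mul_eq_of_red_eq (hk : 1 ≤ k) {x y : ZMod (p ^ k)}
    (h : red p k hk x = red p k hk y) :
    (p : ZMod (p ^ k)) ^ (k - 1) * x = (p : ZMod (p ^ k)) ^ (k - 1) * y := by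
  rw [← sub_eq_zero, ← mul_sub, ppow_mul_eq_zero_iff (Nat.sub_le k 1), Nat.sub_sub_self hk, pow_one,
    ← red_eq_zero_iff hk, map_sub, h, sub_self]

end PrimePowerRing

theorem AddChar.map_sum_univ {A ι N : Type*} [AddCommMonoid A] [CommMonoid N] [Fintype ι]
    (ψ : AddChar A N) (f : ι → A) : ψ (∑ i, f i) = ∏ i, ψ (f i) := by
  classical
  induction (Finset.univ : Finset ι) using Finset.induction_on with
  | empty => simp
  | insert a t ha ih => rw [Finset.sum_insert ha, Finset.prod_insert ha, map_add_eq_mul, ih]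

section QuadraticExponentialSums

variable {R : Type*} [CommRing R] {n : Type*} [Fintype n]

theorem quadratic_add {M : Matrix n n R} (hM : M.IsSymm) (x y : n → R) :
    (x + y) ⬝ᵥ M *ᵥ (x + y) = x ⬝ᵥ M *ᵥ x + 2 * (M *ᵥ y ⬝ᵥ x) + y ⬝ᵥ M *ᵥ y := by
  have h : y ⬝ᵥ M *ᵥ x = x ⬝ᵥ M *ᵥ y := by
    rw [Matrix.dotProduct_mulVec, ← Matrix.mulVec_transpose, hM.eq, dotProduct_comm]
  rw [Matrix.mulVec_add, add_dotProduct, dotProduct_add, dotProduct_add, h,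
    dotProduct_comm (M *ᵥ y) x]
  ring

theorem mulVec_dotProduct_of_isSymm {M : Matrix n n R} (hM : M.IsSymm) (x y : n → R) :
    M *ᵥ x ⬝ᵥ y = x ⬝ᵥ M *ᵥ y := by
  rw [Matrix.dotProduct_mulVec, ← Matrix.mulVec_transpose, hM.eq]

theorem smul_quadratic (m : R) (M : Matrix n n R) (x : n → R) :
    x ⬝ᵥ (m • M) *ᵥ x = m * (x ⬝ᵥ M *ᵥ x) := by
  rw [Matrix.smul_mulVec, dotProduct_smul, smul_eq_mul]

variable [Fintype R] [DecidableEq R] [DecidableEq n] {ψ : AddChar R ℂ}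

theorem sum_addChar_dotProduct (hψ : ψ.IsPrimitive) (v : n → R) :
    ∑ b : n → R, ψ (v ⬝ᵥ b) =
      if v = 0 then (Fintype.card R : ℂ) ^ Fintype.card n else 0 := by
  have h1 : ∀ b : n → R, ψ (v ⬝ᵥ b) = ∏ i, ψ (b i * v i) := fun b => by
    rw [dotProduct, AddChar.map_sum_univ]
    simp only [mul_comm]
  simp only [h1]
  rw [← Fintype.piFinset_univ, ← Finset.prod_univ_sum (fun _ : n => (Finset.univ : Finset R))
    (fun i x => ψ (x * v i))]
  simp only [AddChar.sum_mulShift _ hψ]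
  split_ifs with h
  · subst h
    simp
  · obtain ⟨i, hi⟩ := Function.ne_iff.1 h
    refine Finset.prod_eq_zero (Finset.mem_univ i) ?_
    simp only [Pi.zero_apply] at hi
    simp [hi]

variable (ψ) in
/-- The quadratic exponential sum with matrix `M` and linear part `u`. -/
noncomputable def quadSum (M : Matrix n n R) (u : n → R) : ℂ :=
  ∑ z : n → R, ψ (z ⬝ᵥ M *ᵥ z + u ⬝ᵥ z)

theorem quadSum_mul_conj (hψ : ψ.IsPrimitive) {M : Matrix n n R} (hM : M.IsSymm) (u : n → R) :
    ((‖quadSum ψ M u‖ ^ 2 : ℝ) : ℂ) =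
      ∑ h : n → R, ψ (h ⬝ᵥ M *ᵥ h + u ⬝ᵥ h) *
        (if (2 : R) • M *ᵥ h = 0 then (Fintype.card R : ℂ) ^ Fintype.card n else 0) := by
  have h2 : ((‖quadSum ψ M u‖ ^ 2 : ℝ) : ℂ) = quadSum ψ M u * (starRingEnd ℂ) (quadSum ψ M u) := by
    rw [Complex.mul_conj, Complex.normSq_eq_norm_sq]
  rw [h2]
  rw [quadSum, map_sum, Finset.sum_mul_sum, Finset.sum_comm]
  have h1 : ∀ c : n → R, ∑ b : n → R, ψ (b ⬝ᵥ M *ᵥ b + u ⬝ᵥ b) *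
      (starRingEnd ℂ) (ψ (c ⬝ᵥ M *ᵥ c + u ⬝ᵥ c)) =
      ∑ h : n → R, ψ (h ⬝ᵥ M *ᵥ h + u ⬝ᵥ h) * ψ (((2 : R) • M *ᵥ h) ⬝ᵥ c) := fun c => by
    rw [← Equiv.sum_comp (Equiv.addRight c)]
    refine Finset.sum_congr rfl fun h _ => ?_
    rw [← AddChar.map_neg_eq_conj, ← AddChar.map_add_eq_mul, ← AddChar.map_add_eq_mul]
    congr 1
    change (h + c) ⬝ᵥ M *ᵥ (h + c) + u ⬝ᵥ (h + c) + _ = _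
    rw [quadratic_add hM, dotProduct_add, smul_dotProduct,
      smul_eq_mul, mulVec_dotProduct_of_isSymm hM h c, dotProduct_comm (M *ᵥ c) h]
    ring
  simp only [h1]
  rw [Finset.sum_comm]
  refine Finset.sum_congr rfl fun h _ => ?_
  rw [← Finset.mul_sum, sum_addChar_dotProduct hψ]

theorem normSq_quadSum_le (hψ : ψ.IsPrimitive) {M : Matrix n n R} (hM : M.IsSymm) (u : n → R) :
    ‖quadSum ψ M u‖ ^ 2 ≤ (Fintype.card R : ℝ) ^ Fintype.card n *
      #{w : n → R | (2 : R) • M *ᵥ w = 0} := by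
  have h3 : ‖quadSum ψ M u‖ ^ 2 = ‖((‖quadSum ψ M u‖ ^ 2 : ℝ) : ℂ)‖ := by
    rw [Complex.norm_real, Real.norm_of_nonneg (sq_nonneg _)]
  rw [h3, quadSum_mul_conj hψ hM]
  refine (norm_sum_le _ _).trans ?_
  rw [mul_comm, ← nsmul_eq_mul, ← Finset.sum_const, Finset.sum_filter]
  refine Finset.sum_le_sum fun h _ => ?_
  rw [norm_mul, AddChar.norm_apply, one_mul]
  split_ifs <;> simp

theorem normSq_quadSum_of_forall_mulVec_ne_zero (hψ : ψ.IsPrimitive) {M : Matrix n n R}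
    (hM : M.IsSymm) (u : n → R) (h : ∀ w, (2 : R) • M *ᵥ w = 0 → w = 0) :
    ‖quadSum ψ M u‖ ^ 2 = (Fintype.card R : ℝ) ^ Fintype.card n := by
  have h1 := quadSum_mul_conj hψ hM u
  rw [Finset.sum_eq_single 0 (fun w _ hw => by rw [if_neg fun h2 => hw (h w h2), mul_zero])
    (by simp)] at h1
  simp only [Matrix.mulVec_zero, dotProduct_zero, add_zero, AddChar.map_zero_eq_one, one_mul,
    smul_zero, if_true] at h1
  exact_mod_cast h1

omit [DecidableEq R] in
theorem quadSum_eq_of_isUnit_det {M : Matrix n n R} (hM : M.IsSymm) (hd : IsUnit M.det) (u : n → R)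
    {t : R} (ht : 2 * t = 1) :
    quadSum ψ M u = ψ (-(t ^ 2 * (u ⬝ᵥ M⁻¹ *ᵥ u))) * quadSum ψ M 0 := by
  have hMu : M *ᵥ (M⁻¹ *ᵥ u) = u := by
    rw [Matrix.mulVec_mulVec, Matrix.mul_nonsing_inv _ hd, Matrix.one_mulVec]
  rw [quadSum, quadSum, ← Equiv.sum_comp (Equiv.addRight (-(t • M⁻¹ *ᵥ u))), Finset.mul_sum]
  refine Finset.sum_congr rfl fun z _ => ?_
  rw [← AddChar.map_add_eq_mul]
  congr 1
  rw [Equiv.coe_addRight, quadratic_add hM, Matrix.mulVec_neg, Matrix.mulVec_smul, hMu]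
  simp only [neg_dotProduct, dotProduct_neg, smul_dotProduct, dotProduct_smul, dotProduct_add,
    zero_dotProduct, smul_eq_mul, dotProduct_comm (M⁻¹ *ᵥ u) u]
  linear_combination (-(u ⬝ᵥ z) + t * (u ⬝ᵥ M⁻¹ *ᵥ u)) * ht

end QuadraticExponentialSums

section FiniteFieldGauss

variable {F : Type*} [Field F] [Fintype F] [DecidableEq F]

variable (F) in
/-- The quadratic character with complex values. -/
noncomputable def quadCharC : MulChar F ℂ := (quadraticChar F).ringHomComp (Int.castRingHom ℂ)

theorem quadCharC_sq {a : F} (ha : a ≠ 0) : quadCharC F a ^ 2 = 1 := by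
  have := quadraticChar_sq_one ha
  rw [quadCharC, MulChar.ringHomComp_apply, ← map_pow, this, map_one]

theorem norm_quadCharC {a : F} (ha : a ≠ 0) : ‖quadCharC F a‖ = 1 := by
  have := congrArg norm (quadCharC_sq ha)
  rw [norm_pow, norm_one] at this
  exact (pow_eq_one_iff_of_nonneg (norm_nonneg _) two_ne_zero).1 this

variable (hF : ringChar F ≠ 2) {ψ : AddChar F ℂ}
include hF

theorem quadCharC_ne_one : quadCharC F ≠ 1 := by
  intro h
  obtain ⟨a, ha⟩ := quadraticChar_exists_neg_one' hF
  have h1 := congrArg (fun χ => χ (a : F)) h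
  simp only [quadCharC, MulChar.ringHomComp_apply, ha, MulChar.one_apply_coe] at h1
  norm_num at h1

theorem norm_gaussSum_quadCharC_sq (hψ : ψ.IsPrimitive) :
    ‖gaussSum (quadCharC F) ψ‖ ^ 2 = Fintype.card F := by
  have hq : (quadCharC F).IsQuadratic :=
    (quadraticChar_isQuadratic F).comp _
  have := congrArg norm (gaussSum_sq (quadCharC_ne_one hF) hq hψ)
  rw [norm_pow, norm_mul, norm_quadCharC (neg_ne_zero.2 one_ne_zero), one_mul] at this
  simpa using this

theorem sum_addChar_sq_mul (hψ : ψ.IsPrimitive) {c : F} (hc : c ≠ 0) :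
    ∑ y : F, ψ (c * y ^ 2) = quadCharC F c * gaussSum (quadCharC F) ψ := by
  have h1 : ∑ y : F, ψ (c * y ^ 2) =
      ∑ t : F, (quadCharC F t + 1) * ψ (c * t) := by
    rw [← Finset.sum_fiberwise Finset.univ (fun y : F => y ^ 2)]
    refine Finset.sum_congr rfl fun t _ => ?_
    rw [Finset.sum_congr rfl (g := fun _ => ψ (c * t))
      (fun y hy => by rw [(Finset.mem_filter.1 hy).2]), Finset.sum_const, nsmul_eq_mul]
    congr 1
    have := quadraticChar_card_sqrts hF t
    have h2 : (Finset.univ.filter fun y : F => y ^ 2 = t) = {x : F | x ^ 2 = t}.toFinset := by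
      ext; simp
    rw [h2, quadCharC, MulChar.ringHomComp_apply]
    have h3 := congrArg (Int.cast : ℤ → ℂ) this
    push_cast at h3
    exact h3
  have h4 : ∑ t : F, ψ (c * t) = 0 := by
    have := AddChar.sum_mulShift c hψ
    simp only [mul_comm _ c] at this
    rw [this]
    simp [hc]
  have h5 := gaussSum_mulShift (quadCharC F) ψ (Units.mk0 c hc)
  rw [h1]
  simp only [add_mul, one_mul, Finset.sum_add_distrib, h4, add_zero]
  have h6 := quadCharC_sq hc
  rw [← h5]
  simp only [Units.val_mk0]
  rw [← mul_assoc, ← sq, h6, one_mul]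
  rfl

theorem quadSum_smul_field (hψ : ψ.IsPrimitive) {n : Type*} [Fintype n] [DecidableEq n]
    {N : Matrix n n F} (hN : N.IsSymm) (hd : N.det ≠ 0) {m : F} (hm : m ≠ 0) :
    quadSum ψ (m • N) 0 = quadCharC F m ^ Fintype.card n * quadSum ψ N 0 := by
  have h2 : (2 : F) ≠ 0 := Ring.two_ne_zero hF
  have : Invertible (2 : F) := invertibleOfNonzero h2
  let Q : QuadraticForm F (n → F) := N.toQuadraticForm'
  have hQ : ∀ z, Q z = z ⬝ᵥ N *ᵥ z := fun z => by
    exact Matrix.toLinearMap₂'_apply' N z z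
  have hsep : (QuadraticMap.associated (R := F) Q).SeparatingLeft := by
    intro x hx
    have h3 : ∀ y, N *ᵥ x ⬝ᵥ y = 0 := fun y => by
      have h4 : (2 : F) * (N *ᵥ x ⬝ᵥ y) = 0 := by
        have := congrArg (fun B => B x y) (QuadraticMap.two_nsmul_associated F Q)
        simp only [LinearMap.smul_apply, hx y, smul_zero, QuadraticMap.polarBilin_apply_apply,
          QuadraticMap.polar, hQ] at this
        rw [add_comm x y, quadratic_add hN] at this
        linear_combination -this
      exact (mul_eq_zero.1 h4).resolve_left h2
    have h5 : N *ᵥ x = 0 := dotProduct_eq_zero _ h3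
    exact Matrix.eq_zero_of_mulVec_eq_zero hd h5
  obtain ⟨w, ⟨e⟩⟩ := QuadraticForm.equivalent_weightedSumSquares_units_of_nondegenerate' Q hsep
  have hgen : ∀ c : F, c ≠ 0 → quadSum ψ (c • N) 0 =
      ∏ i, (quadCharC F (c * w i) * gaussSum (quadCharC F) ψ) := by
    intro c hc
    have h6 : ∀ z, ψ (z ⬝ᵥ (c • N) *ᵥ z + 0 ⬝ᵥ z) =
        ∏ i, ψ (c * w i * (e z i) ^ 2) := fun z => by
      rw [← AddChar.map_sum_univ, smul_quadratic, zero_dotProduct, add_zero, ← hQ, ← e.map_app]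
      simp only [QuadraticMap.weightedSumSquares_apply, Finset.mul_sum]
      congr 1
      refine Finset.sum_congr rfl fun i _ => ?_
      simp only [Units.smul_def, smul_eq_mul]
      ring
    rw [quadSum]
    simp only [h6]
    have h7 := Equiv.sum_comp e.toLinearEquiv.toEquiv (fun y => ∏ i, ψ (c * w i * (y i) ^ 2))
    refine Eq.trans h7 ?_
    rw [← Fintype.piFinset_univ, ← Finset.prod_univ_sum (fun _ => (Finset.univ : Finset F))
        (fun i x => ψ (c * w i * x ^ 2))]
    refine Finset.prod_congr rfl fun i _ => ?_
    exact sum_addChar_sq_mul hF hψ (mul_ne_zero hc (w i).ne_zero)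
  have h1 := hgen 1 one_ne_zero
  rw [one_smul] at h1
  rw [h1, hgen m hm]
  simp only [one_mul, map_mul, mul_assoc]
  rw [Finset.prod_mul_distrib, Finset.prod_const, Finset.card_univ, Fintype.card_fin]
  congr 2
  exact Module.finrank_fintype_fun_eq_card F

end FiniteFieldGauss

section FiberSum

theorem sum_comp_addMonoidHom {A B : Type*} [AddCommGroup A] [AddCommGroup B] [Fintype A]
    [Fintype B] [DecidableEq B] (φ : A →+ B) (F : B → ℂ) :
    ∑ a, F (φ a) = (#{a | φ a = 0} : ℂ) * ∑ b with ∃ a, φ a = b, F b := by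
  rw [← Finset.sum_fiberwise Finset.univ φ, Finset.sum_filter, Finset.mul_sum]
  refine Finset.sum_congr rfl fun b _ => ?_
  rw [Finset.sum_congr rfl (g := fun _ => F b)
    (fun a ha => by rw [(Finset.mem_filter.1 ha).2]), Finset.sum_const, nsmul_eq_mul]
  split_ifs with h
  · congr 2
    obtain ⟨a₀, ha₀⟩ := h
    refine Finset.card_bij (fun a _ => a - a₀) ?_ ?_ ?_
    · intro a ha
      simp only [mem_filter, Finset.mem_univ, true_and] at ha ⊢
      rw [map_sub, ha, ha₀, sub_self]
    · intro a _ a' _ h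
      exact sub_left_injective h
    · intro a ha
      simp only [mem_filter, Finset.mem_univ, true_and] at ha
      exact ⟨a + a₀, by simp [ha, ha₀], by simp⟩
  · rw [Finset.filter_eq_empty_iff.2 fun a _ ha => h ⟨a, ha⟩]
    simp

end FiberSum

section PrimePowerGauss

variable {p : ℕ} [hp : Fact p.Prime] {k : ℕ} (hk : 1 ≤ k)

include hk in
theorem ppow_pred_ne_zero : (p : ZMod (p ^ k)) ^ (k - 1) ≠ 0 := by
  intro h
  have h1 := (ppow_mul_eq_zero_iff (p := p) (Nat.sub_le k 1) 1).1 (by rw [h, zero_mul])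
  rw [Nat.sub_sub_self hk, pow_one] at h1
  exact (isUnit_iff_not_p_dvd hk (1 : ZMod (p ^ k))).1 isUnit_one h1

/-- The additive character modulo `p` induced by restricting `ψ` to `p ^ (k - 1)`. -/
noncomputable def residueChar (ψ : AddChar (ZMod (p ^ k)) ℂ) : AddChar (ZMod p) ℂ where
  toFun y := ψ ((p : ZMod (p ^ k)) ^ (k - 1) * (y.val : ZMod (p ^ k)))
  map_zero_eq_one' := by simp
  map_add_eq_mul' x y := by
    rw [← AddChar.map_add_eq_mul, ← mul_add]
    congr 1
    refine ppow_mul_eq_of_red_eq hk ?_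
    rw [map_add, red_natCast, red_natCast, red_natCast, ZMod.natCast_zmod_val,
      ZMod.natCast_zmod_val, ZMod.natCast_zmod_val]

theorem residueChar_red (ψ : AddChar (ZMod (p ^ k)) ℂ) (x : ZMod (p ^ k)) :
    residueChar hk ψ (red p k hk x) = ψ ((p : ZMod (p ^ k)) ^ (k - 1) * x) := by
  change ψ _ = ψ _
  congr 1
  refine ppow_mul_eq_of_red_eq hk ?_
  rw [red_natCast, ZMod.natCast_zmod_val]

variable {ψ : AddChar (ZMod (p ^ k)) ℂ} (hψ : ψ.IsPrimitive)

include hψ in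
theorem isPrimitive_residueChar : (residueChar hk ψ).IsPrimitive := by
  refine AddChar.IsPrimitive.of_ne_one fun h => ?_
  refine hψ (ppow_pred_ne_zero (p := p) hk) ?_
  ext x
  rw [AddChar.mulShift_apply, ← residueChar_red hk, h]
  rfl

variable (p k) in
/-- The quadratic character modulo `p`, lifted to `ZMod (p ^ k)`. -/
noncomputable def chi (x : ZMod (p ^ k)) : ℂ := quadCharC (ZMod p) (red p k hk x)

theorem chi_sq {x : ZMod (p ^ k)} (hx : IsUnit x) : chi p k hk x ^ 2 = 1 :=
  quadCharC_sq ((isUnit_red_iff hk x).2 hx).ne_zero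

theorem norm_chi {x : ZMod (p ^ k)} (hx : IsUnit x) : ‖chi p k hk x‖ = 1 :=
  norm_quadCharC ((isUnit_red_iff hk x).2 hx).ne_zero

theorem chi_pow_of_even {x : ZMod (p ^ k)} (hx : IsUnit x) {j : ℕ} (hj : Even j) :
    chi p k hk x ^ j = 1 := by
  obtain ⟨l, rfl⟩ := hj
  rw [← two_mul, pow_mul, chi_sq hk hx, one_pow]

theorem chi_pow_of_odd {x : ZMod (p ^ k)} (hx : IsUnit x) {j : ℕ} (hj : Odd j) :
    chi p k hk x ^ j = chi p k hk x := by
  obtain ⟨l, rfl⟩ := hj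
  rw [pow_succ, pow_mul, chi_sq hk hx, one_pow, one_mul]

theorem ringChar_zmod_ne_two (hp2 : p ≠ 2) : ringChar (ZMod p) ≠ 2 := by
  rwa [ZMod.ringChar_zmod_n]

theorem isUnit_two_zmod (hp2 : p ≠ 2) : IsUnit (2 : ZMod (p ^ k)) := by
  have := isUnit_natCast_of_not_dvd (p := p) (k := k) 2 fun h =>
    hp2 ((Nat.prime_dvd_prime_iff_eq hp.out Nat.prime_two).1 h)
  exact_mod_cast this

variable {n : Type*} [Fintype n] [DecidableEq n]

theorem card_filter_ppow_smul_eq_zero {i : ℕ} (hi : i ≤ k) :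
    #{w : n → ZMod (p ^ k) | (p : ZMod (p ^ k)) ^ i • w = 0} = (p ^ i) ^ Fintype.card n := by
  rw [← card_filter_ppow_mul_eq_zero (p := p) hi, ← Finset.card_univ (α := n), ← Finset.prod_const,
    ← Fintype.card_piFinset]
  congr 1
  ext w
  simp [funext_iff]

theorem mulVec_eq_zero_iff_of_isUnit_det {R : Type*} [CommRing R] {N : Matrix n n R}
    (hd : IsUnit N.det) (w : n → R) : N *ᵥ w = 0 ↔ w = 0 := by
  refine ⟨fun h => ?_, fun h => by rw [h, Matrix.mulVec_zero]⟩
  rw [← Matrix.one_mulVec w, ← Matrix.nonsing_inv_mul N hd, ← Matrix.mulVec_mulVec, h,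
    Matrix.mulVec_zero]

theorem smul_mulVec_eq_zero_iff {R : Type*} [CommRing R] {N : Matrix n n R}
    (hd : IsUnit N.det) (h2 : IsUnit (2 : R)) (t : R) (w : n → R) :
    (2 : R) • (t • N) *ᵥ w = 0 ↔ t • w = 0 := by
  rw [Matrix.smul_mulVec, ← Matrix.mulVec_smul, ← Matrix.mulVec_smul,
    mulVec_eq_zero_iff_of_isUnit_det hd]
  exact h2.smul_eq_zero

variable (hp2 : p ≠ 2)

include hψ hp2 in
theorem norm_quadSum_ppow_smul_sq_le {i : ℕ} (hi : i ≤ k) {N : Matrix n n (ZMod (p ^ k))}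
    (hN : N.IsSymm) (hd : IsUnit N.det) (u : n → ZMod (p ^ k)) :
    ‖quadSum ψ ((p : ZMod (p ^ k)) ^ i • N) u‖ ^ 2 ≤ ((p : ℝ) ^ Fintype.card n) ^ (k + i) := by
  refine (normSq_quadSum_le hψ (hN.smul _) u).trans (le_of_eq ?_)
  simp only [smul_mulVec_eq_zero_iff hd (isUnit_two_zmod hp2)]
  rw [card_filter_ppow_smul_eq_zero hi, ZMod.card]
  push_cast
  ring

include hψ hp2 in
theorem quadSum_ppow_smul_eq_sum_filter {i : ℕ} (hi : i ≤ k) {N : Matrix n n (ZMod (p ^ k))}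
    (hN : N.IsSymm) (hd : IsUnit N.det) :
    quadSum ψ ((p : ZMod (p ^ k)) ^ i • N) 0 =
      ∑ z : n → ZMod (p ^ k) with (p : ZMod (p ^ k)) ^ (i + (k - i + 1) / 2) • z = 0,
        ψ ((p : ZMod (p ^ k)) ^ i * (z ⬝ᵥ N *ᵥ z)) := by
  set h := (k - i + 1) / 2 with hh
  have hzero : ∀ x : ZMod (p ^ k), (p : ZMod (p ^ k)) ^ (i + h + h) * x = 0 := fun x => by
    rw [show i + h + h = k + (i + h + h - k) by omega, pow_add, ppow_eq_zero, zero_mul, zero_mul]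
  set c : ℂ := (Fintype.card (ZMod (p ^ k)) : ℂ) ^ Fintype.card n with hc
  have hc0 : c ≠ 0 := pow_ne_zero _ (by simp [hp.out.ne_zero])
  have key : c * quadSum ψ ((p : ZMod (p ^ k)) ^ i • N) 0 =
      ∑ z : n → ZMod (p ^ k), ψ ((p : ZMod (p ^ k)) ^ i * (z ⬝ᵥ N *ᵥ z)) *
        ∑ w : n → ZMod (p ^ k), ψ (((2 : ZMod (p ^ k)) •
          ((p : ZMod (p ^ k)) ^ (i + h) • N) *ᵥ z) ⬝ᵥ w) := by
    simp only [Finset.mul_sum]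
    rw [Finset.sum_comm]
    have : ∀ w : n → ZMod (p ^ k), ∑ z : n → ZMod (p ^ k),
        ψ ((p : ZMod (p ^ k)) ^ i * (z ⬝ᵥ N *ᵥ z)) * ψ (((2 : ZMod (p ^ k)) •
          ((p : ZMod (p ^ k)) ^ (i + h) • N) *ᵥ z) ⬝ᵥ w) =
        quadSum ψ ((p : ZMod (p ^ k)) ^ i • N) 0 := fun w => by
      rw [quadSum]
      conv_rhs => rw [← Equiv.sum_comp (Equiv.addRight ((p : ZMod (p ^ k)) ^ h • w))]
      refine Finset.sum_congr rfl fun z _ => ?_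
      rw [← AddChar.map_add_eq_mul]
      congr 1
      simp only [Equiv.coe_addRight, zero_dotProduct, add_zero, quadratic_add hN,
        Matrix.smul_mulVec, Matrix.mulVec_smul, smul_dotProduct, dotProduct_smul, smul_eq_mul]
      have h1 := hzero (w ⬝ᵥ N *ᵥ w)
      have h2 : w ⬝ᵥ N *ᵥ z = z ⬝ᵥ N *ᵥ w := by
        rw [← mulVec_dotProduct_of_isSymm hN, dotProduct_comm]
      rw [dotProduct_comm (N *ᵥ z) w, mulVec_dotProduct_of_isSymm hN w z, h2]
      linear_combination -h1
    rw [Finset.sum_congr rfl fun w _ => this w, Finset.sum_const, nsmul_eq_mul, Finset.card_univ,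
      Fintype.card_fun, hc]
    push_cast
    ring
  refine mul_left_cancel₀ hc0 (key.trans ?_)
  rw [Finset.sum_filter, Finset.mul_sum]
  refine Finset.sum_congr rfl fun z _ => ?_
  rw [sum_addChar_dotProduct hψ]
  simp only [smul_mulVec_eq_zero_iff hd (isUnit_two_zmod hp2)]
  split_ifs
  · ring
  · simp

end PrimePowerGauss

section PrimePowerGauss

variable {p : ℕ} [hp : Fact p.Prime] {k : ℕ} (hk : 1 ≤ k)
  {ψ : AddChar (ZMod (p ^ k)) ℂ} (hψ : ψ.IsPrimitive)
  {n : Type*} [Fintype n] [DecidableEq n] (hp2 : p ≠ 2)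

omit [DecidableEq n] in
theorem map_quadratic {R S : Type*} [CommRing R] [CommRing S] (φ : R →+* S) (N : Matrix n n R)
    (z : n → R) : φ (z ⬝ᵥ N *ᵥ z) = (φ ∘ z) ⬝ᵥ (N.map φ) *ᵥ (φ ∘ z) := by
  simp [dotProduct, Matrix.mulVec, map_sum, map_mul]

omit [Fintype n] [DecidableEq n] in
theorem ppow_smul_eq_zero_iff {i : ℕ} (hi : i ≤ k) (z : n → ZMod (p ^ k)) :
    (p : ZMod (p ^ k)) ^ i • z = 0 ↔ ∃ y, (p : ZMod (p ^ k)) ^ (k - i) • y = z := by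
  constructor
  · intro h
    have : ∀ j, ∃ y, (p : ZMod (p ^ k)) ^ (k - i) * y = z j := fun j => by
      obtain ⟨y, hy⟩ := (ppow_mul_eq_zero_iff hi (z j)).1 (congrFun h j)
      exact ⟨y, hy.symm⟩
    choose y hy using this
    exact ⟨y, funext hy⟩
  · rintro ⟨y, rfl⟩
    rw [smul_smul, ← pow_add, Nat.add_sub_of_le hi, ppow_eq_zero, zero_smul]

include hψ hp2 in
theorem exists_quadSum_ppow_smul_eq {i : ℕ} (hi : i ≤ k) :
    ∃ c : ℂ, ∀ N : Matrix n n (ZMod (p ^ k)), N.IsSymm → IsUnit N.det →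
      quadSum ψ ((p : ZMod (p ^ k)) ^ i • N) 0 =
        c * if Even (k - i) then 1 else quadSum (residueChar hk ψ) (N.map (red p k hk)) 0 := by
  set h := (k - i + 1) / 2 with hh
  have hih : i + h ≤ k := by omega
  set l := k - (i + h) with hl
  by_cases he : Even (k - i)
  · refine ⟨#{z : n → ZMod (p ^ k) | (p : ZMod (p ^ k)) ^ (i + h) • z = 0}, fun N hN hd => ?_⟩
    rw [quadSum_ppow_smul_eq_sum_filter hψ hp2 hi hN hd, if_pos he, mul_one,
      Finset.sum_congr rfl (g := fun _ => 1), Finset.sum_const, nsmul_eq_mul, mul_one]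
    intro z hz
    obtain ⟨y, rfl⟩ := (ppow_smul_eq_zero_iff hih z).1 (Finset.mem_filter.1 hz).2
    rw [Matrix.mulVec_smul, smul_dotProduct, dotProduct_smul, smul_eq_mul, smul_eq_mul, ← mul_assoc,
      ← mul_assoc, ← pow_add, ← pow_add]
    obtain ⟨e, he⟩ := he
    rw [show i + (k - (i + h)) + (k - (i + h)) = k by omega, ppow_eq_zero, zero_mul,
      AddChar.map_zero_eq_one]
  · rw [Nat.not_even_iff_odd] at he
    let φ : (n → ZMod (p ^ k)) →+ (n → ZMod (p ^ k)) :=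
      DistribSMul.toAddMonoidHom _ ((p : ZMod (p ^ k)) ^ l)
    let ρ : (n → ZMod (p ^ k)) →+ (n → ZMod p) :=
      (red p k hk).toAddMonoidHom.compLeft n
    have hφ : ∀ z, φ z = (p : ZMod (p ^ k)) ^ l • z := fun _ => rfl
    have hρ : ∀ z, ρ z = red p k hk ∘ z := fun _ => rfl
    have hK : (#{a | φ a = 0} : ℂ) ≠ 0 := by
      rw [Nat.cast_ne_zero]
      exact (Finset.card_pos.2 ⟨0, by simp⟩).ne'
    refine ⟨#{a | ρ a = 0} / #{a | φ a = 0}, fun N hN hd => ?_⟩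
    have h1 := sum_comp_addMonoidHom φ fun z => ψ ((p : ZMod (p ^ k)) ^ i * (z ⬝ᵥ N *ᵥ z))
    have h2 := sum_comp_addMonoidHom ρ
      fun z => residueChar hk ψ (z ⬝ᵥ (N.map (red p k hk)) *ᵥ z)
    have hsurj : ∀ b, ∃ a, ρ a = b := fun b => by
      choose f hf using red_surjective (p := p) hk
      exact ⟨fun j => f (b j), funext fun j => hf (b j)⟩
    rw [Finset.filter_true_of_mem fun b _ => hsurj b] at h2
    rw [quadSum_ppow_smul_eq_sum_filter hψ hp2 hi hN hd, if_neg (Nat.not_even_iff_odd.2 he)]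
    have h3 : (Finset.univ.filter fun b => ∃ a, φ a = b) =
        Finset.univ.filter
          (fun z : n → ZMod (p ^ k) => (p : ZMod (p ^ k)) ^ (i + h) • z = 0) := by
      ext z
      simp only [mem_filter, Finset.mem_univ, true_and, hφ]
      rw [ppow_smul_eq_zero_iff hih]
    rw [h3] at h1
    have h4 : ∀ z, ψ ((p : ZMod (p ^ k)) ^ i * (φ z ⬝ᵥ N *ᵥ φ z)) =
        residueChar hk ψ (ρ z ⬝ᵥ (N.map (red p k hk)) *ᵥ ρ z) := fun z => by
      rw [hρ, ← map_quadratic, residueChar_red, hφ, Matrix.mulVec_smul, smul_dotProduct,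
        dotProduct_smul, smul_eq_mul, smul_eq_mul, ← mul_assoc, ← mul_assoc, ← pow_add, ← pow_add]
      congr 3
      obtain ⟨e, he⟩ := he
      omega
    simp only [h4] at h1
    rw [h1] at h2
    rw [div_mul_eq_mul_div, eq_div_iff hK, mul_comm, h2, quadSum]
    simp only [zero_dotProduct, add_zero]

include hψ hp2 in
theorem quadSum_ppow_smul_unit_smul {i : ℕ} (hi : i ≤ k) {N : Matrix n n (ZMod (p ^ k))}
    (hN : N.IsSymm) (hd : IsUnit N.det) {m : ZMod (p ^ k)} (hm : IsUnit m) :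
    quadSum ψ ((p : ZMod (p ^ k)) ^ i • m • N) 0 =
      chi p k hk m ^ (Fintype.card n * (k - i)) * quadSum ψ ((p : ZMod (p ^ k)) ^ i • N) 0 := by
  obtain ⟨c, hc⟩ := exists_quadSum_ppow_smul_eq hk hψ (n := n) hp2 hi
  have hmd : IsUnit (m • N).det := by
    rw [Matrix.det_smul]
    exact (hm.pow _).mul hd
  rw [hc _ (hN.smul m) hmd, hc _ hN hd]
  split_ifs with he
  · rw [chi_pow_of_even hk hm (he.mul_left _)]
    ring
  · have h1 : (m • N).map (red p k hk) = red p k hk m • N.map (red p k hk) := by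
      ext
      simp
    rw [h1, quadSum_smul_field (ringChar_zmod_ne_two hp2) (isPrimitive_residueChar hk hψ)
      (by ext a b; simp [hN.apply]) _ ((isUnit_red_iff hk m).2 hm).ne_zero]
    · have : chi p k hk m ^ (Fintype.card n * (k - i)) = chi p k hk m ^ Fintype.card n := by
        rw [mul_comm, pow_mul, chi_pow_of_odd hk hm (Nat.not_even_iff_odd.1 he)]
      rw [this, chi]
      ring
    · rw [← RingHom.mapMatrix_apply, ← RingHom.map_det]
      exact ((isUnit_red_iff hk _).2 hd).ne_zero

include hψ hp2 in
theorem quadSum_ppow_smul_congr {i : ℕ} (hi : i ≤ k) {N N' : Matrix n n (ZMod (p ^ k))}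
    (hN : N.IsSymm) (hd : IsUnit N.det) (hN' : N'.IsSymm) (hd' : IsUnit N'.det)
    (h : N.map (red p k hk) = N'.map (red p k hk)) :
    quadSum ψ ((p : ZMod (p ^ k)) ^ i • N) 0 = quadSum ψ ((p : ZMod (p ^ k)) ^ i • N') 0 := by
  obtain ⟨c, hc⟩ := exists_quadSum_ppow_smul_eq hk hψ (n := n) hp2 hi
  rw [hc _ hN hd, hc _ hN' hd', h]

end PrimePowerGauss

section UnitSums

theorem sum_units_eq_sum_filter {R : Type*} [CommRing R] [Fintype R] [DecidableEq R]
    [DecidablePred (IsUnit : R → Prop)] {E : Type*} [AddCommMonoid E]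
    (F : R → E) : ∑ m : Rˣ, F m = ∑ x with IsUnit x, F x := by
  have : (Finset.univ.filter fun x : R => IsUnit x) =
      Finset.univ.map ⟨Units.val, Units.val_injective⟩ := by
    ext x
    rw [Finset.mem_filter, Finset.mem_map]
    simp [IsUnit]
  rw [this, Finset.sum_map]
  rfl

variable {p : ℕ} [hp : Fact p.Prime] {k : ℕ} (hk : 1 ≤ k)
  {ψ : AddChar (ZMod (p ^ k)) ℂ} (hψ : ψ.IsPrimitive)

variable (ψ) in
/-- Twisted sum over units `∑ χ(m)^e ψ(c / m)`. -/
noncomputable def unitSum (e : ℕ) (c : ZMod (p ^ k)) : ℂ :=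
  ∑ m : (ZMod (p ^ k))ˣ, chi p k hk m ^ e * ψ (↑m⁻¹ * c)

theorem chi_inv (m : (ZMod (p ^ k))ˣ) : chi p k hk ↑m⁻¹ = chi p k hk m := by
  have h1 : chi p k hk ↑m⁻¹ * chi p k hk m = 1 := by
    rw [chi, chi, ← map_mul, ← map_mul, Units.inv_mul, map_one, map_one]
  have h2 := chi_sq hk m.isUnit
  have h3 : chi p k hk (m : ZMod (p ^ k)) ≠ 0 := by
    intro h
    rw [h] at h1
    simp at h1
  refine mul_right_cancel₀ h3 ?_
  rw [h1, ← sq, h2]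

theorem unitSum_eq (e : ℕ) (c : ZMod (p ^ k)) :
    unitSum hk ψ e c = ∑ m : (ZMod (p ^ k))ˣ, chi p k hk m ^ e * ψ (m * c) := by
  rw [unitSum, ← Equiv.sum_comp (Equiv.inv _)]
  simp only [Equiv.inv_apply, chi_inv, inv_inv]

theorem norm_unitSum_le (e : ℕ) (c : ZMod (p ^ k)) :
    ‖unitSum hk ψ e c‖ ≤ (p : ℝ) ^ k - (p : ℝ) ^ (k - 1) := by
  refine (norm_sum_le _ _).trans (le_of_eq ?_)
  rw [Finset.sum_congr rfl (g := fun _ => 1) fun m _ => by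
    rw [norm_mul, norm_pow, norm_chi hk m.isUnit, AddChar.norm_apply, one_pow, one_mul]]
  rw [Finset.sum_const, nsmul_eq_mul, mul_one, Finset.card_univ, card_zmod_units_prime_pow hk,
    Nat.cast_sub (Nat.pow_le_pow_right hp.out.pos (Nat.sub_le k 1))]
  push_cast
  ring

include hψ in
theorem norm_unitSum_le_of_even {e : ℕ} (he : Even e) {c : ZMod (p ^ k)} (hc : c ≠ 0) :
    ‖unitSum hk ψ e c‖ ≤ (p : ℝ) ^ (k - 1) := by
  classical
  rw [unitSum_eq]
  simp only [chi_pow_of_even hk (Units.isUnit _) he, one_mul]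
  rw [sum_units_eq_sum_filter (fun x => ψ (x * c))]
  have h1 := AddChar.sum_mulShift c hψ
  rw [if_neg hc, ← Finset.sum_filter_add_sum_filter_not Finset.univ fun x => IsUnit x,
    Nat.cast_zero] at h1
  rw [eq_neg_of_add_eq_zero_left h1, norm_neg]
  refine (norm_sum_le _ _).trans ?_
  simp only [AddChar.norm_apply, Finset.sum_const, nsmul_eq_mul, mul_one, not_isUnit_iff_p_dvd hk]
  have := card_filter_ppow_dvd (p := p) hk
  simp only [pow_one] at this
  rw [this]
  push_cast
  rfl

variable (hp2 : p ≠ 2)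

include hψ in
theorem unitSum_eq_of_odd {e : ℕ} (he : Odd e) (c : ZMod (p ^ k)) :
    (∃ c', c = (p : ZMod (p ^ k)) ^ (k - 1) * c' ∧
      unitSum hk ψ e c = (p : ℂ) ^ (k - 1) *
        ∑ y : ZMod p, quadCharC (ZMod p) y * residueChar hk ψ (red p k hk c' * y)) ∨
    unitSum hk ψ e c = 0 := by
  classical
  have h1 : unitSum hk ψ e c = ∑ x, chi p k hk x * ψ (x * c) := by
    rw [unitSum_eq]
    simp only [chi_pow_of_odd hk (Units.isUnit _) he]
    rw [sum_units_eq_sum_filter (fun x => chi p k hk x * ψ (x * c)), Finset.sum_filter]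
    refine Finset.sum_congr rfl fun x _ => ?_
    split_ifs with hx
    · rfl
    · rw [not_isUnit_iff_p_dvd hk, ← red_eq_zero_iff hk] at hx
      rw [chi, hx, MulChar.map_zero, zero_mul]
  by_cases hpc : (p : ZMod (p ^ k)) * c = 0
  · left
    have := (ppow_mul_eq_zero_iff hk c).1 (by rwa [pow_one])
    obtain ⟨c', rfl⟩ := this
    refine ⟨c', rfl, ?_⟩
    have h2 := sum_comp_addMonoidHom (red p k hk).toAddMonoidHom
      fun y => quadCharC (ZMod p) y * residueChar hk ψ (red p k hk c' * y)
    have h3 : ∀ a, (red p k hk).toAddMonoidHom a = red p k hk a := fun _ => rfl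
    simp only [h3] at h2
    rw [Finset.filter_true_of_mem fun b _ => red_surjective hk b] at h2
    simp only [red_eq_zero_iff] at h2
    have h4 := card_filter_ppow_dvd (p := p) hk
    simp only [pow_one] at h4
    rw [h4] at h2
    rw [h1]
    push_cast at h2
    rw [← h2]
    refine Finset.sum_congr rfl fun x _ => ?_
    rw [chi, ← map_mul, residueChar_red]
    congr 2
    ring
  · right
    obtain ⟨h, hh⟩ : ∃ h, ψ ((p : ZMod (p ^ k)) * c * h) ≠ 1 := by
      by_contra! hcon
      refine hψ hpc ?_
      ext x
      rw [AddChar.mulShift_apply, hcon]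
      rfl
    have h2 : unitSum hk ψ e c = ψ ((p : ZMod (p ^ k)) * c * h) * unitSum hk ψ e c := by
      rw [h1]
      conv_lhs => rw [← Equiv.sum_comp (Equiv.addRight ((p : ZMod (p ^ k)) * h))]
      rw [Finset.mul_sum]
      refine Finset.sum_congr rfl fun x _ => ?_
      rw [Equiv.coe_addRight, chi, map_add, (red_eq_zero_iff hk ((p : ZMod (p ^ k)) * h)).2 (Dvd.intro _ rfl),
        add_zero, mul_left_comm, ← AddChar.map_add_eq_mul, chi]
      congr 2
      ring
    have h3 : (1 - ψ ((p : ZMod (p ^ k)) * c * h)) * unitSum hk ψ e c = 0 := by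
      linear_combination h2
    exact (mul_eq_zero.1 h3).resolve_left (sub_ne_zero.2 hh.symm)

include hp2 in
theorem sum_quadCharC_eq_zero : ∑ y : ZMod p, quadCharC (ZMod p) y = 0 :=
  MulChar.sum_eq_zero_of_ne_one (quadCharC_ne_one (ringChar_zmod_ne_two hp2))

include hψ hp2 in
theorem unitSum_zero_of_odd {e : ℕ} (he : Odd e) : unitSum hk ψ e 0 = 0 := by
  rcases unitSum_eq_of_odd hk hψ he 0 with ⟨c', h1, h2⟩ | h
  · have h3 := (ppow_mul_eq_zero_iff (Nat.sub_le k 1) c').1 h1.symm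
    rw [Nat.sub_sub_self hk, pow_one, ← red_eq_zero_iff hk] at h3
    rw [h2, h3]
    simp only [zero_mul, AddChar.map_zero_eq_one, mul_one]
    rw [sum_quadCharC_eq_zero hp2, mul_zero]
  · exact h

include hψ hp2 in
theorem norm_unitSum_le_of_odd {e : ℕ} (he : Odd e) (c : ZMod (p ^ k)) :
    ‖unitSum hk ψ e c‖ ≤ √(p : ℝ) ^ (2 * k - 1) := by
  rcases unitSum_eq_of_odd hk hψ he c with ⟨c', h1, h2⟩ | h
  · rw [h2, norm_mul]
    have hpow : √(p : ℝ) ^ (2 * k - 1) = (p : ℝ) ^ (k - 1) * √(p : ℝ) := by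
      rw [show 2 * k - 1 = 2 * (k - 1) + 1 by omega, pow_succ, pow_mul,
        Real.sq_sqrt (Nat.cast_nonneg p)]
    rw [hpow, norm_pow, Complex.norm_natCast]
    refine mul_le_mul_of_nonneg_left ?_ (by positivity)
    by_cases h3 : red p k hk c' = 0
    · rw [h3]
      simp only [zero_mul, AddChar.map_zero_eq_one, mul_one]
      rw [sum_quadCharC_eq_zero hp2, norm_zero]
      positivity
    · have h4 := gaussSum_mulShift (quadCharC (ZMod p)) (residueChar hk ψ) (Units.mk0 _ h3)
      have h5 := norm_gaussSum_quadCharC_sq (ringChar_zmod_ne_two hp2)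
        (isPrimitive_residueChar hk hψ)
      rw [← h4, norm_mul, Units.val_mk0, norm_quadCharC h3, one_mul, ZMod.card] at h5
      refine Real.le_sqrt_of_sq_le (le_of_eq ?_)
      rw [← h5]
      rfl
  · rw [h, norm_zero]
    positivity

end UnitSums

section LineSums

variable {p : ℕ} [hp : Fact p.Prime] {k : ℕ} (hk : 1 ≤ k)
  {ψ : AddChar (ZMod (p ^ k)) ℂ} (hψ : ψ.IsPrimitive)
  {n : Type*} [Fintype n] [DecidableEq n]

variable (ψ) in
/-- The sum of the quadratic exponential sums over all unit multiples of `M`. -/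
noncomputable def lineSum (M : Matrix n n (ZMod (p ^ k))) (u : n → ZMod (p ^ k)) : ℂ :=
  ∑ m : (ZMod (p ^ k))ˣ, quadSum ψ ((m : ZMod (p ^ k)) • M) u

variable (hp2 : p ≠ 2)

include hψ hp2 in
theorem norm_quadSum_le_of_isUnit_det {M : Matrix n n (ZMod (p ^ k))} (hM : M.IsSymm)
    (hd : IsUnit M.det) (u : n → ZMod (p ^ k)) :
    ‖quadSum ψ M u‖ ≤ √(p : ℝ) ^ (k * Fintype.card n) := by
  have h := norm_quadSum_ppow_smul_sq_le hψ hp2 (Nat.zero_le k) hM hd u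
  rw [pow_zero, one_smul, add_zero] at h
  refine le_of_sq_le_sq ?_ (by positivity)
  rw [← pow_mul, mul_comm _ 2, pow_mul, Real.sq_sqrt (Nat.cast_nonneg p), mul_comm k, pow_mul]
  exact h

omit hp in
theorem inv_unit_smul {M : Matrix n n (ZMod (p ^ k))} (hd : IsUnit M.det) (m : (ZMod (p ^ k))ˣ) :
    ((m : ZMod (p ^ k)) • M)⁻¹ = ((m⁻¹ : (ZMod (p ^ k))ˣ) : ZMod (p ^ k)) • M⁻¹ :=
  Matrix.inv_smul' M m hd

include hψ hp2 in
theorem quadSum_unit_smul {M : Matrix n n (ZMod (p ^ k))} (hM : M.IsSymm)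
    (hd : IsUnit M.det) (u : n → ZMod (p ^ k)) (m : (ZMod (p ^ k))ˣ) {t : ZMod (p ^ k)}
    (ht : 2 * t = 1) :
    quadSum ψ ((m : ZMod (p ^ k)) • M) u =
      chi p k hk m ^ (Fintype.card n * k) * ψ (↑m⁻¹ * -(t ^ 2 * (u ⬝ᵥ M⁻¹ *ᵥ u))) *
        quadSum ψ M 0 := by
  have hmd : IsUnit ((m : ZMod (p ^ k)) • M).det := by
    rw [Matrix.det_smul]
    exact (m.isUnit.pow _).mul hd
  have h := quadSum_ppow_smul_unit_smul hk hψ hp2 (Nat.zero_le k) hM hd m.isUnit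
  rw [pow_zero, one_smul, one_smul, Nat.sub_zero] at h
  rw [quadSum_eq_of_isUnit_det (hM.smul _) hmd u ht, h, inv_unit_smul hd, Matrix.smul_mulVec,
    dotProduct_smul, smul_eq_mul]
  rw [show -(t ^ 2 * (((m⁻¹ : (ZMod (p ^ k))ˣ) : ZMod (p ^ k)) * (u ⬝ᵥ M⁻¹ *ᵥ u))) =
    ↑m⁻¹ * -(t ^ 2 * (u ⬝ᵥ M⁻¹ *ᵥ u)) by ring]
  ring

include hψ hp2 in
theorem norm_lineSum_le_of_isUnit_det {M : Matrix n n (ZMod (p ^ k))} (hM : M.IsSymm)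
    (hd : IsUnit M.det) (u : n → ZMod (p ^ k)) {t : ZMod (p ^ k)} (ht : 2 * t = 1) :
    ‖lineSum ψ M u‖ ≤ √(p : ℝ) ^ (k * Fintype.card n) *
      ‖unitSum hk ψ (Fintype.card n * k) (-(t ^ 2 * (u ⬝ᵥ M⁻¹ *ᵥ u)))‖ := by
  rw [lineSum, Finset.sum_congr rfl fun m _ => quadSum_unit_smul hk hψ hp2 hM hd u m ht,
    ← Finset.sum_mul, norm_mul, mul_comm]
  exact mul_le_mul_of_nonneg_right (norm_quadSum_le_of_isUnit_det hψ hp2 hM hd 0) (norm_nonneg _)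

variable (ψ) in
/-- The one-variable quadratic Gauss sum. -/
noncomputable def gauss1 (c v : ZMod (p ^ k)) : ℂ := ∑ y, ψ (c * y ^ 2 + v * y)

/-- A `1 × 1` matrix. -/
def unitMatrix {R : Type*} (c : R) : Matrix Unit Unit R := Matrix.of fun _ _ => c

theorem isSymm_unitMatrix {R : Type*} (c : R) : (unitMatrix c).IsSymm := by
  ext
  rfl

theorem det_unitMatrix {R : Type*} [CommRing R] (c : R) : (unitMatrix c).det = c := by
  rw [Matrix.det_unique]
  rfl

theorem smul_unitMatrix {R : Type*} [CommRing R] (a c : R) :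
    a • unitMatrix c = unitMatrix (a * c) := by
  ext
  rfl

theorem gauss1_eq_quadSum (c v : ZMod (p ^ k)) :
    gauss1 ψ c v = quadSum ψ (unitMatrix c) fun _ => v := by
  rw [gauss1, quadSum, ← Equiv.sum_comp (Equiv.funUnique Unit (ZMod (p ^ k)))]
  refine Finset.sum_congr rfl fun z _ => ?_
  simp only [Equiv.funUnique_apply, dotProduct, Matrix.mulVec, unitMatrix, Matrix.of_apply,
    Finset.univ_unique, Finset.sum_singleton]
  congr 1
  ring

include hψ hp2 in
theorem norm_gauss1_zero_of_isUnit {c : ZMod (p ^ k)} (hc : IsUnit c) :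
    ‖gauss1 ψ c 0‖ = √(p : ℝ) ^ k := by
  have h := normSq_quadSum_of_forall_mulVec_ne_zero hψ (isSymm_unitMatrix c)
    (fun _ => (0 : ZMod (p ^ k))) fun w hw => by
      have := smul_mulVec_eq_zero_iff (N := unitMatrix c) (by rwa [det_unitMatrix])
        (isUnit_two_zmod hp2) 1 w
      rw [one_smul, one_smul] at this
      exact this.1 hw
  rw [← gauss1_eq_quadSum, ZMod.card] at h
  refine (pow_left_inj₀ (norm_nonneg _) (by positivity) two_ne_zero).1 ?_
  rw [h, ← pow_mul, mul_comm k, pow_mul, Real.sq_sqrt (Nat.cast_nonneg p)]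
  simp

include hψ hp2 in
theorem norm_gauss1_ppow_le {i : ℕ} (hi : i ≤ k) {c : ZMod (p ^ k)} (hc : IsUnit c)
    (v : ZMod (p ^ k)) : ‖gauss1 ψ (p ^ i * c) v‖ ≤ √(p : ℝ) ^ (k + i) := by
  have h := norm_quadSum_ppow_smul_sq_le hψ hp2 hi (isSymm_unitMatrix c)
    (by rwa [det_unitMatrix]) fun _ => v
  rw [smul_unitMatrix, ← gauss1_eq_quadSum, Fintype.card_unit, pow_one] at h
  refine le_of_sq_le_sq ?_ (by positivity)
  rwa [← pow_mul, mul_comm _ 2, pow_mul, Real.sq_sqrt (Nat.cast_nonneg p)]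

include hψ hp2 in
theorem gauss1_ppow_unit {i : ℕ} (hi : i ≤ k) {c m : ZMod (p ^ k)} (hc : IsUnit c)
    (hm : IsUnit m) :
    gauss1 ψ (p ^ i * (m * c)) 0 = chi p k hk m ^ (k - i) * gauss1 ψ (p ^ i * c) 0 := by
  have h := quadSum_ppow_smul_unit_smul hk hψ hp2 hi (isSymm_unitMatrix c)
    (by rwa [det_unitMatrix]) hm
  rw [smul_unitMatrix, smul_unitMatrix, smul_unitMatrix, Fintype.card_unit, one_mul] at h
  rw [gauss1_eq_quadSum, gauss1_eq_quadSum]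
  exact h

include hψ hp2 in
theorem gauss1_congr {c c' : ZMod (p ^ k)} (hc : IsUnit c) (hc' : IsUnit c')
    (h : red p k hk c = red p k hk c') : gauss1 ψ c 0 = gauss1 ψ c' 0 := by
  have h := quadSum_ppow_smul_congr hk hψ hp2 (Nat.zero_le k) (isSymm_unitMatrix c)
    (by rwa [det_unitMatrix]) (isSymm_unitMatrix c') (by rwa [det_unitMatrix])
    (by ext; simpa [unitMatrix] using h)
  rw [pow_zero, one_smul, one_smul] at h
  rw [gauss1_eq_quadSum, gauss1_eq_quadSum]
  exact h

theorem gauss1_complete_square (a v : ZMod (p ^ k)) (c : (ZMod (p ^ k))ˣ) {t : ZMod (p ^ k)}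
    (ht : 2 * t = 1) :
    gauss1 ψ (a * c) (a * v) = ψ (-(a * t ^ 2 * ↑c⁻¹ * v ^ 2)) * gauss1 ψ (a * c) 0 := by
  rw [gauss1, gauss1, ← Equiv.sum_comp (Equiv.addRight (-(t * ↑c⁻¹ * v))), Finset.mul_sum]
  refine Finset.sum_congr rfl fun y _ => ?_
  rw [← AddChar.map_add_eq_mul, Equiv.coe_addRight]
  congr 1
  have hc : (c : ZMod (p ^ k)) * ↑c⁻¹ = 1 := Units.mul_inv c
  linear_combination (-a * y * v * 2 * t + a * t ^ 2 * v ^ 2 * ↑c⁻¹) * hc +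
    (-a * y * v + a * t * v ^ 2 * ↑c⁻¹) * ht

include hψ in
theorem gauss1_eq_zero {i : ℕ} (hi : i ≤ k) (c : ZMod (p ^ k)) {v : ZMod (p ^ k)}
    (hv : ¬ (p : ZMod (p ^ k)) ^ i ∣ v) : gauss1 ψ (p ^ i * c) v = 0 := by
  have h1 : (p : ZMod (p ^ k)) ^ (k - i) * v ≠ 0 := by
    rwa [Ne, ppow_mul_eq_zero_iff (Nat.sub_le k i), Nat.sub_sub_self hi]
  obtain ⟨h, hh⟩ : ∃ h, ψ ((p : ZMod (p ^ k)) ^ (k - i) * v * h) ≠ 1 := by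
    by_contra! hcon
    refine hψ h1 ?_
    ext x
    rw [AddChar.mulShift_apply, hcon]
    rfl
  have h2 : gauss1 ψ (p ^ i * c) v =
      ψ ((p : ZMod (p ^ k)) ^ (k - i) * v * h) * gauss1 ψ (p ^ i * c) v := by
    rw [gauss1]
    conv_lhs => rw [← Equiv.sum_comp (Equiv.addRight ((p : ZMod (p ^ k)) ^ (k - i) * h))]
    rw [Finset.mul_sum]
    refine Finset.sum_congr rfl fun y _ => ?_
    rw [← AddChar.map_add_eq_mul, Equiv.coe_addRight]
    congr 1
    have h3 : (p : ZMod (p ^ k)) ^ i * (p : ZMod (p ^ k)) ^ (k - i) = 0 := by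
      rw [← pow_add, Nat.add_sub_of_le hi, ppow_eq_zero]
    linear_combination (2 * c * y * h + c * h ^ 2 * (p : ZMod (p ^ k)) ^ (k - i)) * h3
  have h3 : (1 - ψ ((p : ZMod (p ^ k)) ^ (k - i) * v * h)) * gauss1 ψ (p ^ i * c) v = 0 := by
    linear_combination h2
  exact (mul_eq_zero.1 h3).resolve_left (sub_ne_zero.2 hh.symm)

end LineSums

section SingularClass

variable {p : ℕ} [hp : Fact p.Prime] {k : ℕ} (hk : 1 ≤ k)
  {ψ : AddChar (ZMod (p ^ k)) ℂ} (hψ : ψ.IsPrimitive)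
  {n : Type*} [Fintype n] [DecidableEq n] (hp2 : p ≠ 2)

/-- The matrix `A + x B + β⁻¹ (B e) (B e)ᵀ`. -/
noncomputable def sharpMatrix {R : Type*} [CommRing R] (A B : Matrix n n R) (e : n → R) (β : Rˣ)
    (x : R) : Matrix n n R :=
  A + x • B + ((β⁻¹ : Rˣ) : R) • Matrix.vecMulVec (B *ᵥ e) (B *ᵥ e)

omit [Fintype n] [DecidableEq n] in
theorem vecMulVec_isSymm {R : Type*} [CommRing R] (w : n → R) : (vecMulVec w w).IsSymm := by
  ext i j
  simp [vecMulVec_apply, mul_comm]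

omit [DecidableEq n] in
theorem vecMulVec_quadratic {R : Type*} [CommRing R] (w b : n → R) :
    b ⬝ᵥ vecMulVec w w *ᵥ b = (w ⬝ᵥ b) ^ 2 := by
  rw [vecMulVec_mulVec, dotProduct_smul, dotProduct_comm b w]
  simp [sq]

omit [DecidableEq n] in
theorem sharpMatrix_isSymm {R : Type*} [CommRing R] {A B : Matrix n n R} (hA : A.IsSymm)
    (hB : B.IsSymm) (e : n → R) (β : Rˣ) (x : R) : (sharpMatrix A B e β x).IsSymm :=
  (hA.add (hB.smul x)).add ((vecMulVec_isSymm _).smul _)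

/-- The data of a simple root at `0` of the pencil `A + x B`: a kernel vector `e` of `A` with
`e ⬝ B e = β` a unit and such that `A` is nondegenerate modulo `e`. -/
structure SimpleRoot {R : Type*} [CommRing R] (A B : Matrix n n R) (e : n → R) (β : Rˣ) : Prop where
  symmA : A.IsSymm
  symmB : B.IsSymm
  ker : A *ᵥ e = 0
  form : e ⬝ᵥ B *ᵥ e = β
  isUnit_det : IsUnit (sharpMatrix A B e β 0).det

theorem isUnit_of_isUnit_sum {ι : Type*} (s : Finset ι) (f : ι → ZMod (p ^ k)) (hk : 1 ≤ k)
    (h : IsUnit (∑ i ∈ s, f i)) : ∃ i ∈ s, IsUnit (f i) := by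
  by_contra! hcon
  refine (isUnit_iff_not_p_dvd hk _).1 h (Finset.dvd_sum fun i hi => ?_)
  exact (not_isUnit_iff_p_dvd hk _).1 (hcon i hi)

include hk in
theorem exists_simpleRoot {A B : Matrix n n (ZMod (p ^ k))} (hA : A.IsSymm) (hB : B.IsSymm)
    (hd : A.det = 0) (htr : IsUnit (A.adjugate * B).trace) :
    ∃ e β, SimpleRoot A B e β := by
  obtain ⟨i, -, hi⟩ := isUnit_of_isUnit_sum Finset.univ _ hk htr
  rw [Matrix.diag_apply, Matrix.mul_apply] at hi
  obtain ⟨j, -, hj⟩ := isUnit_of_isUnit_sum Finset.univ _ hk hi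
  have hK : IsUnit (A.adjugate j j) := by
    have h1 := adjugate_mul_adjugate_of_det_eq_zero hd i j j i
    have h2 : A.adjugate j i = A.adjugate i j := by
      conv_lhs => rw [← hA.eq, ← Matrix.adjugate_transpose, Matrix.transpose_apply]
    rw [h2] at h1
    have h3 := isUnit_of_mul_isUnit_left hj
    exact isUnit_of_mul_isUnit_right (h1 ▸ h3.mul h3)
  set e : n → ZMod (p ^ k) := fun i => A.adjugate i j with he
  have hform := adjugate_col_form hd hA B j
  rw [← he] at hform
  have hβ : IsUnit (e ⬝ᵥ B *ᵥ e) := hform ▸ hK.mul htr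
  have hker : A *ᵥ e = 0 := mulVec_adjugate_col hd j
  refine ⟨e, hβ.unit, hA, hB, hker, rfl, ?_⟩
  rw [← Matrix.isUnit_iff_isUnit_det, ← Matrix.mulVec_surjective_iff_isUnit]
  refine Finite.surjective_of_injective ?_
  rw [← Matrix.coe_mulVecLin, injective_iff_map_eq_zero]
  intro v hv
  rw [Matrix.mulVecLin_apply, sharpMatrix, zero_smul, add_zero, Matrix.add_mulVec,
    Matrix.smul_mulVec, vecMulVec_mulVec] at hv
  have h1 := congrArg (e ⬝ᵥ ·) hv
  simp only [dotProduct_add, dotProduct_smul, dotProduct_zero] at h1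
  rw [← mulVec_dotProduct_of_isSymm hA, hker, zero_dotProduct, zero_add] at h1
  have hwv : (B *ᵥ e) ⬝ᵥ v = 0 := by
    change ↑hβ.unit⁻¹ * ((e ⬝ᵥ B *ᵥ e) * ((B *ᵥ e) ⬝ᵥ v)) = 0 at h1
    rwa [← mul_assoc, hβ.val_inv_mul, one_mul] at h1
  rw [hwv] at hv
  simp only [MulOpposite.op_zero, zero_smul, smul_zero, add_zero] at hv
  have h2 : ∀ l, A.adjugate j j * v l = v j * e l := fun l =>
    adjugate_mul_apply_of_mulVec_eq_zero hv j j l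
  have h3 : A.adjugate j j * ((B *ᵥ e) ⬝ᵥ v) = v j * (e ⬝ᵥ B *ᵥ e) := by
    rw [dotProduct_comm e, ← smul_eq_mul, ← smul_eq_mul, ← dotProduct_smul, ← dotProduct_smul]
    congr 1
    ext l
    exact h2 l
  rw [hwv, mul_zero] at h3
  have h4 : v j = 0 := (hβ.mul_left_eq_zero).1 h3.symm
  ext l
  have h5 := h2 l
  rw [h4, zero_mul] at h5
  exact (hK.mul_right_eq_zero).1 h5

variable {A B : Matrix n n (ZMod (p ^ k))} {e : n → ZMod (p ^ k)} {β : (ZMod (p ^ k))ˣ}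

omit hp [DecidableEq n] in
theorem map_sharpMatrix_det {S : Type*} [CommRing S] (φ : ZMod (p ^ k) →+* S)
    {x : ZMod (p ^ k)} (hx : φ x = 0) :
    (sharpMatrix A B e β x).map φ = (sharpMatrix A B e β 0).map φ := by
  ext i j
  simp [sharpMatrix, hx]

include hk in
theorem SimpleRoot.isUnit_det_sharp (h : SimpleRoot A B e β) {x : ZMod (p ^ k)}
    (hx : (p : ZMod (p ^ k)) ∣ x) : IsUnit (sharpMatrix A B e β x).det := by
  rw [← isUnit_red_iff hk, RingHom.map_det, RingHom.mapMatrix_apply,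
    map_sharpMatrix_det _ ((red_eq_zero_iff hk x).2 hx), ← RingHom.mapMatrix_apply,
    ← RingHom.map_det, isUnit_red_iff]
  exact h.isUnit_det

theorem SimpleRoot.quadSum_mul_gauss1 (h : SimpleRoot A B e β) (u : n → ZMod (p ^ k))
    (m x : ZMod (p ^ k)) :
    quadSum ψ (m • (A + x • B)) u * gauss1 ψ (m * (β * (1 + x))) (u ⬝ᵥ e) =
      quadSum ψ (m • sharpMatrix A B e β x) u * gauss1 ψ (m * (β * x)) (u ⬝ᵥ e) := by
  set w := B *ᵥ e with hw
  have hwe : w ⬝ᵥ e = β := by rw [dotProduct_comm]; exact h.form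
  have hββ : ((β⁻¹ : (ZMod (p ^ k))ˣ) : ZMod (p ^ k)) * β = 1 := β.inv_mul
  set y : (n → ZMod (p ^ k)) → ZMod (p ^ k) := fun b => ↑β⁻¹ * (w ⬝ᵥ b) with hy
  let T : (n → ZMod (p ^ k)) × ZMod (p ^ k) → (n → ZMod (p ^ k)) × ZMod (p ^ k) :=
    fun z => (z.1 + (z.2 - y z.1) • e, y z.1)
  have hyT : ∀ b c, y (b + (c - y b) • e) = c := fun b c => by
    simp only [hy, dotProduct_add, dotProduct_smul, hwe, smul_eq_mul]
    linear_combination (c - ↑β⁻¹ * (w ⬝ᵥ b)) * hββ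
  have hT : Function.Involutive T := by
    rintro ⟨b, c⟩
    simp only [T]
    rw [hyT]
    ext1
    · simp only
      rw [add_assoc, ← add_smul]
      simp
    · rfl
  have hsum : ∀ (N : Matrix n n (ZMod (p ^ k))) (c v : ZMod (p ^ k)), quadSum ψ N u * gauss1 ψ c v =
      ∑ z : (n → ZMod (p ^ k)) × ZMod (p ^ k),
        ψ (z.1 ⬝ᵥ N *ᵥ z.1 + u ⬝ᵥ z.1 + (c * z.2 ^ 2 + v * z.2)) := fun N c v => by
    rw [quadSum, gauss1, Finset.sum_mul_sum, Fintype.sum_prod_type]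
    simp only [AddChar.map_add_eq_mul]
  rw [hsum, hsum, ← Equiv.sum_comp (hT.toPerm T)
    (fun z => ψ (z.1 ⬝ᵥ (m • sharpMatrix A B e β x) *ᵥ z.1 + u ⬝ᵥ z.1 + _))]
  refine Finset.sum_congr rfl fun z _ => ?_
  obtain ⟨b, c⟩ := z
  congr 1
  simp only [Function.Involutive.coe_toPerm, T]
  have hsharp : ∀ b', b' ⬝ᵥ (m • sharpMatrix A B e β x) *ᵥ b' =
      m * (b' ⬝ᵥ (A + x • B) *ᵥ b' + β * y b' ^ 2) := fun b' => by
    rw [smul_quadratic, sharpMatrix, Matrix.add_mulVec, dotProduct_add, smul_quadratic,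
      vecMulVec_quadratic]
    simp only [hy]
    linear_combination (-m * ↑β⁻¹ * (w ⬝ᵥ b') ^ 2) * hββ
  have hMe : (A + x • B) *ᵥ e = x • w := by
    rw [Matrix.add_mulVec, h.ker, zero_add, Matrix.smul_mulVec]
  have hwb : w ⬝ᵥ b = β * y b := by
    simp only [hy]
    linear_combination (-(w ⬝ᵥ b)) * hββ
  rw [hsharp, hyT, smul_quadratic, quadratic_add (h.symmA.add (h.symmB.smul x)), Matrix.mulVec_smul,
    hMe]
  simp only [smul_dotProduct, dotProduct_smul, dotProduct_add, smul_eq_mul, hwb,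
    dotProduct_comm e w, hwe]
  ring

end SingularClass

section SingularLine

variable {p : ℕ} [hp : Fact p.Prime] {k : ℕ} (hk : 1 ≤ k)
  {ψ : AddChar (ZMod (p ^ k)) ℂ} (hψ : ψ.IsPrimitive)
  {n : Type*} [Fintype n] [DecidableEq n] (hp2 : p ≠ 2)
  {A B : Matrix n n (ZMod (p ^ k))} {e : n → ZMod (p ^ k)} {β : (ZMod (p ^ k))ˣ}

/-- The phase of the quadratic sum of `A + x B` near a simple root at `0`. -/
noncomputable def rootPhase (A B : Matrix n n (ZMod (p ^ k))) (e : n → ZMod (p ^ k))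
    (β : (ZMod (p ^ k))ˣ) (u : n → ZMod (p ^ k)) (t x : ZMod (p ^ k)) : ZMod (p ^ k) :=
  t ^ 2 * ((u ⬝ᵥ e) ^ 2 * ((β : ZMod (p ^ k)) * (1 + x))⁻¹ -
    u ⬝ᵥ (sharpMatrix A B e β x)⁻¹ *ᵥ u)

variable (ψ) in
/-- The amplitude of the quadratic sum of `A + x B` near a simple root at `0`. -/
noncomputable def rootConst (A B : Matrix n n (ZMod (p ^ k))) (e : n → ZMod (p ^ k))
    (β : (ZMod (p ^ k))ˣ) : ℂ :=
  quadSum ψ (sharpMatrix A B e β 0) 0 / gauss1 ψ β 0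

include hψ hp2 in
theorem SimpleRoot.norm_rootConst_mul_le (h : SimpleRoot A B e β) :
    ‖rootConst ψ A B e β‖ * √(p : ℝ) ^ k ≤ √(p : ℝ) ^ (k * Fintype.card n) := by
  have h1 := norm_gauss1_zero_of_isUnit hψ hp2 β.isUnit
  have h2 : (0 : ℝ) < √(p : ℝ) ^ k := by
    have := hp.out.pos
    positivity
  rw [rootConst, norm_div, h1, div_mul_cancel₀ _ h2.ne']
  exact norm_quadSum_le_of_isUnit_det hψ hp2 (sharpMatrix_isSymm h.symmA h.symmB e β 0)
    h.isUnit_det 0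

include hψ hp2 in
theorem SimpleRoot.quadSum_eq (h : SimpleRoot A B e β) (u : n → ZMod (p ^ k))
    {t x : ZMod (p ^ k)} (ht : 2 * t = 1) (hx : (p : ZMod (p ^ k)) ∣ x) (m : (ZMod (p ^ k))ˣ) :
    quadSum ψ ((m : ZMod (p ^ k)) • (A + x • B)) u =
      rootConst ψ A B e β * chi p k hk m ^ (Fintype.card n * k + k) *
        ψ (↑m⁻¹ * rootPhase A B e β u t x) * gauss1 ψ (m * (β * x)) (u ⬝ᵥ e) := by
  have hg0 : gauss1 ψ (β : ZMod (p ^ k)) 0 ≠ 0 := by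
    rw [← norm_ne_zero_iff, norm_gauss1_zero_of_isUnit hψ hp2 β.isUnit]
    have := hp.out.pos
    positivity
  obtain ⟨γ, hγ⟩ : IsUnit ((β : ZMod (p ^ k)) * (1 + x)) :=
    β.isUnit.mul (isUnit_add_of_p_dvd hk isUnit_one hx)
  have hsh := h.isUnit_det_sharp hk hx
  have hsymm := sharpMatrix_isSymm h.symmA h.symmB e β x
  have h1 := h.quadSum_mul_gauss1 (ψ := ψ) u m x
  rw [quadSum_unit_smul hk hψ hp2 hsymm hsh u m ht] at h1
  have h2 : quadSum ψ (sharpMatrix A B e β x) 0 = quadSum ψ (sharpMatrix A B e β 0) 0 := by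
    have := quadSum_ppow_smul_congr hk hψ hp2 (Nat.zero_le k) hsymm hsh
      (sharpMatrix_isSymm h.symmA h.symmB e β 0) h.isUnit_det
      (map_sharpMatrix_det _ ((red_eq_zero_iff hk x).2 hx))
    rwa [pow_zero, one_smul, one_smul] at this
  have h3 : gauss1 ψ (m * (β * (1 + x))) (u ⬝ᵥ e) =
      ψ (-(t ^ 2 * ↑(m * γ)⁻¹ * (u ⬝ᵥ e) ^ 2)) * (chi p k hk m ^ k * gauss1 ψ β 0) := by
    have h4 := gauss1_complete_square (ψ := ψ) 1 (u ⬝ᵥ e) (m * γ) ht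
    rw [one_mul, one_mul, one_mul] at h4
    have h5 := gauss1_ppow_unit hk hψ hp2 (Nat.zero_le k) γ.isUnit m.isUnit
    rw [pow_zero, one_mul, one_mul, Nat.sub_zero] at h5
    rw [← hγ, ← Units.val_mul, h4, Units.val_mul, h5]
    congr 2
    refine gauss1_congr hk hψ hp2 γ.isUnit β.isUnit ?_
    rw [hγ, map_mul, map_add, (red_eq_zero_iff hk x).2 hx]
    simp
  have hχ : chi p k hk m ^ k * chi p k hk m ^ k = 1 := by
    rw [← mul_pow, ← sq, chi_sq hk m.isUnit, one_pow]
  have hγinv : ((β : ZMod (p ^ k)) * (1 + x))⁻¹ = ((γ⁻¹ : (ZMod (p ^ k))ˣ) : ZMod (p ^ k)) := by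
    rw [← hγ, ZMod.inv_coe_unit]
  have hψ1 : ψ (↑m⁻¹ * rootPhase A B e β u t x) * ψ (-(t ^ 2 * ↑(m * γ)⁻¹ * (u ⬝ᵥ e) ^ 2)) =
      ψ (↑m⁻¹ * -(t ^ 2 * (u ⬝ᵥ (sharpMatrix A B e β x)⁻¹ *ᵥ u))) := by
    rw [← AddChar.map_add_eq_mul, rootPhase, hγinv, mul_inv, Units.val_mul]
    congr 1
    ring
  have hψ0 : ψ (-(t ^ 2 * ↑(m * γ)⁻¹ * (u ⬝ᵥ e) ^ 2)) ≠ 0 := (ψ.val_isUnit _).ne_zero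
  have hχ0 : chi p k hk m ^ k ≠ 0 := left_ne_zero_of_mul_eq_one hχ
  refine mul_right_cancel₀ (mul_ne_zero hψ0 (mul_ne_zero hχ0 hg0)) ?_
  have hκ : rootConst ψ A B e β * gauss1 ψ β 0 = quadSum ψ (sharpMatrix A B e β 0) 0 :=
    div_mul_cancel₀ _ hg0
  rw [← h3, h1, h2, ← hψ1, h3, pow_add, ← hκ]
  generalize chi p k hk m ^ k = X at hχ
  linear_combination -(chi p k hk m ^ (Fintype.card n * k) *
    ψ (↑m⁻¹ * rootPhase A B e β u t x) * ψ (-(t ^ 2 * ↑(m * γ)⁻¹ * (u ⬝ᵥ e) ^ 2)) *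
    gauss1 ψ (m * (β * x)) (u ⬝ᵥ e) * rootConst ψ A B e β * gauss1 ψ β 0) * hχ

include hψ hp2 in
theorem SimpleRoot.norm_lineSum_le (h : SimpleRoot A B e β) (u : n → ZMod (p ^ k))
    {t : ZMod (p ^ k)} (ht : 2 * t = 1) {i : ℕ} (hi : 1 ≤ i) (hik : i ≤ k)
    (α : (ZMod (p ^ k))ˣ) :
    ∃ c, ‖lineSum ψ (A + ((p : ZMod (p ^ k)) ^ i * α) • B) u‖ ≤
      √(p : ℝ) ^ (k * Fintype.card n + i) *
        ‖unitSum hk ψ (Fintype.card n * k + k + (k - i)) c‖ := by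
  set x : ZMod (p ^ k) := (p : ZMod (p ^ k)) ^ i * α with hx
  have hpx : (p : ZMod (p ^ k)) ∣ x := Dvd.dvd.mul_right (dvd_pow_self _ (by omega)) _
  by_cases hdvd : (p : ZMod (p ^ k)) ^ i ∣ u ⬝ᵥ e
  · obtain ⟨w, hw⟩ := hdvd
    refine ⟨rootPhase A B e β u t x - p ^ i * t ^ 2 * ↑(β * α)⁻¹ * w ^ 2, ?_⟩
    set G := gauss1 ψ (p ^ i * (β * α : (ZMod (p ^ k))ˣ)) 0 with hG
    have h1 : ∀ m : (ZMod (p ^ k))ˣ, quadSum ψ ((m : ZMod (p ^ k)) • (A + x • B)) u =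
        rootConst ψ A B e β * G * (chi p k hk m ^ (Fintype.card n * k + k + (k - i)) *
          ψ (↑m⁻¹ * (rootPhase A B e β u t x - p ^ i * t ^ 2 * ↑(β * α)⁻¹ * w ^ 2))) := by
      intro m
      have h2 : (m : ZMod (p ^ k)) * (β * x) = p ^ i * (m * (β * α) : (ZMod (p ^ k))ˣ) := by
        rw [hx]
        push_cast
        ring
      have h3 := gauss1_ppow_unit hk hψ hp2 hik (β * α).isUnit m.isUnit
      rw [h.quadSum_eq hk hψ hp2 u ht hpx m, h2, hw, gauss1_complete_square _ _ _ ht,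
        Units.val_mul, h3, ← hG, pow_add _ (Fintype.card n * k + k), mul_sub,
        sub_eq_add_neg (_ * rootPhase A B e β u t x), AddChar.map_add_eq_mul]
      rw [show -(p ^ i * t ^ 2 * ((m * (β * α))⁻¹ : (ZMod (p ^ k))ˣ) * w ^ 2) =
        -(((m⁻¹ : (ZMod (p ^ k))ˣ) : ZMod (p ^ k)) *
          (p ^ i * t ^ 2 * ((β * α)⁻¹ : (ZMod (p ^ k))ˣ) * w ^ 2)) by
          rw [mul_inv m, Units.val_mul]; ring]
      ring
    rw [lineSum, Finset.sum_congr rfl fun m _ => h1 m, ← Finset.mul_sum, norm_mul, norm_mul]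
    refine mul_le_mul_of_nonneg_right ?_ (norm_nonneg _)
    calc ‖rootConst ψ A B e β‖ * ‖G‖
        ≤ ‖rootConst ψ A B e β‖ * √(p : ℝ) ^ (k + i) := by
          gcongr
          exact norm_gauss1_ppow_le hψ hp2 hik (β * α).isUnit 0
      _ = (‖rootConst ψ A B e β‖ * √(p : ℝ) ^ k) * √(p : ℝ) ^ i := by rw [pow_add]; ring
      _ ≤ _ := by
          rw [pow_add]
          gcongr
          exact h.norm_rootConst_mul_le hψ hp2
  · refine ⟨0, ?_⟩
    rw [lineSum, Finset.sum_eq_zero fun m _ => ?_]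
    · rw [norm_zero]
      positivity
    · rw [h.quadSum_eq hk hψ hp2 u ht hpx m, hx,
        show (m : ZMod (p ^ k)) * (β * (p ^ i * α)) = p ^ i * (m * (β * α)) by ring,
        gauss1_eq_zero hψ hik _ hdvd, mul_zero]

include hk hψ hp2 in
theorem SimpleRoot.norm_lineSum_le_card (h : SimpleRoot A B e β) (u : n → ZMod (p ^ k))
    {i : ℕ} (hi : 1 ≤ i) (hik : i ≤ k) (α : (ZMod (p ^ k))ˣ) :
    ‖lineSum ψ (A + ((p : ZMod (p ^ k)) ^ i * α) • B) u‖ ≤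
      √(p : ℝ) ^ (k * Fintype.card n + i) * ((p : ℝ) ^ k - (p : ℝ) ^ (k - 1)) := by
  obtain ⟨t, ht⟩ := (isUnit_two_zmod (k := k) hp2).exists_right_inv
  obtain ⟨c, hc⟩ := h.norm_lineSum_le hk hψ hp2 u ht hi hik α
  refine hc.trans ?_
  gcongr
  exact norm_unitSum_le hk _ c

include hk hψ hp2 in
theorem SimpleRoot.norm_lineSum_le_of_odd (h : SimpleRoot A B e β) (u : n → ZMod (p ^ k))
    {i : ℕ} (hi : 1 ≤ i) (hik : i ≤ k) (α : (ZMod (p ^ k))ˣ)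
    (he : ¬ Even (k * Fintype.card n + i)) :
    ‖lineSum ψ (A + ((p : ZMod (p ^ k)) ^ i * α) • B) u‖ ≤
      √(p : ℝ) ^ (k * Fintype.card n + i) * √(p : ℝ) ^ (2 * k - 1) := by
  obtain ⟨t, ht⟩ := (isUnit_two_zmod (k := k) hp2).exists_right_inv
  obtain ⟨c, hc⟩ := h.norm_lineSum_le hk hψ hp2 u ht hi hik α
  refine hc.trans ?_
  gcongr
  refine norm_unitSum_le_of_odd hk hψ hp2 ?_ c
  rw [← Nat.not_even_iff_odd]
  intro h2
  apply he
  rw [Nat.even_iff] at h2 ⊢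
  rw [mul_comm k]
  omega

end SingularLine

section SingularClassSum

variable {p : ℕ} [hp : Fact p.Prime] {k : ℕ} (hk : 1 ≤ k)
  {ψ : AddChar (ZMod (p ^ k)) ℂ} (hψ : ψ.IsPrimitive)
  {n : Type*} [Fintype n] [DecidableEq n] (hp2 : p ≠ 2)
  {A B : Matrix n n (ZMod (p ^ k))} {e : n → ZMod (p ^ k)} {β : (ZMod (p ^ k))ˣ}

open Classical in
variable (p k) in
/-- The elements of `ℤ / p ^ k` divisible by `p ^ r` but not by `p ^ (r + 1)`. -/
noncomputable def ppowShell (r : ℕ) : Finset (ZMod (p ^ k)) :=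
  Finset.univ.filter (fun x => (p : ZMod (p ^ k)) ^ r ∣ x) \
    Finset.univ.filter (fun x => (p : ZMod (p ^ k)) ^ (r + 1) ∣ x)

theorem exists_unit_of_mem_shell {r : ℕ} {x : ZMod (p ^ k)} (hk : 1 ≤ k)
    (hx : x ∈ ppowShell p k r) :
    ∃ α : (ZMod (p ^ k))ˣ, x = p ^ r * α := by
  simp only [ppowShell, Finset.mem_sdiff, Finset.mem_filter, Finset.mem_univ, true_and] at hx
  obtain ⟨⟨y, rfl⟩, h2⟩ := hx
  have hy : IsUnit y := by
    by_contra hy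
    rw [not_isUnit_iff_p_dvd hk] at hy
    exact h2 (by rw [pow_succ]; exact mul_dvd_mul_left _ hy)
  exact ⟨hy.unit, rfl⟩

theorem card_shell {r : ℕ} (hr : r + 1 ≤ k) :
    ((#(ppowShell p k r) : ℕ) : ℝ) =
    (p : ℝ) ^ (k - r) - (p : ℝ) ^ (k - (r + 1)) := by
  rw [ppowShell, Finset.cast_card_sdiff, card_filter_ppow_dvd (by omega), card_filter_ppow_dvd hr]
  · push_cast
    rfl
  · intro x hx
    simp only [Finset.mem_filter, Finset.mem_univ, true_and] at hx ⊢
    exact (pow_dvd_pow _ (Nat.le_succ r)).trans hx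

open Classical in
theorem sum_filter_ppow_dvd_eq_shell_add {M : Type*} [AddCommMonoid M] (r : ℕ)
    (f : ZMod (p ^ k) → M) :
    ∑ x with (p : ZMod (p ^ k)) ^ r ∣ x, f x =
      ∑ x ∈ ppowShell p k r, f x +
      ∑ x with (p : ZMod (p ^ k)) ^ (r + 1) ∣ x, f x := by
  rw [ppowShell, Finset.sum_sdiff]
  intro x hx
  simp only [Finset.mem_filter, Finset.mem_univ, true_and] at hx ⊢
  exact (pow_dvd_pow _ (Nat.le_succ r)).trans hx

open Classical in
include hk hψ hp2 in
theorem SimpleRoot.sum_norm_lineSum_aux (h : SimpleRoot A B e β) (u : n → ZMod (p ^ k)) (j : ℕ) :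
    ∀ r, r + j = k → 1 ≤ r →
      (Even (k * Fintype.card n + r) →
        ∑ x with (p : ZMod (p ^ k)) ^ r ∣ x, ‖lineSum ψ (A + x • B) u‖ ≤
          √(p : ℝ) ^ (k * Fintype.card n + 3 * k + j)) ∧
      (¬ Even (k * Fintype.card n + r) →
        (∑ x with (p : ZMod (p ^ k)) ^ r ∣ x, ‖lineSum ψ (A + x • B) u‖) * √(p : ℝ) ^ 3 ≤
          (2 * √(p : ℝ) ^ 2 - 1) * √(p : ℝ) ^ (k * Fintype.card n + 3 * k + j)) := by
  set N := k * Fintype.card n with hN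
  set ρ := √(p : ℝ) with hρ
  have hρ2 : (p : ℝ) = ρ ^ 2 := (Real.sq_sqrt (Nat.cast_nonneg p)).symm
  have hρ1 : 1 ≤ ρ := Real.one_le_sqrt.2 (by exact_mod_cast hp.out.one_le)
  have hρ0 : 0 < ρ := by linarith
  induction j with
  | zero =>
    intro r hr hr1
    obtain rfl : r = k := by omega
    have hset : ({x | (p : ZMod (p ^ r)) ^ r ∣ x} : Finset (ZMod (p ^ r))) = {0} := by
      ext x
      simp [ppow_eq_zero]
    have hz : (0 : ZMod (p ^ r)) = p ^ r * ((1 : (ZMod (p ^ r))ˣ) : ZMod (p ^ r)) := by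
      rw [ppow_eq_zero, zero_mul]
    rw [hset, Finset.sum_singleton, hz]
    constructor
    · intro _
      refine (h.norm_lineSum_le_card hk hψ hp2 u hr1 le_rfl 1).trans ?_
      rw [← hN, ← hρ, hρ2]
      calc ρ ^ (N + r) * ((ρ ^ 2) ^ r - (ρ ^ 2) ^ (r - 1)) ≤ ρ ^ (N + r) * (ρ ^ 2) ^ r := by
            gcongr
            have : (0 : ℝ) ≤ (ρ ^ 2) ^ (r - 1) := by positivity
            linarith
        _ = _ := by ring
    · intro hodd
      have h1 := h.norm_lineSum_le_of_odd hk hψ hp2 u hr1 le_rfl 1 hodd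
      rw [← hN, ← hρ] at h1
      calc _ ≤ ρ ^ (N + r) * ρ ^ (2 * r - 1) * ρ ^ 3 := by gcongr
        _ = ρ ^ 2 * ρ ^ (N + 3 * r + 0) := by
          rw [← pow_add, ← pow_add, ← pow_add]
          congr 1
          omega
        _ ≤ _ := by
          gcongr
          nlinarith
  | succ j ih =>
    intro r hr hr1
    obtain ⟨ih1, ih2⟩ := ih (r + 1) (by omega) (by omega)
    rw [sum_filter_ppow_dvd_eq_shell_add]
    set V := ∑ x with (p : ZMod (p ^ k)) ^ (r + 1) ∣ x, ‖lineSum ψ (A + x • B) u‖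
    have hcard := card_shell (p := p) (k := k) (r := r) (by omega)
    rw [show k - r = j + 1 by omega, show k - (r + 1) = j by omega, hρ2] at hcard
    have hY : ρ ^ (N + 3 * k + (j + 1)) = ρ ^ (N + 3 * k + j) * ρ := by rw [← add_assoc, pow_succ]
    rw [hY]
    constructor
    · intro heven
      have h1 := ih2 (by rw [← add_assoc, Nat.even_add_one]; simpa using heven)
      have h2 : ∑ x ∈ ppowShell p k r, ‖lineSum ψ (A + x • B) u‖ ≤
          ((ρ ^ 2) ^ (j + 1) - (ρ ^ 2) ^ j) *
            (ρ ^ (N + r) * ((ρ ^ 2) ^ k - (ρ ^ 2) ^ (k - 1))) := by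
        rw [← hcard, ← nsmul_eq_mul]
        refine Finset.sum_le_card_nsmul _ _ _ fun x hx => ?_
        obtain ⟨α, rfl⟩ := exists_unit_of_mem_shell hk hx
        have h3 := h.norm_lineSum_le_card hk hψ hp2 u hr1 (by omega) α
        rwa [← hN, ← hρ, hρ2] at h3
      have h3 : ((ρ ^ 2) ^ (j + 1) - (ρ ^ 2) ^ j) *
            (ρ ^ (N + r) * ((ρ ^ 2) ^ k - (ρ ^ 2) ^ (k - 1))) * ρ ^ 3 =
          (ρ ^ 2 - 1) ^ 2 * ρ ^ (N + 3 * k + j) := by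
        obtain ⟨l, rfl⟩ : ∃ l, k = l + 1 := ⟨k - 1, by omega⟩
        obtain rfl : l = r + j := by omega
        simp only [Nat.add_sub_cancel]
        ring
      refine le_of_mul_le_mul_right ?_ (by positivity : 0 < ρ ^ 3)
      nlinarith [mul_le_mul_of_nonneg_right h2 (by positivity : 0 ≤ ρ ^ 3)]
    · intro hodd
      have h1 := ih1 (by rw [← add_assoc, Nat.even_add_one]; exact hodd)
      have h2 : ∑ x ∈ ppowShell p k r, ‖lineSum ψ (A + x • B) u‖ ≤
          ((ρ ^ 2) ^ (j + 1) - (ρ ^ 2) ^ j) * (ρ ^ (N + r) * ρ ^ (2 * k - 1)) := by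
        rw [← hcard, ← nsmul_eq_mul]
        refine Finset.sum_le_card_nsmul _ _ _ fun x hx => ?_
        obtain ⟨α, rfl⟩ := exists_unit_of_mem_shell hk hx
        exact h.norm_lineSum_le_of_odd hk hψ hp2 u hr1 (by omega) α hodd
      have h3 : ((ρ ^ 2) ^ (j + 1) - (ρ ^ 2) ^ j) * (ρ ^ (N + r) * ρ ^ (2 * k - 1)) * ρ ^ 2 =
          (ρ ^ 2 - 1) * ρ ^ (N + 3 * k + j) := by
        obtain ⟨l, rfl⟩ : ∃ l, k = l + 1 := ⟨k - 1, by omega⟩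
        obtain rfl : l = r + j := by omega
        rw [show 2 * (r + j + 1) - 1 = 2 * (r + j) + 1 by omega]
        ring
      have h4 := mul_le_mul_of_nonneg_right h2 (by positivity : 0 ≤ ρ ^ 2)
      rw [h3] at h4
      have h5 := mul_le_mul_of_nonneg_right h1 (by positivity : 0 ≤ ρ ^ 2)
      nlinarith

open Classical in
include hk hψ hp2 in
/-- The total contribution of a neighbourhood of a simple root. -/
theorem SimpleRoot.sum_norm_lineSum_le (h : SimpleRoot A B e β) (u : n → ZMod (p ^ k)) {r : ℕ}
    (hr : 1 ≤ r) (hrk : r ≤ k) :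
    ∑ x with (p : ZMod (p ^ k)) ^ r ∣ x, ‖lineSum ψ (A + x • B) u‖ ≤
      √(p : ℝ) ^ (k * Fintype.card n + 4 * k - r) := by
  obtain ⟨h1, h2⟩ := h.sum_norm_lineSum_aux hk hψ hp2 u (k - r) r (by omega) hr
  rw [show k * Fintype.card n + 4 * k - r = k * Fintype.card n + 3 * k + (k - r) by omega]
  by_cases he : Even (k * Fintype.card n + r)
  · exact h1 he
  · have h3 : (3 : ℝ) ≤ p := by
      have := hp.out.two_le
      exact_mod_cast (by omega : 3 ≤ p)
    have hρ2 : √(p : ℝ) ^ 2 = p := Real.sq_sqrt (Nat.cast_nonneg p)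
    have hρ : 1.7 ≤ √(p : ℝ) := Real.le_sqrt_of_sq_le (by norm_num; linarith)
    refine le_of_mul_le_mul_right ((h2 he).trans ?_) (by positivity : 0 < √(p : ℝ) ^ 3)
    rw [mul_comm]
    gcongr
    nlinarith

end SingularClassSum

section RankOne

variable {R : Type*} [CommRing R] {n : Type*} [Fintype n] [DecidableEq n]

theorem det_updateRow_of_rows_shifted (M : Matrix n n R) (u v : n → R) (s : Finset n) {k : n} :
    ((Matrix.of fun i => if i ∈ s then M i + u i • v else M i).updateRow k v).det =
      (M.updateRow k v).det := by
  refine Matrix.det_eq_of_forall_row_eq_smul_add_const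
    (fun i => if i = k then 0 else if i ∈ s then u i else 0) k (by simp) fun i j => ?_
  by_cases hik : i = k
  · subst hik
    simp
  · by_cases his : i ∈ s <;> simp [hik, his]

theorem vecMul_adjugate_add_vecMulVec (M : Matrix n n R) (u v : n → R) :
    v ᵥ* (M + vecMulVec u v).adjugate = v ᵥ* M.adjugate := by
  have h : ∀ N : Matrix n n R, v ᵥ* N.adjugate = fun k => (N.updateRow k v).det := fun N => by
    ext k
    rw [← Matrix.mulVec_transpose, Matrix.adjugate_transpose, ← Matrix.cramer_eq_adjugate_mulVec,
      Matrix.cramer_transpose_apply]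
  rw [h, h]
  ext k
  rw [← det_updateRow_of_rows_shifted M u v Finset.univ]
  congr 2
  ext i j
  simp [vecMulVec_apply]

theorem det_add_vecMulVec (M : Matrix n n R) (u v : n → R) :
    (M + vecMulVec u v).det = M.det + v ⬝ᵥ M.adjugate *ᵥ u := by
  have h : ∀ s : Finset n, (Matrix.of fun i => if i ∈ s then M i + u i • v else M i).det =
      M.det + ∑ k ∈ s, u k * (M.updateRow k v).det := by
    intro s
    induction s using Finset.induction_on with
    | empty =>
      rw [Finset.sum_empty, add_zero]
      congr 1
    | insert k s hk ih =>
      have h1 : (Matrix.of fun i => if i ∈ insert k s then M i + u i • v else M i) =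
          (Matrix.of fun i => if i ∈ s then M i + u i • v else M i).updateRow k
            (M k + u k • v) := by
        ext i j
        by_cases hik : i = k
        · subst hik
          simp
        · simp [hik]
      have h2 : (Matrix.of fun i => if i ∈ s then M i + u i • v else M i).updateRow k (M k) =
          Matrix.of fun i => if i ∈ s then M i + u i • v else M i := by
        conv_lhs => rw [show M k = (Matrix.of fun i => if i ∈ s then M i + u i • v else M i) k by
          ext j; simp [hk]]
        exact Matrix.updateRow_eq_self _ _
      rw [h1, Matrix.det_updateRow_add, Matrix.det_updateRow_smul, h2, ih,
        det_updateRow_of_rows_shifted, Finset.sum_insert hk]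
      ring
  have h3 : v ⬝ᵥ M.adjugate *ᵥ u = ∑ k, u k * (M.updateRow k v).det := by
    rw [dotProduct_mulVec, dotProduct_comm, dotProduct]
    refine Finset.sum_congr rfl fun k _ => ?_
    rw [← Matrix.mulVec_transpose, Matrix.adjugate_transpose, ← Matrix.cramer_eq_adjugate_mulVec,
      Matrix.cramer_transpose_apply]
  rw [h3, ← h]
  congr 1
  ext i j
  simp [vecMulVec_apply]

theorem adjugate_mulVec_dotProduct {M : Matrix n n R} (hM : M.IsSymm) (a b : n → R) :
    a ⬝ᵥ M.adjugate *ᵥ b = b ⬝ᵥ M.adjugate *ᵥ a := by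
  have h : M.adjugate.IsSymm := by rw [Matrix.IsSymm, Matrix.adjugate_transpose, hM.eq]
  rw [← mulVec_dotProduct_of_isSymm h, dotProduct_comm]

variable {M : Matrix n n R} {e w u : n → R} {x γ b : R}

theorem det_add_rankOne_of_mulVec_eq (he : M *ᵥ e = x • w) (hγ : γ * b = 1)
    (hw : w ⬝ᵥ e = b) : x * (M + γ • vecMulVec w w).det = (1 + x) * M.det := by
  have h1 : x • M.adjugate *ᵥ w = M.det • e := by
    rw [← Matrix.mulVec_smul, ← he, Matrix.mulVec_mulVec, Matrix.adjugate_mul,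
      Matrix.smul_mulVec, Matrix.one_mulVec]
  have h2 : x * (w ⬝ᵥ M.adjugate *ᵥ w) = M.det * b := by
    rw [← hw, ← smul_eq_mul, ← smul_eq_mul, ← dotProduct_smul, ← dotProduct_smul, h1]
  rw [← smul_vecMulVec, det_add_vecMulVec, Matrix.mulVec_smul, dotProduct_smul, smul_eq_mul]
  linear_combination γ * h2 + M.det * hγ

theorem det_add_rankTwo_of_mulVec_eq (hM : M.IsSymm) (he : M *ᵥ e = x • w) (hγ : γ * b = 1)
    (hw : w ⬝ᵥ e = b) :
    x ^ 2 * ((M + vecMulVec u u + γ • vecMulVec w w).det - (M + vecMulVec u u).det) =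
      x * (M + vecMulVec u u).det - γ * M.det * (u ⬝ᵥ e) ^ 2 := by
  set N := M + vecMulVec u u with hN
  have hNs : N.IsSymm := hM.add (vecMulVec_isSymm u)
  have h0 : x • M.adjugate *ᵥ w = M.det • e := by
    rw [← Matrix.mulVec_smul, ← he, Matrix.mulVec_mulVec, Matrix.adjugate_mul,
      Matrix.smul_mulVec, Matrix.one_mulVec]
  have hNe : N *ᵥ e = x • w + (u ⬝ᵥ e) • u := by
    rw [hN, Matrix.add_mulVec, he, vecMulVec_mulVec]
    simp
  have h1 : N.det • e = x • N.adjugate *ᵥ w + (u ⬝ᵥ e) • N.adjugate *ᵥ u := by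
    rw [← Matrix.mulVec_smul, ← Matrix.mulVec_smul, ← Matrix.mulVec_add, ← hNe,
      Matrix.mulVec_mulVec, Matrix.adjugate_mul, Matrix.smul_mulVec, Matrix.one_mulVec]
  have h2 := congrArg (w ⬝ᵥ ·) h1
  simp only [dotProduct_smul, dotProduct_add, smul_eq_mul, hw] at h2
  have h3 : w ⬝ᵥ N.adjugate *ᵥ u = u ⬝ᵥ M.adjugate *ᵥ w := by
    rw [adjugate_mulVec_dotProduct hNs, dotProduct_mulVec, dotProduct_mulVec, hN,
      vecMul_adjugate_add_vecMulVec]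
  have h4 : x * (u ⬝ᵥ M.adjugate *ᵥ w) = M.det * (u ⬝ᵥ e) := by
    rw [← smul_eq_mul, ← smul_eq_mul, ← dotProduct_smul, ← dotProduct_smul, h0]
  rw [← smul_vecMulVec, det_add_vecMulVec, Matrix.mulVec_smul, dotProduct_smul, smul_eq_mul]
  rw [h3] at h2
  linear_combination (-γ * x) * h2 - γ * (u ⬝ᵥ e) * h4 + x * N.det * hγ

end RankOne

section SimpleRootIdentity

variable {R : Type*} [CommRing R] {n : Type*} [Fintype n] [DecidableEq n]
  {A B : Matrix n n R} {e u : n → R} {β : Rˣ}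

theorem SimpleRoot.phase_eq_zero (h : SimpleRoot A B e β)
    (hu : pencilDet (A + vecMulVec u u) B = pencilDet A B) :
    (u ⬝ᵥ e) ^ 2 = 0 ∧
      ∀ x, IsUnit (sharpMatrix A B e β x).det → u ⬝ᵥ (sharpMatrix A B e β x)⁻¹ *ᵥ u = 0 := by
  set w := B *ᵥ e with hw
  set A' := sharpMatrix A B e β 0 with hA'
  let M : Matrix n n (Polynomial R) :=
    (Polynomial.X : Polynomial R) • B.map Polynomial.C + A.map Polynomial.C
  have hmapvec : ∀ v : n → R, (vecMulVec v v).map Polynomial.C =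
      vecMulVec (Polynomial.C ∘ v) (Polynomial.C ∘ v) := fun v => by
    ext1 i j
    simp [vecMulVec_apply]
  have hM : M.IsSymm := (IsSymm.smul (h.symmB.map _) _).add (h.symmA.map _)
  have hdot : ∀ v z : n → R, (Polynomial.C ∘ v) ⬝ᵥ (Polynomial.C ∘ z) = Polynomial.C (v ⬝ᵥ z) :=
    fun v z => by simp [dotProduct]
  have hmul : ∀ (N : Matrix n n R) (v : n → R),
      N.map Polynomial.C *ᵥ (Polynomial.C ∘ v) = Polynomial.C ∘ (N *ᵥ v) := fun N v => by
    ext1 i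
    exact hdot (N i) v
  have hMe : M *ᵥ (Polynomial.C ∘ e) = (Polynomial.X : Polynomial R) • (Polynomial.C ∘ w) := by
    rw [Matrix.add_mulVec, Matrix.smul_mulVec, hmul, hmul, h.ker]
    ext1 i
    simp [hw]
  have hγ : Polynomial.C ((β⁻¹ : Rˣ) : R) * Polynomial.C (β : R) = 1 := by
    rw [← Polynomial.C_mul, Units.inv_mul, Polynomial.C_1]
  have hwe : (Polynomial.C ∘ w) ⬝ᵥ (Polynomial.C ∘ e) = Polynomial.C (β : R) := by
    rw [hdot, dotProduct_comm, h.form]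
  have hf : pencilDet A B = M.det := rfl
  have hf' : pencilDet (A + vecMulVec u u) B =
      (M + vecMulVec (Polynomial.C ∘ u) (Polynomial.C ∘ u)).det := by
    rw [pencilDet, ← hmapvec, add_assoc]
    congr 2
    ext1 i j
    simp
  have hD : pencilDet A' B = (M + Polynomial.C ((β⁻¹ : Rˣ) : R) •
      vecMulVec (Polynomial.C ∘ w) (Polynomial.C ∘ w)).det := by
    rw [pencilDet, ← hmapvec, add_assoc]
    congr 2
    ext1 i j
    simp [hA', sharpMatrix, hw]
  have hD' : pencilDet (A' + vecMulVec u u) B =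
      (M + vecMulVec (Polynomial.C ∘ u) (Polynomial.C ∘ u) + Polynomial.C ((β⁻¹ : Rˣ) : R) •
      vecMulVec (Polynomial.C ∘ w) (Polynomial.C ∘ w)).det := by
    rw [pencilDet, ← hmapvec, ← hmapvec, add_assoc M, add_assoc]
    congr 2
    ext1 i j
    simp [hA', sharpMatrix, hw]
    ring
  have h1 := det_add_rankOne_of_mulVec_eq hMe hγ hwe
  have h2 := det_add_rankTwo_of_mulVec_eq (u := Polynomial.C ∘ u) hM hMe hγ hwe
  rw [← hD', ← hf', ← hf, hu, hdot] at h2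
  rw [← hD, ← hf] at h1
  set D := pencilDet A' B
  set D' := pencilDet (A' + vecMulVec u u) B
  set f := pencilDet A B
  set v := u ⬝ᵥ e
  have hX : IsRegular (Polynomial.X : Polynomial R) := Polynomial.monic_X.isRegular
  have h3 : Polynomial.X ^ 2 * (D' - D) =
      -(Polynomial.C ((β⁻¹ : Rˣ) : R) * f * Polynomial.C v ^ 2) := by
    linear_combination h2 - Polynomial.X * h1
  have h4 : Polynomial.X * (1 + Polynomial.X) * (D' - D) =
      -(Polynomial.C ((β⁻¹ : Rˣ) : R) * D * Polynomial.C v ^ 2) := by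
    refine hX.left ?_
    change Polynomial.X * _ = Polynomial.X * _
    linear_combination (1 + Polynomial.X) * h3 +
      Polynomial.C ((β⁻¹ : Rˣ) : R) * Polynomial.C v ^ 2 * h1
  have h5 : v ^ 2 = 0 := by
    have h6 := congrArg (Polynomial.eval 0) h4
    have h7 : Polynomial.eval 0 D = A'.det := by
      rw [eval_pencilDet, zero_smul, add_zero]
    simp only [Polynomial.eval_mul, Polynomial.eval_X, zero_mul, Polynomial.eval_neg,
      Polynomial.eval_C, Polynomial.eval_pow, h7] at h6
    have h8 : IsUnit (((β⁻¹ : Rˣ) : R) * A'.det) := β⁻¹.isUnit.mul h.isUnit_det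
    exact (h8.mul_right_eq_zero).1 (neg_eq_zero.1 h6.symm)
  have h6 : D' = D := by
    rw [← Polynomial.C_pow, h5, Polynomial.C_0, mul_zero, neg_zero] at h3
    rw [← sub_eq_zero]
    refine (hX.pow 2).left ?_
    simpa using h3
  refine ⟨h5, fun x hx => ?_⟩
  have hsx : sharpMatrix A B e β x = A' + x • B := by
    rw [hA', sharpMatrix, sharpMatrix, zero_smul]
    abel
  have h7 := congrArg (Polynomial.eval x) h6
  rw [eval_pencilDet, eval_pencilDet, add_right_comm, ← hsx, det_add_vecMulVec,
    add_eq_left] at h7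
  rw [Matrix.inv_def, Matrix.smul_mulVec, dotProduct_smul, h7, smul_zero]

end SimpleRootIdentity

section SingularClassVanishing

variable {p : ℕ} [hp : Fact p.Prime] {k : ℕ} (hk : 1 ≤ k)
  {ψ : AddChar (ZMod (p ^ k)) ℂ} (hψ : ψ.IsPrimitive)
  {n : Type*} [Fintype n] [DecidableEq n] (hp2 : p ≠ 2)
  {A B : Matrix n n (ZMod (p ^ k))} {e : n → ZMod (p ^ k)} {β : (ZMod (p ^ k))ˣ}

open Classical in
theorem sum_p_dvd_addChar (hk : 1 ≤ k) (hψ : ψ.IsPrimitive) (a : ZMod (p ^ k)) :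
    ∑ x with (p : ZMod (p ^ k)) ∣ x, ψ (x * a) =
      if (p : ZMod (p ^ k)) * a = 0 then (p : ℂ) ^ (k - 1) else 0 := by
  have hcard : (#{x : ZMod (p ^ k) | (p : ZMod (p ^ k)) ∣ x} : ℂ) = (p : ℂ) ^ (k - 1) := by
    have := card_filter_ppow_dvd (p := p) hk
    simp only [pow_one] at this
    rw [this]
    push_cast
    rfl
  split_ifs with ha
  · rw [← hcard, Finset.sum_congr rfl fun x hx => ?_, Finset.sum_const, nsmul_eq_mul, mul_one]
    obtain ⟨y, rfl⟩ := (Finset.mem_filter.1 hx).2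
    rw [mul_right_comm, ha, zero_mul, AddChar.map_zero_eq_one]
  · obtain ⟨y, hy⟩ : ∃ y, ψ ((p : ZMod (p ^ k)) * a * y) ≠ 1 := by
      by_contra! hcon
      refine hψ ha ?_
      ext x
      simpa [AddChar.mulShift_apply] using hcon x
    have hshift : ∑ x with (p : ZMod (p ^ k)) ∣ x, ψ (x * a) =
        ψ ((p : ZMod (p ^ k)) * a * y) * ∑ x with (p : ZMod (p ^ k)) ∣ x, ψ (x * a) := by
      rw [Finset.mul_sum]
      refine Finset.sum_nbij' (fun x => x - p * y) (fun x => x + p * y) ?_ ?_ ?_ ?_ ?_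
      · intro x hx
        rw [Finset.mem_filter] at hx ⊢
        exact ⟨Finset.mem_univ _, dvd_sub hx.2 (dvd_mul_right _ _)⟩
      · intro x hx
        rw [Finset.mem_filter] at hx ⊢
        exact ⟨Finset.mem_univ _, dvd_add hx.2 (dvd_mul_right _ _)⟩
      · intro x _
        ring
      · intro x _
        ring
      · intro x _
        rw [← AddChar.map_add_eq_mul]
        congr 1
        ring
    by_contra h0
    exact hy (mul_right_cancel₀ h0 ((one_mul _).trans hshift)).symm

open Classical in
include hk hψ hp2 in
theorem SimpleRoot.norm_sum_lineSum_le_of_phase_eq_zero (h : SimpleRoot A B e β)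
    {u : n → ZMod (p ^ k)} (hu : pencilDet (A + vecMulVec u u) B = pencilDet A B)
    (hn : Even (k * Fintype.card n)) :
    ‖∑ x with (p : ZMod (p ^ k)) ∣ x, lineSum ψ (A + x • B) u‖ ≤
      √(p : ℝ) ^ (k * Fintype.card n) * ((p : ℝ) ^ k - (p : ℝ) ^ (k - 1)) * (p : ℝ) ^ (k - 1) := by
  obtain ⟨t, ht⟩ := (isUnit_two_zmod (k := k) hp2).exists_right_inv
  obtain ⟨hv, hinv⟩ := h.phase_eq_zero hu
  have hsum : ∀ m : (ZMod (p ^ k))ˣ, ∑ x with (p : ZMod (p ^ k)) ∣ x,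
      quadSum ψ ((m : ZMod (p ^ k)) • (A + x • B)) u =
      rootConst ψ A B e β * chi p k hk m ^ k *
        ((p : ℂ) ^ (k - 1) * ∑ y with (p : ZMod (p ^ k)) * y ^ 2 = 0, ψ ((u ⬝ᵥ e) * y)) := by
    intro m
    have h1 : ∀ x ∈ Finset.univ.filter (fun x : ZMod (p ^ k) => (p : ZMod (p ^ k)) ∣ x),
        quadSum ψ ((m : ZMod (p ^ k)) • (A + x • B)) u =
        rootConst ψ A B e β * chi p k hk m ^ k * gauss1 ψ (m * (β * x)) (u ⬝ᵥ e) := by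
      intro x hx
      rw [Finset.mem_filter] at hx
      rw [h.quadSum_eq hk hψ hp2 u ht hx.2 m, rootPhase, hv, hinv x (h.isUnit_det_sharp hk hx.2),
        zero_mul, sub_zero, mul_zero, mul_zero, AddChar.map_zero_eq_one, mul_one, pow_add,
        mul_comm _ k, chi_pow_of_even hk m.isUnit hn, one_mul]
    rw [Finset.sum_congr rfl h1, ← Finset.mul_sum]
    congr 1
    have h2 : ∑ x with (p : ZMod (p ^ k)) ∣ x, gauss1 ψ (m * (β * x)) (u ⬝ᵥ e) =
        ∑ x with (p : ZMod (p ^ k)) ∣ x, gauss1 ψ x (u ⬝ᵥ e) := by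
      refine Finset.sum_nbij' (fun x => (m * β : (ZMod (p ^ k))ˣ) * x)
        (fun x => ((m * β)⁻¹ : (ZMod (p ^ k))ˣ) * x) ?_ ?_ ?_ ?_ ?_
      · intro x hx
        rw [Finset.mem_filter] at hx ⊢
        exact ⟨Finset.mem_univ _, Dvd.dvd.mul_left hx.2 _⟩
      · intro x hx
        rw [Finset.mem_filter] at hx ⊢
        exact ⟨Finset.mem_univ _, Dvd.dvd.mul_left hx.2 _⟩
      · intro x _
        rw [Units.inv_mul_cancel_left]
      · intro x _
        rw [Units.mul_inv_cancel_left]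
      · intro x _
        rw [Units.val_mul, mul_assoc]
    rw [h2]
    simp only [gauss1, AddChar.map_add_eq_mul]
    rw [Finset.sum_comm, Finset.mul_sum, Finset.sum_filter]
    refine Finset.sum_congr rfl fun y _ => ?_
    rw [← Finset.sum_mul, sum_p_dvd_addChar hk hψ]
    split_ifs <;> simp
  have hswap : ∑ x with (p : ZMod (p ^ k)) ∣ x, lineSum ψ (A + x • B) u =
      rootConst ψ A B e β * (∑ m : (ZMod (p ^ k))ˣ, chi p k hk m ^ k) *
        ((p : ℂ) ^ (k - 1) * ∑ y with (p : ZMod (p ^ k)) * y ^ 2 = 0, ψ ((u ⬝ᵥ e) * y)) := by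
    simp only [lineSum]
    rw [Finset.sum_comm, Finset.sum_congr rfl fun m _ => hsum m, ← Finset.sum_mul, ← Finset.mul_sum]
  have hUnit : ∑ m : (ZMod (p ^ k))ˣ, chi p k hk m ^ k = unitSum hk ψ k 0 := by
    simp [unitSum]
  have hpk : (0 : ℝ) ≤ (p : ℝ) ^ k - (p : ℝ) ^ (k - 1) :=
    (norm_nonneg _).trans (norm_unitSum_le hk (ψ := ψ) 0 0)
  rw [hswap, hUnit]
  rcases Nat.even_or_odd k with hke | hko
  · obtain ⟨l, hl⟩ := hke
    have hcount : ‖∑ y with (p : ZMod (p ^ k)) * y ^ 2 = 0, ψ ((u ⬝ᵥ e) * y)‖ ≤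
        √(p : ℝ) ^ k := by
      have hsub : Finset.univ.filter (fun y : ZMod (p ^ k) => (p : ZMod (p ^ k)) * y ^ 2 = 0) ⊆
          Finset.univ.filter (fun y : ZMod (p ^ k) => (p : ZMod (p ^ k)) ^ l ∣ y) := by
        intro y hy
        rw [Finset.mem_filter] at hy ⊢
        refine ⟨Finset.mem_univ _, ?_⟩
        obtain ⟨i, hik, v, rfl⟩ := exists_eq_ppow_mul_unit y
        have h1 : (p : ZMod (p ^ k)) ^ (2 * i + 1) = 0 := by
          have h2 : (p : ZMod (p ^ k)) ^ (2 * i + 1) * (v : ZMod (p ^ k)) ^ 2 = 0 := by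
            rw [← hy.2]
            ring
          exact ((v.isUnit.pow 2).mul_left_eq_zero).1 h2
        refine Dvd.dvd.mul_right (pow_dvd_pow _ ?_) _
        by_contra hlt
        have h3 := (ppow_dvd_natCast_iff (p := p) le_rfl (p ^ (2 * i + 1))).1 (by
          push_cast
          rw [h1]
          exact dvd_zero _)
        rw [Nat.pow_dvd_pow_iff_le_right hp.out.one_lt] at h3
        omega
      refine (norm_sum_le _ _).trans ?_
      simp only [AddChar.norm_apply, Finset.sum_const, nsmul_eq_mul, mul_one]
      refine (Nat.cast_le.2 (Finset.card_le_card hsub)).trans ?_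
      rw [card_filter_ppow_dvd (by omega), hl, ← two_mul, pow_mul,
        Real.sq_sqrt (Nat.cast_nonneg p), show 2 * l - l = l by omega]
      push_cast
      rfl
    rw [norm_mul, norm_mul, norm_mul, norm_pow, RCLike.norm_natCast]
    calc _ ≤ ‖rootConst ψ A B e β‖ * ((p : ℝ) ^ k - (p : ℝ) ^ (k - 1)) *
          ((p : ℝ) ^ (k - 1) * √(p : ℝ) ^ k) := by
          gcongr
          exact norm_unitSum_le hk k 0
      _ = (‖rootConst ψ A B e β‖ * √(p : ℝ) ^ k) * ((p : ℝ) ^ k - (p : ℝ) ^ (k - 1)) *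
          (p : ℝ) ^ (k - 1) := by ring
      _ ≤ _ := by
          gcongr
          exact h.norm_rootConst_mul_le hψ hp2
  · rw [unitSum_zero_of_odd hk hψ hp2 hko, mul_zero, zero_mul, norm_zero]
    positivity

end SingularClassVanishing

section PolynomialRoots

theorem Polynomial.eq_zero_of_roots_isUnit_sub {R : Type*} [CommRing R] [DecidableEq R]
    (S : Finset R) (hS : ∀ x ∈ S, ∀ y ∈ S, x ≠ y → IsUnit (x - y)) (g : Polynomial R)
    (hdeg : g.natDegree < #S) (hg : ∀ x ∈ S, g.eval x = 0) : g = 0 := by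
  induction S using Finset.induction_on generalizing g with
  | empty => simp at hdeg
  | insert a S ha ih =>
    obtain ⟨q, rfl⟩ := Polynomial.dvd_iff_isRoot.2 (hg a (Finset.mem_insert_self a S))
    by_cases hq : q = 0
    · rw [hq, mul_zero]
    have : Nontrivial R := by
      by_contra hR
      rw [not_nontrivial_iff_subsingleton] at hR
      exact hq (Subsingleton.elim _ _)
    rw [(Polynomial.monic_X_sub_C a).natDegree_mul' hq, Polynomial.natDegree_X_sub_C,
      Finset.card_insert_of_notMem ha] at hdeg
    rw [ih (fun x hx y hy => hS x (Finset.mem_insert_of_mem hx) y (Finset.mem_insert_of_mem hy)) q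
      (by omega) fun x hx => ?_, mul_zero]
    have h1 := hg x (Finset.mem_insert_of_mem hx)
    rw [Polynomial.eval_mul, Polynomial.eval_sub, Polynomial.eval_X, Polynomial.eval_C] at h1
    have hxa : x ≠ a := fun h => ha (h ▸ hx)
    exact (hS x (Finset.mem_insert_of_mem hx) a (Finset.mem_insert_self a S)
      hxa).mul_right_eq_zero.1 h1

theorem pencilDet_add_smul {R : Type*} [CommRing R] {n : Type*} [Fintype n] [DecidableEq n]
    (A B : Matrix n n R) (c : R) :
    pencilDet (A + c • B) B = (pencilDet A B).comp (Polynomial.X + Polynomial.C c) := by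
  rw [← Polynomial.coe_compRingHom_apply, pencilDet, pencilDet, RingHom.map_det]
  congr 1
  ext1 i j
  simp
  ring

variable {p : ℕ} [hp : Fact p.Prime] {k : ℕ} (hk : 1 ≤ k)

theorem card_filter_ppow_dvd_sub {r : ℕ} (hr : r ≤ k) (x₀ : ZMod (p ^ k))
    [DecidablePred fun x : ZMod (p ^ k) => (p : ZMod (p ^ k)) ^ r ∣ x - x₀] :
    #{x : ZMod (p ^ k) | (p : ZMod (p ^ k)) ^ r ∣ x - x₀} = p ^ (k - r) := by
  classical
  rw [← card_filter_ppow_dvd hr]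
  refine Finset.card_nbij' (fun x => x - x₀) (fun x => x + x₀) ?_ ?_ ?_ ?_ <;> intro x <;> simp

theorem red_eq_iff (x y : ZMod (p ^ k)) :
    red p k hk x = red p k hk y ↔ (p : ZMod (p ^ k)) ∣ x - y := by
  rw [← sub_eq_zero, ← map_sub, red_eq_zero_iff]

theorem card_filter_eval_eq_zero_le (hk : 1 ≤ k) {g : Polynomial (ZMod (p ^ k))} (hg : g ≠ 0)
    {D : ℕ} (hD : g.natDegree ≤ D) :
    #{x : ZMod (p ^ k) | g.eval x = 0} ≤ D * p ^ (k - 1) := by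
  classical
  set Z : Finset (ZMod (p ^ k)) := {x | g.eval x = 0} with hZ
  have h1 : #Z ≤ p ^ (k - 1) * #(Z.image (red p k hk)) := by
    refine Finset.card_le_mul_card_image _ _ fun c hc => ?_
    obtain ⟨x₀, -, rfl⟩ := Finset.mem_image.1 hc
    rw [← card_filter_ppow_dvd_sub hk x₀]
    refine Finset.card_le_card fun x hx => ?_
    rw [Finset.mem_filter] at hx ⊢
    rw [pow_one, ← red_eq_iff hk]
    exact ⟨Finset.mem_univ _, hx.2⟩
  have h2 : #(Z.image (red p k hk)) ≤ D := by
    by_contra! hlt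
    choose! lift hlift hred using fun c (hc : c ∈ Z.image (red p k hk)) => Finset.mem_image.1 hc
    refine hg (Polynomial.eq_zero_of_roots_isUnit_sub ((Z.image (red p k hk)).image lift) ?_ g ?_
      ?_)
    · intro x hx y hy hxy
      obtain ⟨c, hc, rfl⟩ := Finset.mem_image.1 hx
      obtain ⟨c', hc', rfl⟩ := Finset.mem_image.1 hy
      rw [← isUnit_red_iff hk, map_sub, hred c hc, hred c' hc', isUnit_iff_ne_zero, sub_ne_zero]
      rintro rfl
      exact hxy rfl
    · rw [Finset.card_image_of_injOn]
      · omega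
      · intro c hc c' hc' h
        rw [← hred c hc, ← hred c' hc', h]
    · intro x hx
      obtain ⟨c, hc, rfl⟩ := Finset.mem_image.1 hx
      exact (Finset.mem_filter.1 (hlift c hc)).2
  rw [mul_comm D]
  exact h1.trans (Nat.mul_le_mul_left _ h2)

theorem isUnit_eval_congr (hk : 1 ≤ k) (g : Polynomial (ZMod (p ^ k))) {x y : ZMod (p ^ k)}
    (h : (p : ZMod (p ^ k)) ∣ x - y) : IsUnit (g.eval x) ↔ IsUnit (g.eval y) := by
  rw [← isUnit_red_iff hk, ← isUnit_red_iff hk (g.eval y)]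
  have h1 : red p k hk (g.eval x) = red p k hk (g.eval y) :=
    (red_eq_iff hk _ _).2 (h.trans (Polynomial.sub_dvd_eval_sub x y g))
  rw [h1]

theorem exists_root_of_not_isUnit_eval (hk : 1 ≤ k) (f : Polynomial (ZMod (p ^ k)))
    {x₀ : ZMod (p ^ k)} (h0 : ¬ IsUnit (f.eval x₀)) (h1 : IsUnit (f.derivative.eval x₀)) :
    ∃ x, (p : ZMod (p ^ k)) ∣ x - x₀ ∧ f.eval x = 0 := by
  let S := {y : ZMod (p ^ k) // (p : ZMod (p ^ k)) ∣ y}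
  let F : S → S := fun y => ⟨f.eval (x₀ + y.1), by
    rw [← not_isUnit_iff_p_dvd hk, isUnit_eval_congr hk f (y := x₀) (by simpa using y.2)]
    exact h0⟩
  have hF : Function.Injective F := by
    rintro ⟨y, hy⟩ ⟨z, hz⟩ hyz
    have h2 : f.eval (x₀ + y) = f.eval (x₀ + z) := congrArg Subtype.val hyz
    obtain ⟨q, hq⟩ := Polynomial.binomExpansion f (x₀ + z) (y - z)
    rw [show x₀ + z + (y - z) = x₀ + y by ring, h2] at hq
    have h3 : IsUnit (f.derivative.eval (x₀ + z) + q * (y - z)) :=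
      isUnit_add_of_p_dvd hk ((isUnit_eval_congr hk _ (y := x₀) (by simpa using hz)).2 h1)
        (Dvd.dvd.mul_left (dvd_sub hy hz) _)
    have h4 : (f.derivative.eval (x₀ + z) + q * (y - z)) * (y - z) = 0 := by
      linear_combination -hq
    exact Subtype.ext (sub_eq_zero.1 (h3.mul_right_eq_zero.1 h4))
  obtain ⟨⟨y, hy⟩, h2⟩ := Finite.surjective_of_injective hF ⟨0, dvd_zero _⟩
  exact ⟨x₀ + y, by simpa using hy, congrArg Subtype.val h2⟩

theorem card_image_not_isUnit_eval_le {f : Polynomial (ZMod (p ^ k))}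
    (hgood : ∀ x, IsUnit (f.eval x) ∨ IsUnit (f.derivative.eval x)) {D : ℕ}
    (hD : f.natDegree ≤ D) [DecidablePred fun x : ZMod (p ^ k) => ¬ IsUnit (f.eval x)] :
    #((Finset.univ.filter fun x : ZMod (p ^ k) => ¬ IsUnit (f.eval x)).image (red p k hk)) ≤ D := by
  have hf : f.map (red p k hk) ≠ 0 := by
    intro h0
    rcases hgood 0 with h | h
    · rw [← isUnit_red_iff hk, ← Polynomial.eval_map_apply, h0] at h
      simp at h
    · rw [← isUnit_red_iff hk, ← Polynomial.eval_map_apply, ← Polynomial.derivative_map, h0] at h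
      simp at h
  refine (Finset.card_le_card (t := (f.map (red p k hk)).roots.toFinset) fun c hc => ?_).trans
    ((Multiset.toFinset_card_le _).trans ((Polynomial.card_roots' _).trans
      (Polynomial.natDegree_map_le.trans hD)))
  obtain ⟨x, hx, rfl⟩ := Finset.mem_image.1 hc
  rw [Multiset.mem_toFinset, Polynomial.mem_roots hf, Polynomial.IsRoot,
    Polynomial.eval_map_apply]
  by_contra h
  exact (Finset.mem_filter.1 hx).2 ((isUnit_red_iff hk _).1 (isUnit_iff_ne_zero.2 h))

end PolynomialRoots

section ResidueClassBound

variable {p : ℕ} [hp : Fact p.Prime] {k : ℕ} (hk : 1 ≤ k)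
  {ψ : AddChar (ZMod (p ^ k)) ℂ} (hψ : ψ.IsPrimitive)
  {n : Type*} [Fintype n] [DecidableEq n] (hp2 : p ≠ 2)
  {A B : Matrix n n (ZMod (p ^ k))} (hA : A.IsSymm) (hB : B.IsSymm)

include hk hA hB in
theorem exists_simpleRoot_of_eval_eq_zero {x : ZMod (p ^ k)} (h0 : (pencilDet A B).eval x = 0)
    (h1 : IsUnit ((pencilDet A B).derivative.eval x)) : ∃ e β, SimpleRoot (A + x • B) B e β := by
  rw [eval_pencilDet] at h0
  rw [eval_derivative_pencilDet] at h1
  exact exists_simpleRoot hk (hA.add (hB.smul x)) hB h0 h1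

include hk hψ hp2 in
theorem norm_lineSum_le_card_of_isUnit_det (hA : A.IsSymm) (hd : IsUnit A.det)
    (u : n → ZMod (p ^ k)) :
    ‖lineSum ψ A u‖ ≤ √(p : ℝ) ^ (k * Fintype.card n) * ((p : ℝ) ^ k - (p : ℝ) ^ (k - 1)) := by
  obtain ⟨t, ht⟩ := (isUnit_two_zmod (k := k) hp2).exists_right_inv
  refine (norm_lineSum_le_of_isUnit_det hk hψ hp2 hA hd u ht).trans ?_
  gcongr
  exact norm_unitSum_le hk _ _

include hk hA hB in
theorem exists_simpleRoot_of_not_isUnit_eval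
    (hgood : ∀ x, IsUnit ((pencilDet A B).eval x) ∨ IsUnit ((pencilDet A B).derivative.eval x))
    {x₀ : ZMod (p ^ k)} (h0 : ¬ IsUnit ((pencilDet A B).eval x₀)) :
    ∃ x, (p : ZMod (p ^ k)) ∣ x - x₀ ∧ ∃ e β, SimpleRoot (A + x • B) B e β := by
  have h1 := (hgood x₀).resolve_left h0
  obtain ⟨x, hx, hx0⟩ := exists_root_of_not_isUnit_eval hk _ h0 h1
  exact ⟨x, hx, exists_simpleRoot_of_eval_eq_zero hk hA hB hx0 ((isUnit_eval_congr hk _ hx).2 h1)⟩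

open Classical in
omit [Fintype n] [DecidableEq n] in
theorem sum_filter_dvd_sub_eq {E : Type*} [AddCommMonoid E] (A B : Matrix n n (ZMod (p ^ k)))
    (F : Matrix n n (ZMod (p ^ k)) → E)
    {d x₀ x₁ : ZMod (p ^ k)} (h : d ∣ x₁ - x₀) :
    ∑ x with d ∣ x - x₀, F (A + x • B) = ∑ x with d ∣ x, F (A + x₁ • B + x • B) := by
  refine Finset.sum_equiv (Equiv.subRight x₁) (fun x => ?_) fun x _ => ?_
  · simp only [Finset.mem_filter, Finset.mem_univ, true_and, Equiv.subRight_apply]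
    rw [show x - x₀ = x - x₁ + (x₁ - x₀) by ring]
    exact dvd_add_left h
  · rw [Equiv.subRight_apply, add_assoc, ← add_smul, add_sub_cancel]

open Classical in
include hk hψ hp2 hA hB in
theorem sum_norm_lineSum_le
    (hgood : ∀ x, IsUnit ((pencilDet A B).eval x) ∨ IsUnit ((pencilDet A B).derivative.eval x))
    (u : n → ZMod (p ^ k)) {r : ℕ} (hr : 1 ≤ r) (hrk : r ≤ k) (x₀ : ZMod (p ^ k)) :
    ∑ x with (p : ZMod (p ^ k)) ^ r ∣ x - x₀, ‖lineSum ψ (A + x • B) u‖ ≤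
      √(p : ℝ) ^ (k * Fintype.card n + 4 * k - r) := by
  set N := k * Fintype.card n with hN
  set ρ := √(p : ℝ) with hρ
  have hρ2 : (p : ℝ) = ρ ^ 2 := (Real.sq_sqrt (Nat.cast_nonneg p)).symm
  have hρ1 : 1 ≤ ρ := Real.one_le_sqrt.2 (by exact_mod_cast hp.out.one_le)
  have hpr : (p : ZMod (p ^ k)) ∣ p ^ r := dvd_pow_self _ (by omega)
  have key : (∀ x : ZMod (p ^ k), (p : ZMod (p ^ k)) ^ r ∣ x - x₀ →
      ‖lineSum ψ (A + x • B) u‖ ≤ ρ ^ (N + r) * (p : ℝ) ^ k) →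
      ∑ x with (p : ZMod (p ^ k)) ^ r ∣ x - x₀, ‖lineSum ψ (A + x • B) u‖ ≤
      ρ ^ (N + 4 * k - r) := by
    intro h
    refine (Finset.sum_le_card_nsmul _ _ _ fun x hx => h x (Finset.mem_filter.1 hx).2).trans ?_
    rw [card_filter_ppow_dvd_sub hrk, nsmul_eq_mul, Nat.cast_pow, hρ2, ← pow_mul, ← pow_mul,
      ← pow_add, ← pow_add]
    exact le_of_eq (congrArg _ (by omega))
  have hpk : (p : ℝ) ^ k - (p : ℝ) ^ (k - 1) ≤ (p : ℝ) ^ k :=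
    sub_le_self _ (by positivity)
  have hpk0 : 0 ≤ (p : ℝ) ^ k - (p : ℝ) ^ (k - 1) :=
    sub_nonneg.2 (pow_le_pow_right₀ (by exact_mod_cast hp.out.one_le) (Nat.sub_le _ _))
  by_cases h0 : IsUnit ((pencilDet A B).eval x₀)
  · refine key fun x hx => ?_
    have h1 := (isUnit_eval_congr hk (pencilDet A B) (hpr.trans hx)).2 h0
    rw [eval_pencilDet] at h1
    refine (norm_lineSum_le_card_of_isUnit_det hk hψ hp2 (hA.add (hB.smul x)) h1 u).trans ?_
    gcongr
    omega
  · obtain ⟨x₁, hx₁, e, β, h⟩ := exists_simpleRoot_of_not_isUnit_eval hk hA hB hgood h0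
    by_cases h2 : (p : ZMod (p ^ k)) ^ r ∣ x₁ - x₀
    · rw [sum_filter_dvd_sub_eq A B (fun M => ‖lineSum ψ M u‖) h2]
      exact h.sum_norm_lineSum_le hk hψ hp2 u hr hrk
    · refine key fun x hx => ?_
      obtain ⟨i, hik, v, hv⟩ := exists_eq_ppow_mul_unit (x - x₁)
      have hir : i < r := by
        by_contra hir
        apply h2
        rw [show x₁ - x₀ = (x - x₀) - (x - x₁) by ring, hv]
        exact dvd_sub hx (Dvd.dvd.mul_right (pow_dvd_pow _ (not_lt.1 hir)) _)
      have hi : 1 ≤ i := by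
        rw [Nat.one_le_iff_ne_zero]
        rintro rfl
        have h3 : (p : ZMod (p ^ k)) ∣ x - x₁ := by
          rw [show x - x₁ = (x - x₀) - (x₁ - x₀) by ring]
          exact dvd_sub (hpr.trans hx) hx₁
        rw [← not_isUnit_iff_p_dvd hk, hv, pow_zero, one_mul] at h3
        exact h3 v.isUnit
      have h4 := h.norm_lineSum_le_card hk hψ hp2 u hi hik v
      rw [← hv, add_assoc, ← add_smul, add_sub_cancel] at h4
      refine h4.trans ?_
      gcongr

end ResidueClassBound

section TotalBound

variable {p : ℕ} [hp : Fact p.Prime] {k : ℕ} (hk : 1 ≤ k)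
  {ψ : AddChar (ZMod (p ^ k)) ℂ} (hψ : ψ.IsPrimitive)
  {n : Type*} [Fintype n] [DecidableEq n] (hp2 : p ≠ 2)
  {A B : Matrix n n (ZMod (p ^ k))} (hA : A.IsSymm) (hB : B.IsSymm)
  (hgood : ∀ x, IsUnit ((pencilDet A B).eval x) ∨ IsUnit ((pencilDet A B).derivative.eval x))
  (u : n → ZMod (p ^ k))

open Classical in
include hk hψ hp2 hA hB hgood in
theorem sum_norm_lineSum_singular_le :
    ∑ x with ¬ IsUnit ((pencilDet A B).eval x), ‖lineSum ψ (A + x • B) u‖ ≤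
      Fintype.card n * √(p : ℝ) ^ (k * Fintype.card n + 4 * k - 1) := by
  set S := Finset.univ.filter fun x => ¬ IsUnit ((pencilDet A B).eval x)
  rw [← Finset.sum_fiberwise_of_maps_to (t := S.image (red p k hk))
    fun x hx => Finset.mem_image_of_mem _ hx]
  refine (Finset.sum_le_card_nsmul _ _ (√(p : ℝ) ^ (k * Fintype.card n + 4 * k - 1))
    fun c hc => ?_).trans ?_
  · obtain ⟨x₀, -, rfl⟩ := Finset.mem_image.1 hc
    refine (Finset.sum_le_sum_of_subset_of_nonneg (fun x hx => ?_) fun x _ _ =>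
      norm_nonneg _).trans (sum_norm_lineSum_le hk hψ hp2 hA hB hgood u le_rfl hk x₀)
    rw [Finset.mem_filter] at hx ⊢
    rw [pow_one]
    exact ⟨Finset.mem_univ _, (red_eq_iff hk _ _).1 hx.2⟩
  · rw [nsmul_eq_mul]
    gcongr
    exact card_image_not_isUnit_eval_le hk hgood (natDegree_pencilDet_le A B)

theorem card_filter_zmod_le (P : ZMod (p ^ k) → Prop) [DecidablePred P] :
    ((#{x | P x} : ℕ) : ℝ) ≤ (p : ℝ) ^ k := by
  have h := Finset.card_le_univ (Finset.univ.filter fun x : ZMod (p ^ k) => P x)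
  rw [ZMod.card] at h
  exact_mod_cast h

open Classical in
include hk hψ hp2 hA hB in
theorem sum_norm_lineSum_regular_le_of_odd (hodd : ¬ Even (k * Fintype.card n)) :
    ∑ x with IsUnit ((pencilDet A B).eval x), ‖lineSum ψ (A + x • B) u‖ ≤
      √(p : ℝ) ^ (k * Fintype.card n + 4 * k - 1) := by
  obtain ⟨t, ht⟩ := (isUnit_two_zmod (k := k) hp2).exists_right_inv
  refine (Finset.sum_le_card_nsmul _ _ (√(p : ℝ) ^ (k * Fintype.card n) * √(p : ℝ) ^ (2 * k - 1))
    fun x hx => ?_).trans ?_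
  · have h1 := (Finset.mem_filter.1 hx).2
    rw [eval_pencilDet] at h1
    refine (norm_lineSum_le_of_isUnit_det hk hψ hp2 (hA.add (hB.smul x)) h1 u ht).trans ?_
    gcongr
    refine norm_unitSum_le_of_odd hk hψ hp2 ?_ _
    rw [mul_comm]
    exact Nat.not_even_iff_odd.1 hodd
  · rw [nsmul_eq_mul]
    refine (mul_le_mul_of_nonneg_right (card_filter_zmod_le _) (by positivity)).trans ?_
    nth_rw 1 [← Real.sq_sqrt (Nat.cast_nonneg p)]
    rw [← pow_mul, ← pow_add, ← pow_add]
    exact le_of_eq (congrArg _ (by omega))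

theorem eval_pencilDet_add_vecMulVec_sub {R : Type*} [CommRing R] (A B : Matrix n n R) (u : n → R)
    (x : R) :
    (pencilDet (A + vecMulVec u u) B - pencilDet A B).eval x =
      u ⬝ᵥ (A + x • B).adjugate *ᵥ u := by
  rw [Polynomial.eval_sub, eval_pencilDet, eval_pencilDet,
    show A + vecMulVec u u + x • B = A + x • B + vecMulVec u u by abel, det_add_vecMulVec,
    add_sub_cancel_left]

theorem natDegree_pencilDet_sub_le {R : Type*} [CommRing R] (A A' B : Matrix n n R) :
    (pencilDet A' B - pencilDet A B).natDegree ≤ Fintype.card n :=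
  (Polynomial.natDegree_sub_le _ _).trans
    (max_le (natDegree_pencilDet_le _ _) (natDegree_pencilDet_le _ _))

open Classical in
include hk hψ hp2 hA hB in
theorem sum_norm_lineSum_regular_le_of_even (heven : Even (k * Fintype.card n))
    (hu : pencilDet (A + vecMulVec u u) B ≠ pencilDet A B) :
    ∑ x with IsUnit ((pencilDet A B).eval x), ‖lineSum ψ (A + x • B) u‖ ≤
      (Fintype.card n + 1) * √(p : ℝ) ^ (k * Fintype.card n + 4 * k - 1) := by
  obtain ⟨t, ht⟩ := (isUnit_two_zmod (k := k) hp2).exists_right_inv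
  have ht1 : IsUnit t := IsUnit.of_mul_eq_one_right 2 ht
  set N := k * Fintype.card n with hN
  set ρ := √(p : ℝ) with hρ
  have hρ2 : (p : ℝ) = ρ ^ 2 := (Real.sq_sqrt (Nat.cast_nonneg p)).symm
  have hρ1 : 1 ≤ ρ := Real.one_le_sqrt.2 (by exact_mod_cast hp.out.one_le)
  set g := pencilDet (A + vecMulVec u u) B - pencilDet A B with hg
  have hpow : ρ ^ N * (ρ ^ 2) ^ k * (ρ ^ 2) ^ (k - 1) ≤ ρ ^ (N + 4 * k - 1) := by
    rw [← pow_mul, ← pow_mul, ← pow_add, ← pow_add]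
    exact pow_le_pow_right₀ hρ1 (by omega)
  have hreg : ∀ x, IsUnit ((pencilDet A B).eval x) → ‖lineSum ψ (A + x • B) u‖ ≤
      ρ ^ N * (ρ ^ 2) ^ (k - 1) + if g.eval x = 0 then ρ ^ N * (ρ ^ 2) ^ k else 0 := by
    intro x hx
    rw [eval_pencilDet] at hx
    have hsymm := hA.add (hB.smul x)
    split_ifs with h0
    · refine (norm_lineSum_le_card_of_isUnit_det hk hψ hp2 hsymm hx u).trans ?_
      rw [← hN, ← hρ, hρ2, mul_sub]
      have : 0 ≤ ρ ^ N * (ρ ^ 2) ^ (k - 1) := by positivity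
      linarith
    · rw [add_zero]
      refine (norm_lineSum_le_of_isUnit_det hk hψ hp2 hsymm hx u ht).trans ?_
      rw [← hρ2]
      gcongr
      refine norm_unitSum_le_of_even hk hψ (by rwa [mul_comm]) fun h1 => h0 ?_
      rw [hg, eval_pencilDet_add_vecMulVec_sub]
      rw [neg_eq_zero, (ht1.pow 2).mul_right_eq_zero, Matrix.inv_def, smul_mulVec,
        dotProduct_smul, smul_eq_mul] at h1
      exact (hx.ringInverse).mul_right_eq_zero.1 h1
  refine (Finset.sum_le_sum fun x hx => hreg x (Finset.mem_filter.1 hx).2).trans ?_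
  rw [Finset.sum_add_distrib, Finset.sum_const, nsmul_eq_mul, add_comm, add_mul, one_mul]
  refine add_le_add ?_ ?_
  · refine (Finset.sum_le_sum_of_subset_of_nonneg (Finset.filter_subset _ _) fun x _ _ => ?_).trans
      ?_
    · split_ifs <;> positivity
    rw [← Finset.sum_filter, Finset.sum_const, nsmul_eq_mul]
    have h1 : ((#{x | g.eval x = 0} : ℕ) : ℝ) ≤ Fintype.card n * (ρ ^ 2) ^ (k - 1) := by
      rw [← hρ2]
      exact_mod_cast card_filter_eval_eq_zero_le hk (sub_ne_zero.2 hu)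
        (natDegree_pencilDet_sub_le A _ B)
    calc _ ≤ Fintype.card n * (ρ ^ 2) ^ (k - 1) * (ρ ^ N * (ρ ^ 2) ^ k) := by gcongr
      _ = Fintype.card n * (ρ ^ N * (ρ ^ 2) ^ k * (ρ ^ 2) ^ (k - 1)) := by ring
      _ ≤ _ := by gcongr
  · have h1 := card_filter_zmod_le (p := p) (k := k) fun x => IsUnit ((pencilDet A B).eval x)
    rw [hρ2] at h1
    calc _ ≤ (ρ ^ 2) ^ k * (ρ ^ N * (ρ ^ 2) ^ (k - 1)) := by gcongr
      _ = ρ ^ N * (ρ ^ 2) ^ k * (ρ ^ 2) ^ (k - 1) := by ring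
      _ ≤ _ := hpow

open Classical in
include hk hψ hp2 hA hB hgood in
theorem norm_sum_lineSum_residueClass_le (heven : Even (k * Fintype.card n))
    (hu : pencilDet (A + vecMulVec u u) B = pencilDet A B) (x₀ : ZMod (p ^ k)) :
    ‖∑ x with (p : ZMod (p ^ k)) ∣ x - x₀, lineSum ψ (A + x • B) u‖ ≤
      √(p : ℝ) ^ (k * Fintype.card n) * ((p : ℝ) ^ k - (p : ℝ) ^ (k - 1)) * (p : ℝ) ^ (k - 1) := by
  by_cases h0 : IsUnit ((pencilDet A B).eval x₀)
  · refine (norm_sum_le_of_le _ (n := fun _ => √(p : ℝ) ^ (k * Fintype.card n) *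
      ((p : ℝ) ^ k - (p : ℝ) ^ (k - 1))) fun x hx => ?_).trans (le_of_eq ?_)
    · have h1 := (isUnit_eval_congr hk (pencilDet A B) (Finset.mem_filter.1 hx).2).2 h0
      rw [eval_pencilDet] at h1
      exact norm_lineSum_le_card_of_isUnit_det hk hψ hp2 (hA.add (hB.smul x)) h1 u
    · rw [Finset.sum_const, nsmul_eq_mul, mul_comm]
      have h2 := card_filter_ppow_dvd_sub hk x₀ (r := 1)
      simp only [pow_one] at h2
      rw [h2, Nat.cast_pow]
  · obtain ⟨x₁, hx₁, e, β, h⟩ := exists_simpleRoot_of_not_isUnit_eval hk hA hB hgood h0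
    rw [sum_filter_dvd_sub_eq A B (fun M => lineSum ψ M u) hx₁]
    refine h.norm_sum_lineSum_le_of_phase_eq_zero hk hψ hp2 ?_ heven
    rw [show A + x₁ • B + vecMulVec u u = A + vecMulVec u u + x₁ • B by abel,
      pencilDet_add_smul, pencilDet_add_smul, hu]

omit hp in
include hk in
theorem pencilDet_swap_add_vecMulVec_eq [Fact p.Prime] (hn : Fintype.card n + 1 < p)
    (hu : pencilDet (A + vecMulVec u u) B = pencilDet A B) :
    pencilDet (B + vecMulVec u u) A = pencilDet B A := by
  classical
  by_contra hne
  have h1 := card_filter_eval_eq_zero_le hk (sub_ne_zero.2 hne) (natDegree_pencilDet_sub_le B _ A)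
  have h2 : Fintype.card (ZMod (p ^ k))ˣ ≤
      #{x | (pencilDet (B + vecMulVec u u) A - pencilDet B A).eval x = 0} := by
    rw [← Finset.card_univ, ← Finset.card_map (s := Finset.univ) ⟨Units.val, Units.val_injective⟩]
    refine Finset.card_le_card fun x hx => ?_
    obtain ⟨v, -, rfl⟩ := Finset.mem_map.1 hx
    rw [Finset.mem_filter, eval_pencilDet_add_vecMulVec_sub]
    refine ⟨Finset.mem_univ _, ?_⟩
    have h3 := eval_pencilDet_add_vecMulVec_sub A B u (v⁻¹ : (ZMod (p ^ k))ˣ)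
    rw [hu, sub_self, Polynomial.eval_zero] at h3
    have h4 : B + (v : ZMod (p ^ k)) • A =
        (v : ZMod (p ^ k)) • (A + ((v⁻¹ : (ZMod (p ^ k))ˣ) : ZMod (p ^ k)) • B) := by
      rw [smul_add, smul_smul, Units.mul_inv, one_smul, add_comm]
    change u ⬝ᵥ (B + (v : ZMod (p ^ k)) • A).adjugate *ᵥ u = 0
    rw [h4, Matrix.adjugate_smul, smul_mulVec, dotProduct_smul, ← h3, smul_zero]
  rw [card_zmod_units_prime_pow hk] at h2
  have h5 : p ^ k = p * p ^ (k - 1) := by rw [← pow_succ', Nat.sub_add_cancel hk]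
  have h6 : 0 < p ^ (k - 1) := pow_pos (by omega) _
  have h7 := h2.trans h1
  rw [h5] at h7
  have h8 : (Fintype.card n + 2) * p ^ (k - 1) ≤ p * p ^ (k - 1) := Nat.mul_le_mul_right _ hn
  rw [add_mul] at h8
  omega

open Classical in
include hk hψ hp2 hA hB hgood in
theorem norm_sum_lineSum_projectiveLine_le
    (hgood' : ∀ x, IsUnit ((pencilDet B A).eval x) ∨ IsUnit ((pencilDet B A).derivative.eval x))
    (hn : (2 * Fintype.card n + 2) ^ 2 ≤ p) :
    ‖∑ x : ZMod (p ^ k), lineSum ψ (A + x • B) u +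
      ∑ y with (p : ZMod (p ^ k)) ∣ y, lineSum ψ (B + y • A) u‖ ≤
      √(p : ℝ) ^ (k * Fintype.card n + 4 * k) := by
  have hinf := sum_norm_lineSum_le hk hψ hp2 hB hA hgood' u le_rfl hk 0
  simp only [sub_zero, pow_one] at hinf
  have hsing := sum_norm_lineSum_singular_le hk hψ hp2 hA hB hgood u
  set N := k * Fintype.card n with hN
  set ρ := √(p : ℝ) with hρ
  have hρ2 : (p : ℝ) = ρ ^ 2 := (Real.sq_sqrt (Nat.cast_nonneg p)).symm
  have hρn : 2 * (Fintype.card n : ℝ) + 2 ≤ ρ := Real.le_sqrt_of_sq_le (by exact_mod_cast hn)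
  have hsucc : ρ ^ (N + 4 * k) = ρ * ρ ^ (N + 4 * k - 1) := by
    rw [← pow_succ']
    congr 1
    omega
  have hP : 0 ≤ ρ ^ (N + 4 * k - 1) := by positivity
  have habs : ∑ x with IsUnit ((pencilDet A B).eval x), ‖lineSum ψ (A + x • B) u‖ ≤
      (Fintype.card n + 1) * ρ ^ (N + 4 * k - 1) →
      ‖∑ x : ZMod (p ^ k), lineSum ψ (A + x • B) u +
        ∑ y with (p : ZMod (p ^ k)) ∣ y, lineSum ψ (B + y • A) u‖ ≤ ρ ^ (N + 4 * k) := by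
    intro h
    refine (norm_add_le _ _).trans
      ((add_le_add (norm_sum_le _ _) ((norm_sum_le _ _).trans hinf)).trans ?_)
    rw [← Finset.sum_filter_add_sum_filter_not Finset.univ
      fun x => IsUnit ((pencilDet A B).eval x), hsucc]
    nlinarith [mul_le_mul_of_nonneg_right hρn hP]
  have hcn : (0 : ℝ) ≤ Fintype.card n := Nat.cast_nonneg _
  by_cases heven : Even N
  · by_cases hu : pencilDet (A + vecMulVec u u) B = pencilDet A B
    · have hn1 : Fintype.card n + 1 < p := by nlinarith
      have h1 := norm_sum_lineSum_residueClass_le hk hψ hp2 hB hA hgood' u heven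
        (pencilDet_swap_add_vecMulVec_eq hk u hn1 hu) 0
      simp only [sub_zero] at h1
      have h2 : ‖∑ x : ZMod (p ^ k), lineSum ψ (A + x • B) u‖ ≤
          p * (ρ ^ N * ((p : ℝ) ^ k - (p : ℝ) ^ (k - 1)) * (p : ℝ) ^ (k - 1)) := by
        rw [← Finset.sum_fiberwise Finset.univ (red p k hk)]
        refine (norm_sum_le_of_le _ (n := fun _ => ρ ^ N * ((p : ℝ) ^ k -
          (p : ℝ) ^ (k - 1)) * (p : ℝ) ^ (k - 1)) fun c _ => ?_).trans (le_of_eq ?_)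
        · obtain ⟨x₀, rfl⟩ := red_surjective hk c
          simp only [red_eq_iff hk]
          exact norm_sum_lineSum_residueClass_le hk hψ hp2 hA hB hgood u heven hu x₀
        · rw [Finset.sum_const, nsmul_eq_mul, Finset.card_univ, ZMod.card]
      refine (norm_add_le _ _).trans ((add_le_add h2 h1).trans ?_)
      obtain ⟨l, rfl⟩ : ∃ l, k = l + 1 := ⟨k - 1, by omega⟩
      rw [Nat.add_sub_cancel, ← hρ, ← hN, hρ2]
      have h3 : ρ ^ (N + 4 * (l + 1)) - (ρ ^ 2 * (ρ ^ N * ((ρ ^ 2) ^ (l + 1) - (ρ ^ 2) ^ l) *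
          (ρ ^ 2) ^ l) + ρ ^ N * ((ρ ^ 2) ^ (l + 1) - (ρ ^ 2) ^ l) * (ρ ^ 2) ^ l) =
          ρ ^ N * ρ ^ (4 * l) := by ring
      have h4 : 0 ≤ ρ ^ N * ρ ^ (4 * l) := by positivity
      linarith
    · exact habs (sum_norm_lineSum_regular_le_of_even hk hψ hp2 hA hB u heven hu)
  · refine habs ((sum_norm_lineSum_regular_le_of_odd hk hψ hp2 hA hB u heven).trans ?_)
    nlinarith

end TotalBound

section Valuation

variable {p : ℕ} [hp : Fact p.Prime] {k : ℕ}

/-- The exponent of `p` in an element of `ℤ / p ^ k`, equal to `k` at zero. -/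
noncomputable def pval (x : ZMod (p ^ k)) : ℕ := (exists_eq_ppow_mul_unit x).choose

theorem pval_le (x : ZMod (p ^ k)) : pval x ≤ k := (exists_eq_ppow_mul_unit x).choose_spec.1

theorem eq_ppow_pval_mul (x : ZMod (p ^ k)) :
    ∃ v : (ZMod (p ^ k))ˣ, x = (p : ZMod (p ^ k)) ^ pval x * v :=
  (exists_eq_ppow_mul_unit x).choose_spec.2

theorem ppow_dvd_ppow_mul_unit_iff {i : ℕ} (hi : i ≤ k) (j : ℕ) (v : (ZMod (p ^ k))ˣ) :
    (p : ZMod (p ^ k)) ^ i ∣ p ^ j * v ↔ i ≤ j := by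
  rw [Units.dvd_mul_right]
  have h := ppow_dvd_natCast_iff (p := p) hi (p ^ j)
  rw [Nat.cast_pow] at h
  rw [h, Nat.pow_dvd_pow_iff_le_right hp.out.one_lt]

theorem ppow_dvd_iff_le_pval {i : ℕ} (hi : i ≤ k) (x : ZMod (p ^ k)) :
    (p : ZMod (p ^ k)) ^ i ∣ x ↔ i ≤ pval x := by
  obtain ⟨v, hv⟩ := eq_ppow_pval_mul x
  conv_lhs => rw [hv]
  exact ppow_dvd_ppow_mul_unit_iff hi _ v

theorem pval_mul_le (x y : ZMod (p ^ k)) : pval (x * y) ≤ pval x + pval y := by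
  obtain ⟨v, hv⟩ := eq_ppow_pval_mul x
  obtain ⟨w, hw⟩ := eq_ppow_pval_mul y
  rw [← ppow_dvd_ppow_mul_unit_iff (pval_le (x * y)) _ (v * w), Units.val_mul,
    show (p : ZMod (p ^ k)) ^ (pval x + pval y) * (v * w) = p ^ pval x * v * (p ^ pval y * w) by
      ring, ← hv, ← hw, ppow_dvd_iff_le_pval (pval_le _)]

theorem ppow_pval_mul_eq_zero {x y : ZMod (p ^ k)} (h : x * y = 0) :
    (p : ZMod (p ^ k)) ^ pval x * y = 0 := by
  obtain ⟨v, hv⟩ := eq_ppow_pval_mul x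
  rw [hv, mul_right_comm] at h
  exact v.isUnit.mul_left_eq_zero.1 h

omit hp in
theorem ppow_mul_eq_zero_of_le {i j : ℕ} (hij : i ≤ j) {y : ZMod (p ^ k)}
    (h : (p : ZMod (p ^ k)) ^ i * y = 0) : (p : ZMod (p ^ k)) ^ j * y = 0 := by
  obtain ⟨l, rfl⟩ := Nat.exists_eq_add_of_le hij
  rw [pow_add, mul_right_comm, h, zero_mul]

theorem p_mul_eq_zero_of_two_mul_eq_zero {y : ZMod (p ^ k)} (h : 2 * y = 0) :
    (p : ZMod (p ^ k)) * y = 0 := by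
  by_cases hp2 : p = 2
  · subst hp2
    exact_mod_cast h
  · rw [(isUnit_two_zmod hp2).mul_right_eq_zero.1 h, mul_zero]

variable {n : Type*} [Fintype n] [DecidableEq n]

theorem card_filter_ppow_smul_eq_zero_le (i : ℕ) :
    #{w : n → ZMod (p ^ k) | (p : ZMod (p ^ k)) ^ i • w = 0} ≤ (p ^ i) ^ Fintype.card n := by
  rcases le_or_gt i k with hi | hi
  · exact (card_filter_ppow_smul_eq_zero hi).le
  · refine (Finset.card_le_univ _).trans ?_
    rw [Fintype.card_fun, ZMod.card]
    exact Nat.pow_le_pow_left (Nat.pow_le_pow_right hp.out.pos hi.le) _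

theorem card_filter_ppow_mul_eq_zero_le (i : ℕ) :
    #{x : ZMod (p ^ k) | (p : ZMod (p ^ k)) ^ i * x = 0} ≤ p ^ i := by
  rcases le_or_gt i k with hi | hi
  · exact (card_filter_ppow_mul_eq_zero hi).le
  · refine (Finset.card_le_univ _).trans ?_
    rw [ZMod.card]
    exact Nat.pow_le_pow_right hp.out.pos hi.le

/-- The kernel of a matrix over `ℤ / p ^ k` is controlled by its determinant and its minors. -/
theorem card_two_smul_mulVec_eq_zero_le (M : Matrix n n (ZMod (p ^ k))) {ν : ℕ} (hν : ν + 1 ≤ k)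
    (h : (p : ZMod (p ^ k)) ^ (ν + 1) ∣ M.det →
      ∃ a b, ¬ (p : ZMod (p ^ k)) ^ (ν + 1) ∣ M.adjugate a b) :
    #{w | (2 : ZMod (p ^ k)) • M *ᵥ w = 0} ≤
      p ^ (pval M.det + 1) * (p ^ (ν + 1)) ^ Fintype.card n := by
  have hp1 : 1 ≤ p := hp.out.one_le
  have hker : ∀ w, (2 : ZMod (p ^ k)) • M *ᵥ w = 0 → M *ᵥ ((p : ZMod (p ^ k)) • w) = 0 := by
    intro w hw
    rw [mulVec_smul]
    ext l
    exact p_mul_eq_zero_of_two_mul_eq_zero (congrFun hw l)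
  have hdet : ∀ w, (2 : ZMod (p ^ k)) • M *ᵥ w = 0 → ∀ l,
      (p : ZMod (p ^ k)) ^ (pval M.det + 1) * w l = 0 := by
    intro w hw l
    have h1 : M.det * (p * w l) = 0 := by
      have h2 : M.adjugate *ᵥ (M *ᵥ ((p : ZMod (p ^ k)) • w)) = 0 := by rw [hker w hw, mulVec_zero]
      rw [mulVec_mulVec, adjugate_mul, smul_mulVec, one_mulVec] at h2
      exact congrFun h2 l
    rw [pow_succ, mul_assoc]
    exact ppow_pval_mul_eq_zero h1
  by_cases hd : (p : ZMod (p ^ k)) ^ (ν + 1) ∣ M.det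
  · obtain ⟨a, b, hab⟩ := h hd
    rw [ppow_dvd_iff_le_pval hν, not_le, Nat.lt_succ_iff] at hab
    refine (Finset.card_le_mul_card_image (f := fun w => w a) _ ((p ^ (ν + 1)) ^ Fintype.card n)
      fun c hc => ?_).trans ?_
    · obtain ⟨w₀, hw₀, rfl⟩ := Finset.mem_image.1 hc
      refine (Finset.card_le_card_of_injOn (fun w => w - w₀) (fun w hw => ?_) ?_).trans
        (card_filter_ppow_smul_eq_zero_le (p := p) (k := k) (n := n) (ν + 1))
      · simp only [Finset.coe_filter, Finset.mem_filter, Finset.mem_univ, true_and,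
          Set.mem_ofPred_eq] at hw hw₀ ⊢
        ext l
        rw [Pi.smul_apply, Pi.sub_apply, Pi.zero_apply, smul_eq_mul]
        have h1 := adjugate_mul_apply_of_mulVec_eq_zero (hker w hw.1) a b l
        have h2 := adjugate_mul_apply_of_mulVec_eq_zero (hker w₀ hw₀) a b l
        simp only [Pi.smul_apply, smul_eq_mul] at h1 h2
        rw [hw.2] at h1
        refine ppow_mul_eq_zero_of_le (Nat.succ_le_succ hab) ?_
        rw [pow_succ, mul_assoc]
        refine ppow_pval_mul_eq_zero ?_
        linear_combination h1 - h2
      · exact (sub_left_injective (b := w₀)).injOn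
    · rw [mul_comm]
      gcongr
      refine (Finset.card_le_card fun c hc => ?_).trans
        (card_filter_ppow_mul_eq_zero_le (p := p) (k := k) _)
      obtain ⟨w₀, hw₀, rfl⟩ := Finset.mem_image.1 hc
      exact Finset.mem_filter.2 ⟨Finset.mem_univ _, hdet w₀ (Finset.mem_filter.1 hw₀).2 a⟩
  · rw [ppow_dvd_iff_le_pval hν, not_le] at hd
    refine (Finset.card_le_card fun w hw => ?_).trans
      ((card_filter_ppow_smul_eq_zero_le (p := p) (k := k) (n := n) (ν + 1)).trans
        (Nat.le_mul_of_pos_left _ (by positivity)))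
    refine Finset.mem_filter.2 ⟨Finset.mem_univ _, ?_⟩
    ext l
    exact ppow_mul_eq_zero_of_le hd (hdet w (Finset.mem_filter.1 hw).2 l)

end Valuation

section ValuationSums

variable {p : ℕ} [hp : Fact p.Prime] {k : ℕ}

open Classical in
theorem sum_sqrt_pow_pval_le (hk : 1 ≤ k) (j : ℕ) : ∀ r : ℕ, r + j = k →
    ∑ x with (p : ZMod (p ^ k)) ^ r ∣ x, √(p : ℝ) ^ pval x ≤ 4 * √(p : ℝ) ^ (k + j) := by
  set ρ := √(p : ℝ) with hρ
  have hρ2 : (p : ℝ) = ρ ^ 2 := (Real.sq_sqrt (Nat.cast_nonneg p)).symm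
  have hp2 : (2 : ℝ) ≤ p := by exact_mod_cast hp.out.two_le
  have hρ1 : 4 / 3 ≤ ρ := Real.le_sqrt_of_sq_le (by norm_num; linarith)
  have hρ0 : 0 < ρ := by linarith
  induction j with
  | zero =>
    rintro r rfl
    have hset : ({x | (p : ZMod (p ^ r)) ^ r ∣ x} : Finset (ZMod (p ^ r))) = {0} := by
      ext x
      simp [ppow_eq_zero]
    rw [add_zero, hset, Finset.sum_singleton, add_zero]
    have h1 : ρ ^ pval (0 : ZMod (p ^ r)) ≤ ρ ^ r :=
      pow_le_pow_right₀ (by linarith) (pval_le _)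
    have h2 : 0 ≤ ρ ^ r := by positivity
    linarith
  | succ j ih =>
    intro r hr
    rw [sum_filter_ppow_dvd_eq_shell_add]
    have h1 := ih (r + 1) (by omega)
    have h2 : ∑ x ∈ ppowShell p k r, ρ ^ pval x ≤ ρ ^ (k + j + 1) := by
      have hcard := card_shell (p := p) (k := k) (r := r) (by omega)
      refine (Finset.sum_le_card_nsmul _ _ (ρ ^ r) fun x hx => ?_).trans ?_
      · obtain ⟨α, rfl⟩ := exists_unit_of_mem_shell hk hx
        refine pow_le_pow_right₀ (by linarith) ?_
        rw [← ppow_dvd_ppow_mul_unit_iff (pval_le _) r α, ppow_dvd_iff_le_pval (pval_le _)]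
      · rw [nsmul_eq_mul, hcard, sub_mul, hρ2, show k - r = j + 1 by omega, ← pow_mul, ← pow_add]
        have h3 : 0 ≤ (ρ ^ 2) ^ (k - (r + 1)) * ρ ^ r := by positivity
        rw [show 2 * (j + 1) + r = k + j + 1 by omega]
        linarith
    have h3 : ρ ^ (k + (j + 1)) = ρ ^ (k + j) * ρ := by rw [← add_assoc, pow_succ]
    have h4 : ρ ^ (k + j + 1) = ρ ^ (k + j) * ρ := pow_succ _ _
    have h5 : 0 < ρ ^ (k + j) := by positivity
    rw [h3]
    rw [h4] at h2
    nlinarith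

/-- The values of a polynomial on a small residue class are no closer to zero than the distance to
a point of that class where the value is smallest. -/
theorem pval_eval_le_add (f : Polynomial (ZMod (p ^ k))) {ν : ℕ} (hν : ν + 1 ≤ k)
    (hf : ∀ x, (p : ZMod (p ^ k)) ^ (ν + 1) ∣ f.eval x →
      ¬ (p : ZMod (p ^ k)) ^ (ν + 1) ∣ f.derivative.eval x)
    {x y : ZMod (p ^ k)} (hxy : (p : ZMod (p ^ k)) ^ (ν + 1) ∣ x - y)
    (hle : pval (f.eval x) ≤ pval (f.eval y)) : pval (f.eval x) ≤ ν + pval (x - y) := by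
  by_cases h : (p : ZMod (p ^ k)) ^ (ν + 1) ∣ f.eval y
  · obtain ⟨q, hq⟩ := Polynomial.binomExpansion f y (x - y)
    have h1 : ¬ (p : ZMod (p ^ k)) ^ (ν + 1) ∣ f.derivative.eval y + q * (x - y) := by
      rw [dvd_add_left (hxy.mul_left q)]
      exact hf y h
    rw [ppow_dvd_iff_le_pval hν] at h1
    have h2 : f.eval x - f.eval y = (f.derivative.eval y + q * (x - y)) * (x - y) := by
      rw [add_sub_cancel] at hq
      linear_combination hq
    have h3 := pval_mul_le (f.derivative.eval y + q * (x - y)) (x - y)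
    rw [← h2] at h3
    have h4 : pval (f.eval x) ≤ pval (f.eval x - f.eval y) := by
      rw [← ppow_dvd_iff_le_pval (pval_le _)]
      exact dvd_sub ((ppow_dvd_iff_le_pval (pval_le _) _).2 le_rfl)
        ((ppow_dvd_iff_le_pval (pval_le _) _).2 hle)
    omega
  · rw [ppow_dvd_iff_le_pval hν] at h
    omega

open Classical in
theorem sum_sqrt_pow_pval_eval_le_of_lt (f : Polynomial (ZMod (p ^ k))) {ν : ℕ}
    (hf : ∀ x, (p : ZMod (p ^ k)) ^ (ν + 1) ∣ f.eval x →
      ¬ (p : ZMod (p ^ k)) ^ (ν + 1) ∣ f.derivative.eval x)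
    {r : ℕ} (hr : ν + 1 ≤ r) (hrk : r ≤ k) (x₀ : ZMod (p ^ k)) :
    ∑ x with (p : ZMod (p ^ k)) ^ r ∣ x - x₀, √(p : ℝ) ^ pval (f.eval x) ≤
      4 * √(p : ℝ) ^ ν * √(p : ℝ) ^ (2 * k - r) := by
  have hρ1 : 1 ≤ √(p : ℝ) := Real.one_le_sqrt.2 (by exact_mod_cast hp.out.one_le)
  obtain ⟨y, hy, hmax⟩ := Finset.exists_max_image
    (Finset.univ.filter fun x => (p : ZMod (p ^ k)) ^ r ∣ x - x₀) (fun x => pval (f.eval x))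
    ⟨x₀, by simp⟩
  have hy' := (Finset.mem_filter.1 hy).2
  have h1 : ∑ x with (p : ZMod (p ^ k)) ^ r ∣ x - x₀, √(p : ℝ) ^ pval (f.eval x) ≤
      ∑ x with (p : ZMod (p ^ k)) ^ r ∣ x - x₀, √(p : ℝ) ^ ν * √(p : ℝ) ^ pval (x - y) := by
    refine Finset.sum_le_sum fun x hx => ?_
    rw [← pow_add]
    refine pow_le_pow_right₀ hρ1 (pval_eval_le_add f (hr.trans hrk) hf ?_ (hmax x hx))
    refine (pow_dvd_pow _ hr).trans ?_
    rw [show x - y = x - x₀ - (y - x₀) by ring]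
    exact dvd_sub (Finset.mem_filter.1 hx).2 hy'
  have h2 : ∑ x with (p : ZMod (p ^ k)) ^ r ∣ x - x₀, √(p : ℝ) ^ pval (x - y) =
      ∑ x with (p : ZMod (p ^ k)) ^ r ∣ x, √(p : ℝ) ^ pval x := by
    refine Finset.sum_equiv (Equiv.subRight y) (fun x => ?_) fun x _ => rfl
    simp only [Finset.mem_filter, Finset.mem_univ, true_and, Equiv.subRight_apply]
    rw [show x - x₀ = x - y + (y - x₀) by ring]
    exact dvd_add_left hy'
  rw [← Finset.mul_sum, h2] at h1
  have h3 := sum_sqrt_pow_pval_le (p := p) (k := k) (by omega) (k - r) r (by omega)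
  rw [show k + (k - r) = 2 * k - r by omega] at h3
  calc _ ≤ _ := h1
    _ ≤ √(p : ℝ) ^ ν * (4 * √(p : ℝ) ^ (2 * k - r)) := by gcongr
    _ = _ := by ring

open Classical in
theorem sum_sqrt_pow_pval_eval_le (f : Polynomial (ZMod (p ^ k))) {ν : ℕ} (hν : ν + 1 ≤ k)
    (hf : ∀ x, (p : ZMod (p ^ k)) ^ (ν + 1) ∣ f.eval x →
      ¬ (p : ZMod (p ^ k)) ^ (ν + 1) ∣ f.derivative.eval x)
    {r : ℕ} (hrk : r ≤ k) (x₀ : ZMod (p ^ k)) :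
    ∑ x with (p : ZMod (p ^ k)) ^ r ∣ x - x₀, √(p : ℝ) ^ pval (f.eval x) ≤
      4 * √(p : ℝ) ^ (4 * ν + 2) * √(p : ℝ) ^ (2 * k - r) := by
  have hρ2 : (p : ℝ) = √(p : ℝ) ^ 2 := (Real.sq_sqrt (Nat.cast_nonneg p)).symm
  have hρ1 : 1 ≤ √(p : ℝ) := Real.one_le_sqrt.2 (by exact_mod_cast hp.out.one_le)
  rcases le_or_gt (ν + 1) r with hr | hr
  · refine (sum_sqrt_pow_pval_eval_le_of_lt f hf hr hrk x₀).trans ?_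
    gcongr
    omega
  · refine (Finset.sum_le_sum_of_subset_of_nonneg (Finset.filter_subset _ _)
      fun x _ _ => by positivity).trans ?_
    rw [← Finset.sum_fiberwise_of_maps_to (t := Finset.range (p ^ (ν + 1)))
      (g := fun x => x.val % p ^ (ν + 1)) fun x _ => Finset.mem_range.2
        (Nat.mod_lt _ (pow_pos hp.out.pos _))]
    refine (Finset.sum_le_card_nsmul _ _
      (4 * √(p : ℝ) ^ ν * √(p : ℝ) ^ (2 * k - (ν + 1))) fun c _ => ?_).trans ?_
    · refine (Finset.sum_le_sum_of_subset_of_nonneg (fun x hx => ?_)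
        fun x _ _ => by positivity).trans
        (sum_sqrt_pow_pval_eval_le_of_lt f hf le_rfl hν (c : ZMod (p ^ k)))
      rw [Finset.mem_filter] at hx ⊢
      refine ⟨Finset.mem_univ _, ?_⟩
      rw [← hx.2]
      nth_rw 1 [← ZMod.natCast_zmod_val x, ← Nat.mod_add_div x.val (p ^ (ν + 1))]
      rw [Nat.cast_add, add_sub_cancel_left, Nat.cast_mul, Nat.cast_pow]
      exact dvd_mul_right _ _
    · rw [Finset.card_range, nsmul_eq_mul, Nat.cast_pow]
      nth_rw 1 [hρ2]
      calc _ = 4 * (√(p : ℝ) ^ (2 * (ν + 1)) * √(p : ℝ) ^ ν * √(p : ℝ) ^ (2 * k - (ν + 1))) := by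
            rw [← pow_mul]
            ring
        _ = 4 * (√(p : ℝ) ^ (2 * (ν + 1) + ν + (2 * k - (ν + 1)))) := by rw [pow_add, pow_add]
        _ ≤ 4 * (√(p : ℝ) ^ (4 * ν + 2 + (2 * k - r))) := by
            exact mul_le_mul_of_nonneg_left (pow_le_pow_right₀ hρ1 (by omega)) (by norm_num)
        _ = _ := by rw [pow_add]; ring

end ValuationSums

section UniformBound

variable {p : ℕ} [hp : Fact p.Prime] {k : ℕ}
  {ψ : AddChar (ZMod (p ^ k)) ℂ}
  {n : Type*} [Fintype n] [DecidableEq n] {A B : Matrix n n (ZMod (p ^ k))}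

theorem norm_lineSum_le_of_norm_quadSum_le (M : Matrix n n (ZMod (p ^ k))) (u : n → ZMod (p ^ k))
    {c : ℝ} (hc : ∀ m : (ZMod (p ^ k))ˣ, ‖quadSum ψ ((m : ZMod (p ^ k)) • M) u‖ ≤ c) :
    ‖lineSum ψ M u‖ ≤ (p : ℝ) ^ k * c := by
  have hc0 : 0 ≤ c := (norm_nonneg _).trans (hc 1)
  refine (norm_sum_le_of_le _ fun m _ => hc m).trans ?_
  rw [Finset.sum_const, nsmul_eq_mul]
  gcongr
  have h : Fintype.card (ZMod (p ^ k))ˣ ≤ Fintype.card (ZMod (p ^ k)) :=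
    Fintype.card_le_of_injective _ Units.val_injective
  rw [ZMod.card] at h
  exact_mod_cast h

theorem norm_lineSum_le_trivial (M : Matrix n n (ZMod (p ^ k))) (u : n → ZMod (p ^ k)) :
    ‖lineSum ψ M u‖ ≤ (p : ℝ) ^ k * ((p : ℝ) ^ k) ^ Fintype.card n := by
  refine norm_lineSum_le_of_norm_quadSum_le M u fun m => ?_
  refine (norm_sum_le_of_le _ fun z _ => (AddChar.norm_apply ψ _).le).trans ?_
  rw [Finset.sum_const, nsmul_eq_mul, mul_one, Finset.card_univ, Fintype.card_fun, ZMod.card]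
  exact_mod_cast le_rfl

theorem norm_lineSum_le_of_minors (hψ : ψ.IsPrimitive) {M : Matrix n n (ZMod (p ^ k))}
    (hM : M.IsSymm) {ν : ℕ}
    (hν : ν + 1 ≤ k) (h : (p : ZMod (p ^ k)) ^ (ν + 1) ∣ M.det →
      ∃ a b, ¬ (p : ZMod (p ^ k)) ^ (ν + 1) ∣ M.adjugate a b) (u : n → ZMod (p ^ k)) :
    ‖lineSum ψ M u‖ ≤ √(p : ℝ) ^ (k * Fintype.card n + 2 * k + 1 + (ν + 1) * Fintype.card n) *
      √(p : ℝ) ^ pval M.det := by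
  set ρ := √(p : ℝ) with hρ
  have hρ2 : (p : ℝ) = ρ ^ 2 := (Real.sq_sqrt (Nat.cast_nonneg p)).symm
  have hρ0 : 0 ≤ ρ := Real.sqrt_nonneg _
  refine (norm_lineSum_le_of_norm_quadSum_le M u (c := ρ ^ (k * Fintype.card n) *
    (ρ ^ (pval M.det + 1) * ρ ^ ((ν + 1) * Fintype.card n))) fun m => ?_).trans (le_of_eq ?_)
  · refine le_of_sq_le_sq ?_ (by positivity)
    refine (normSq_quadSum_le hψ (hM.smul (m : ZMod (p ^ k))) u).trans ?_
    have h1 : (#{w | (2 : ZMod (p ^ k)) • ((m : ZMod (p ^ k)) • M) *ᵥ w = 0} : ℕ) =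
        #{w | (2 : ZMod (p ^ k)) • M *ᵥ w = 0} := by
      congr 1
      ext w
      simp only [Finset.mem_filter, Finset.mem_univ, true_and]
      rw [smul_mulVec, smul_comm]
      exact m.isUnit.smul_eq_zero
    have h2 := card_two_smul_mulVec_eq_zero_le M hν h
    rw [← h1] at h2
    have h3 : ((#{w | (2 : ZMod (p ^ k)) • ((m : ZMod (p ^ k)) • M) *ᵥ w = 0} : ℕ) : ℝ) ≤
        (ρ ^ 2) ^ (pval M.det + 1) * ((ρ ^ 2) ^ (ν + 1)) ^ Fintype.card n := by
      rw [← hρ2]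
      exact_mod_cast h2
    rw [ZMod.card, Nat.cast_pow]
    nth_rw 1 [hρ2]
    calc _ ≤ ((ρ ^ 2) ^ k) ^ Fintype.card n *
          ((ρ ^ 2) ^ (pval M.det + 1) * ((ρ ^ 2) ^ (ν + 1)) ^ Fintype.card n) := by gcongr
      _ = _ := by
        simp only [← pow_mul, mul_pow]
        ring
  · rw [hρ2]
    ring

open Classical in
/-- A bound valid at every prime, with a constant depending on `p`. -/
theorem sum_norm_lineSum_le_of_not_dvd (hψ : ψ.IsPrimitive) (hA : A.IsSymm) (hB : B.IsSymm) {ν : ℕ}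
    (hf : ν + 1 ≤ k → ∀ x, (p : ZMod (p ^ k)) ^ (ν + 1) ∣ (pencilDet A B).eval x →
      ¬ (p : ZMod (p ^ k)) ^ (ν + 1) ∣ (pencilDet A B).derivative.eval x)
    (u : n → ZMod (p ^ k)) {r : ℕ} (hrk : r ≤ k) (x₀ : ZMod (p ^ k)) :
    ∑ x with (p : ZMod (p ^ k)) ^ r ∣ x - x₀, ‖lineSum ψ (A + x • B) u‖ ≤
      4 * √(p : ℝ) ^ (4 * ν + 3 + (ν + 1) * Fintype.card n) *
        √(p : ℝ) ^ (k * Fintype.card n + 4 * k - r) := by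
  set ρ := √(p : ℝ) with hρ
  have hρ2 : (p : ℝ) = ρ ^ 2 := (Real.sq_sqrt (Nat.cast_nonneg p)).symm
  have hρ1 : 1 ≤ ρ := Real.one_le_sqrt.2 (by exact_mod_cast hp.out.one_le)
  rcases le_or_gt (ν + 1) k with hν | hν
  · have hf' := hf hν
    have h1 := sum_sqrt_pow_pval_eval_le (pencilDet A B) hν hf' hrk x₀
    rw [← hρ] at h1
    refine (Finset.sum_le_sum fun x _ => norm_lineSum_le_of_minors hψ (hA.add (hB.smul x)) hν
      (fun hd => ?_) u).trans ?_
    · by_contra! hab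
      rw [← eval_pencilDet] at hd
      refine hf' x hd ?_
      rw [eval_derivative_pencilDet, Matrix.trace]
      refine Finset.dvd_sum fun i _ => ?_
      rw [Matrix.diag_apply, Matrix.mul_apply]
      exact Finset.dvd_sum fun j _ => (hab i j).mul_right _
    · rw [← Finset.mul_sum]
      simp only [eval_pencilDet] at h1
      calc _ ≤ ρ ^ (k * Fintype.card n + 2 * k + 1 + (ν + 1) * Fintype.card n) *
            (4 * ρ ^ (4 * ν + 2) * ρ ^ (2 * k - r)) := by gcongr
        _ = 4 * ρ ^ (k * Fintype.card n + 2 * k + 1 + (ν + 1) * Fintype.card n + (4 * ν + 2) +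
            (2 * k - r)) := by rw [pow_add ρ _ (2 * k - r), pow_add ρ _ (4 * ν + 2)]; ring
        _ = 4 * ρ ^ (4 * ν + 3 + (ν + 1) * Fintype.card n + (k * Fintype.card n + 4 * k - r)) := by
            congr 2
            omega
        _ = _ := by rw [pow_add]; ring
  · refine (Finset.sum_le_sum fun x _ => norm_lineSum_le_trivial (A + x • B) u).trans ?_
    rw [Finset.sum_const, nsmul_eq_mul]
    have h1 := card_filter_zmod_le (p := p) (k := k) fun x => (p : ZMod (p ^ k)) ^ r ∣ x - x₀
    calc _ ≤ (p : ℝ) ^ k * ((p : ℝ) ^ k * ((p : ℝ) ^ k) ^ Fintype.card n) := by gcongr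
      _ = 1 * ρ ^ (4 * k + 2 * (k * Fintype.card n)) := by rw [hρ2]; ring
      _ ≤ 4 * ρ ^ (4 * ν + 3 + (ν + 1) * Fintype.card n + (k * Fintype.card n + 4 * k - r)) := by
          have h2 : k * Fintype.card n ≤ (ν + 1) * Fintype.card n := Nat.mul_le_mul_right _ hν.le
          exact mul_le_mul (by norm_num) (pow_le_pow_right₀ hρ1 (by omega)) (by positivity)
            (by norm_num)
      _ = _ := by rw [pow_add]; ring

end UniformBound

section Nonsingular

variable {n : Type*} [Fintype n] [DecidableEq n]

theorem exists_isotropic_mem_ker_of_trace_adjugate_mul_eq_zero {M B : Matrix n n ℂ}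
    (hM : M.IsSymm) (hB : B.IsSymm) (hdet : M.det = 0) (htr : (M.adjugate * B).trace = 0) :
    ∃ e : n → ℂ, e ≠ 0 ∧ M *ᵥ e = 0 ∧ e ⬝ᵥ B *ᵥ e = 0 := by
  by_cases hK : ∃ j, M.adjugate j j ≠ 0
  · obtain ⟨j, hj⟩ := hK
    refine ⟨fun i => M.adjugate i j, fun h => hj (congrFun h j), mulVec_adjugate_col hdet j, ?_⟩
    rw [adjugate_col_form hdet hM, htr, mul_zero]
  push Not at hK
  obtain ⟨e, he0, he⟩ := Matrix.exists_mulVec_eq_zero_iff.2 hdet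
  obtain ⟨i, hi⟩ := Function.ne_iff.1 he0
  have h1 := hK i
  rw [Matrix.adjugate_apply] at h1
  obtain ⟨v, hv0, hv⟩ := Matrix.exists_mulVec_eq_zero_iff.2 h1
  have hvi : v i = 0 := by
    have := congrFun hv i
    simpa [Matrix.mulVec] using this
  have hvl : ∀ l, l ≠ i → (M *ᵥ v) l = 0 := fun l hl => by
    have := congrFun hv l
    simpa [Matrix.mulVec, Matrix.updateRow_ne hl] using this
  have hMv : M *ᵥ v = 0 := by
    have h2 : e ⬝ᵥ M *ᵥ v = 0 := by
      rw [← mulVec_dotProduct_of_isSymm hM, he, zero_dotProduct]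
    rw [dotProduct, Finset.sum_eq_single i (fun l _ hl => by rw [hvl l hl, mul_zero])
      (by simp)] at h2
    ext l
    by_cases hl : l = i
    · subst hl
      exact (mul_eq_zero.1 h2).resolve_left hi
    · exact hvl l hl
  by_cases hvv : v ⬝ᵥ B *ᵥ v = 0
  · exact ⟨v, hv0, hMv, hvv⟩
  obtain ⟨x, hx⟩ := exists_quadratic_eq_zero (b := 2 * (B *ᵥ v ⬝ᵥ e)) (c := e ⬝ᵥ B *ᵥ e) hvv (by
    obtain ⟨z, hz⟩ := IsAlgClosed.exists_pow_nat_eq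
      (discrim (v ⬝ᵥ B *ᵥ v) (2 * (B *ᵥ v ⬝ᵥ e)) (e ⬝ᵥ B *ᵥ e)) (n := 2) (by norm_num)
    exact ⟨z, by rw [← hz, sq]⟩)
  refine ⟨e + x • v, fun h => hi ?_, ?_, ?_⟩
  · simpa [hvi] using congrFun h i
  · rw [Matrix.mulVec_add, Matrix.mulVec_smul, he, hMv, smul_zero, add_zero]
  · rw [quadratic_add hB, ← hx]
    simp only [Matrix.mulVec_smul, smul_dotProduct, dotProduct_smul, smul_eq_mul]
    ring

theorem eval_derivative_pencilDet_ne_zero {A B : Matrix n n ℂ} (hA : A.IsSymm) (hB : B.IsSymm)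
    (hns : ∀ x : n → ℂ, x ≠ 0 → x ⬝ᵥ A *ᵥ x = 0 → x ⬝ᵥ B *ᵥ x = 0 →
      LinearIndependent ℂ ![A *ᵥ x, B *ᵥ x])
    {t : ℂ} (h0 : (pencilDet A B).eval t = 0) : (pencilDet A B).derivative.eval t ≠ 0 := by
  intro h1
  rw [eval_pencilDet] at h0
  rw [eval_derivative_pencilDet] at h1
  obtain ⟨e, he0, he, heB⟩ :=
    exists_isotropic_mem_ker_of_trace_adjugate_mul_eq_zero (hA.add (hB.smul t)) hB h0 h1
  rw [Matrix.add_mulVec, Matrix.smul_mulVec] at he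
  have heA : e ⬝ᵥ A *ᵥ e = 0 := by
    have h2 := congrArg (e ⬝ᵥ ·) he
    simpa [dotProduct_add, heB] using h2
  have h3 := LinearIndependent.pair_iff.1 (hns e he0 heA heB) 1 t (by rw [one_smul, he])
  exact one_ne_zero h3.1

theorem exists_bezout_int {f g : Polynomial ℤ}
    (h : ∀ t : ℂ, Polynomial.aeval t f ≠ 0 ∨ Polynomial.aeval t g ≠ 0) :
    ∃ N : ℤ, N ≠ 0 ∧ ∃ a b : Polynomial ℤ, a * f + b * g = Polynomial.C N := by
  have h1 : IsCoprime (f.map (algebraMap ℤ ℚ)) (g.map (algebraMap ℤ ℚ)) := by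
    rw [Polynomial.isCoprime_iff_aeval_ne_zero_of_isAlgClosed ℚ ℂ]
    intro t
    simpa only [Polynomial.aeval_map_algebraMap] using h t
  obtain ⟨a, b, hab⟩ := h1
  obtain ⟨m, hm, hma⟩ := IsLocalization.integerNormalization_spec (nonZeroDivisors ℤ) a
  obtain ⟨l, hl, hlb⟩ := IsLocalization.integerNormalization_spec (nonZeroDivisors ℤ) b
  refine ⟨m * l, mul_ne_zero (nonZeroDivisors.ne_zero hm) (nonZeroDivisors.ne_zero hl),
    Polynomial.C l * IsLocalization.integerNormalization (nonZeroDivisors ℤ) a,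
    Polynomial.C m * IsLocalization.integerNormalization (nonZeroDivisors ℤ) b, ?_⟩
  apply Polynomial.map_injective (algebraMap ℤ ℚ) (algebraMap ℤ ℚ).injective_int
  simp only [Polynomial.map_add, Polynomial.map_mul, Polynomial.map_C, hma, hlb, map_mul]
  rw [Algebra.smul_def, Algebra.smul_def, Polynomial.algebraMap_apply, Polynomial.algebraMap_apply]
  linear_combination (Polynomial.C (algebraMap ℤ ℚ m) * Polynomial.C (algebraMap ℤ ℚ l)) * hab

theorem exists_bezout_pencilDet {A B : Matrix n n ℤ} (hA : A.IsSymm) (hB : B.IsSymm)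
    (hns : ∀ x : n → ℂ, x ≠ 0 → x ⬝ᵥ A.map (Int.castRingHom ℂ) *ᵥ x = 0 →
      x ⬝ᵥ B.map (Int.castRingHom ℂ) *ᵥ x = 0 →
      LinearIndependent ℂ ![A.map (Int.castRingHom ℂ) *ᵥ x, B.map (Int.castRingHom ℂ) *ᵥ x]) :
    ∃ N : ℤ, N ≠ 0 ∧ ∃ a b : Polynomial ℤ,
      a * pencilDet A B + b * (pencilDet A B).derivative = Polynomial.C N := by
  refine exists_bezout_int fun t => ?_
  have h1 := fun h0 => eval_derivative_pencilDet_ne_zero (hA.map (Int.castRingHom ℂ))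
    (hB.map (Int.castRingHom ℂ)) hns (t := t) h0
  rw [← map_pencilDet, Polynomial.derivative_map, Polynomial.eval_map, Polynomial.eval_map] at h1
  exact or_iff_not_imp_left.2 fun h => h1 (not_not.1 h)

end Nonsingular

section Reduction

variable {n : Type*} [Fintype n] [DecidableEq n] {A B : Matrix n n ℤ} {N : ℤ} {a b : Polynomial ℤ}
  (hab : a * pencilDet A B + b * (pencilDet A B).derivative = Polynomial.C N)
  {R : Type*} [CommRing R]

include hab in
theorem bezout_eval_pencilDet_map (x : R) :
    ∃ y z : R, y * (pencilDet (A.map (Int.castRingHom R)) (B.map (Int.castRingHom R))).eval x +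
      z * (pencilDet (A.map (Int.castRingHom R)) (B.map (Int.castRingHom R))).derivative.eval x =
      (N : R) := by
  refine ⟨(a.map (Int.castRingHom R)).eval x, (b.map (Int.castRingHom R)).eval x, ?_⟩
  rw [← map_pencilDet, Polynomial.derivative_map, ← Polynomial.eval_mul, ← Polynomial.eval_mul,
    ← Polynomial.eval_add, ← Polynomial.map_mul, ← Polynomial.map_mul, ← Polynomial.map_add, hab]
  simp

include hab in
theorem isUnit_eval_or_isUnit_eval_derivative {p : ℕ} [hp : Fact p.Prime] {k : ℕ} (hk : 1 ≤ k)
    (hN : ¬ p ∣ N.natAbs) (x : ZMod (p ^ k)) :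
    IsUnit ((pencilDet (A.map (Int.castRingHom (ZMod (p ^ k))))
      (B.map (Int.castRingHom (ZMod (p ^ k))))).eval x) ∨
    IsUnit ((pencilDet (A.map (Int.castRingHom (ZMod (p ^ k))))
      (B.map (Int.castRingHom (ZMod (p ^ k))))).derivative.eval x) := by
  obtain ⟨y, z, h⟩ := bezout_eval_pencilDet_map (R := ZMod (p ^ k)) hab x
  by_contra! hc
  rw [not_isUnit_iff_p_dvd hk, not_isUnit_iff_p_dvd hk] at hc
  have h4 : (p : ZMod (p ^ k)) ^ 1 ∣ (N : ZMod (p ^ k)) := by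
    rw [← h, pow_one]
    exact dvd_add (hc.1.mul_left _) (hc.2.mul_left _)
  refine hN ?_
  rw [← pow_one p, ← ppow_dvd_natCast_iff hk]
  rcases Int.natAbs_eq N with h5 | h5
  · rwa [h5, Int.cast_natCast] at h4
  · rwa [h5, Int.cast_neg, Int.cast_natCast, dvd_neg] at h4

include hab in
theorem not_dvd_eval_derivative_of_natAbs_lt {p : ℕ} [hp : Fact p.Prime] {k ν : ℕ} (hN0 : N ≠ 0)
    (hν : N.natAbs < p ^ ν) (hk : ν ≤ k) (x : ZMod (p ^ k))
    (h1 : (p : ZMod (p ^ k)) ^ ν ∣ (pencilDet (A.map (Int.castRingHom (ZMod (p ^ k))))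
      (B.map (Int.castRingHom (ZMod (p ^ k))))).eval x) :
    ¬ (p : ZMod (p ^ k)) ^ ν ∣ (pencilDet (A.map (Int.castRingHom (ZMod (p ^ k))))
      (B.map (Int.castRingHom (ZMod (p ^ k))))).derivative.eval x := by
  intro h2
  obtain ⟨y, z, h⟩ := bezout_eval_pencilDet_map (R := ZMod (p ^ k)) hab x
  have h3 : (p : ZMod (p ^ k)) ^ ν ∣ ((N.natAbs : ℕ) : ZMod (p ^ k)) := by
    have h4 : (p : ZMod (p ^ k)) ^ ν ∣ (N : ZMod (p ^ k)) :=
      h ▸ dvd_add (h1.mul_left _) (h2.mul_left _)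
    rcases Int.natAbs_eq N with h5 | h5
    · rwa [h5, Int.cast_natCast] at h4
    · rwa [h5, Int.cast_neg, Int.cast_natCast, dvd_neg] at h4
  rw [ppow_dvd_natCast_iff hk] at h3
  exact absurd (Nat.le_of_dvd (Int.natAbs_pos.2 hN0) h3) (not_le.2 hν)

end Reduction

section PencilSum

variable {n : Type*} [Fintype n] [DecidableEq n]

open Classical in
/-- The sum of the quadratic exponential sums over the coprime members of a pencil satisfying the
linear congruence `δ * (c₁ * a₂ - c₂ * a₁) = 0`. -/
noncomputable def pencilSum {R : Type*} [CommRing R] [Fintype R] (ψ : AddChar R ℂ)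
    (A B : Matrix n n R) (u : n → R) (δ c₁ c₂ : R) : ℂ :=
  ∑ a : R × R with IsCoprime a.1 a.2 ∧ δ * (c₁ * a.2 - c₂ * a.1) = 0,
    quadSum ψ (a.1 • A + a.2 • B) u

variable {p : ℕ} [hp : Fact p.Prime] {k : ℕ}

theorem isCoprime_iff_isUnit_or (hk : 1 ≤ k) (a b : ZMod (p ^ k)) :
    IsCoprime a b ↔ IsUnit a ∨ IsUnit b := by
  refine ⟨fun ⟨x, y, h⟩ => ?_, ?_⟩
  · by_contra! hc
    rw [not_isUnit_iff_p_dvd hk, not_isUnit_iff_p_dvd hk] at hc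
    refine (isUnit_iff_not_p_dvd hk (1 : ZMod (p ^ k))).1 isUnit_one ?_
    rw [← h]
    exact dvd_add (hc.1.mul_left _) (hc.2.mul_left _)
  · rintro (h | h)
    · obtain ⟨z, hz⟩ := h.exists_left_inv
      exact ⟨z, 0, by rw [hz, zero_mul, add_zero]⟩
    · obtain ⟨z, hz⟩ := h.exists_left_inv
      exact ⟨0, z, by rw [hz, zero_mul, zero_add]⟩

open Classical in
theorem sum_filter_isUnit_eq (P : ZMod (p ^ k) × ZMod (p ^ k) → Prop) [DecidablePred P]
    (f : ZMod (p ^ k) × ZMod (p ^ k) → ℂ) :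
    ∑ a : ZMod (p ^ k) × ZMod (p ^ k) with IsUnit a.1 ∧ P a, f a =
      ∑ x : ZMod (p ^ k), ∑ m : (ZMod (p ^ k))ˣ,
        if P (m, m * x) then f (m, m * x) else 0 := by
  rw [← Finset.sum_product' univ univ
    (fun (x : ZMod (p ^ k)) (m : (ZMod (p ^ k))ˣ) => if P (m, m * x) then f (m, m * x) else 0),
    ← Finset.sum_filter]
  symm
  refine Finset.sum_bij (fun z _ => ((z.2 : ZMod (p ^ k)), z.2 * z.1)) ?_ ?_ ?_ ?_
  · intro z hz
    simpa using hz
  · rintro ⟨x, m⟩ - ⟨y, l⟩ - h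
    simp only [Prod.mk.injEq] at h
    obtain rfl := Units.ext h.1
    rw [Prod.mk.injEq]
    exact ⟨m.isUnit.mul_left_cancel h.2, rfl⟩
  · rintro ⟨a, b⟩ h
    simp only [Finset.mem_filter, Finset.mem_univ, true_and] at h
    obtain ⟨⟨m, rfl⟩, h⟩ := h
    exact ⟨(m⁻¹ * b, m), by simpa using h, by simp⟩
  · intros
    rfl

open Classical in
theorem pencilSum_eq_add (hk : 1 ≤ k) (ψ : AddChar (ZMod (p ^ k)) ℂ)
    (A B : Matrix n n (ZMod (p ^ k))) (u : n → ZMod (p ^ k)) {δ c₁ c₂ : ZMod (p ^ k)} {r : ℕ}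
    (hδ : ∀ w, δ * w = 0 ↔ (p : ZMod (p ^ k)) ^ r ∣ w) :
    pencilSum ψ A B u δ c₁ c₂ =
      ∑ x with (p : ZMod (p ^ k)) ^ r ∣ c₁ * x - c₂, lineSum ψ (A + x • B) u +
      ∑ y with (p : ZMod (p ^ k)) ∣ y ∧ (p : ZMod (p ^ k)) ^ r ∣ c₂ * y - c₁,
        lineSum ψ (B + y • A) u := by
  have h1 := sum_filter_isUnit_eq
    (fun a : ZMod (p ^ k) × ZMod (p ^ k) => (p : ZMod (p ^ k)) ^ r ∣ c₁ * a.2 - c₂ * a.1)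
    (fun a => quadSum ψ (a.1 • A + a.2 • B) u)
  have h2 := sum_filter_isUnit_eq
    (fun a : ZMod (p ^ k) × ZMod (p ^ k) => (p : ZMod (p ^ k)) ∣ a.2 ∧
      (p : ZMod (p ^ k)) ^ r ∣ c₂ * a.2 - c₁ * a.1)
    (fun a => quadSum ψ (a.1 • B + a.2 • A) u)
  have e1 : ∀ (m : (ZMod (p ^ k))ˣ) (x c c' : ZMod (p ^ k)),
      (p : ZMod (p ^ k)) ^ r ∣ c * (m * x) - c' * m ↔ (p : ZMod (p ^ k)) ^ r ∣ c * x - c' := by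
    intro m x c c'
    rw [show c * (m * x) - c' * m = m * (c * x - c') by ring, m.isUnit.dvd_mul_left]
  have e2 : ∀ (m : (ZMod (p ^ k))ˣ) (x : ZMod (p ^ k)) (A B : Matrix n n (ZMod (p ^ k))),
      (m : ZMod (p ^ k)) • A + (m * x) • B = (m : ZMod (p ^ k)) • (A + x • B) := by
    intro m x A B
    rw [smul_add, smul_smul]
  have h3 : ∀ (Q : ZMod (p ^ k) → Prop) [DecidablePred Q] (A B : Matrix n n (ZMod (p ^ k))),
      ∑ x, ∑ m : (ZMod (p ^ k))ˣ,
        (if Q x then quadSum ψ ((m : ZMod (p ^ k)) • (A + x • B)) u else 0) =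
      ∑ x with Q x, lineSum ψ (A + x • B) u := by
    intro Q _ A B
    rw [Finset.sum_filter]
    refine Finset.sum_congr rfl fun x _ => ?_
    split_ifs
    · rfl
    · simp
  replace h1 := h1.trans <| (Finset.sum_congr rfl fun x _ => Finset.sum_congr rfl fun m _ => by
    rw [e2]
    exact if_congr (e1 m x c₁ c₂) rfl rfl).trans
      (h3 (fun x => (p : ZMod (p ^ k)) ^ r ∣ c₁ * x - c₂) A B)
  replace h2 := h2.trans <| (Finset.sum_congr rfl fun x _ => Finset.sum_congr rfl fun m _ => by
    rw [e2]
    exact if_congr (and_congr m.isUnit.dvd_mul_left (e1 m x c₂ c₁)) rfl rfl).trans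
      (h3 (fun x => (p : ZMod (p ^ k)) ∣ x ∧ (p : ZMod (p ^ k)) ^ r ∣ c₂ * x - c₁) B A)
  rw [← h1, ← h2, pencilSum, ← Finset.sum_filter_add_sum_filter_not _ (fun a => IsUnit a.1),
    Finset.filter_filter, Finset.filter_filter]
  congr 1
  · refine Finset.sum_congr ?_ fun _ _ => rfl
    ext a
    simp only [Finset.mem_filter, Finset.mem_univ, true_and]
    rw [hδ, isCoprime_iff_isUnit_or hk]
    tauto
  · refine Finset.sum_equiv (Equiv.prodComm _ _) (fun a => ?_) fun a _ => ?_
    · simp only [Finset.mem_filter, Finset.mem_univ, true_and, Equiv.prodComm_apply,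
        Prod.fst_swap, Prod.snd_swap]
      rw [hδ, isCoprime_iff_isUnit_or hk, ← not_isUnit_iff_p_dvd hk, ← dvd_neg,
        show -(c₁ * a.2 - c₂ * a.1) = c₂ * a.1 - c₁ * a.2 by ring]
      tauto
    · simp [add_comm]

/-- In coprime coordinates, the two parts of the projective line that carry the congruence are
contained in single residue classes. -/
theorem exists_residueClass_or (hk : 1 ≤ k) {c₁ c₂ : ZMod (p ^ k)} (hc : IsCoprime c₁ c₂) {r : ℕ}
    (hr : 1 ≤ r) :
    (∃ x₀, (∀ x, (p : ZMod (p ^ k)) ^ r ∣ c₁ * x - c₂ ↔ (p : ZMod (p ^ k)) ^ r ∣ x - x₀) ∧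
      ∀ y, ¬ ((p : ZMod (p ^ k)) ∣ y ∧ (p : ZMod (p ^ k)) ^ r ∣ c₂ * y - c₁)) ∨
    ∃ y₀, (∀ y, (p : ZMod (p ^ k)) ∣ y ∧ (p : ZMod (p ^ k)) ^ r ∣ c₂ * y - c₁ ↔
        (p : ZMod (p ^ k)) ^ r ∣ y - y₀) ∧
      ∀ x, ¬ (p : ZMod (p ^ k)) ^ r ∣ c₁ * x - c₂ := by
  have hpr : (p : ZMod (p ^ k)) ∣ p ^ r := dvd_pow_self _ (by omega)
  have key : ∀ {a : ZMod (p ^ k)}, IsUnit a → ∀ b : ZMod (p ^ k), ∃ x₀, a * x₀ = b ∧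
      ∀ x, (p : ZMod (p ^ k)) ^ r ∣ a * x - b ↔ (p : ZMod (p ^ k)) ^ r ∣ x - x₀ := by
    intro a ha b
    obtain ⟨z, hz⟩ := ha.exists_right_inv
    refine ⟨z * b, by rw [← mul_assoc, hz, one_mul], fun x => ?_⟩
    rw [← ha.dvd_mul_left (b := x - z * b), mul_sub, ← mul_assoc a z, hz, one_mul]
  by_cases h1 : IsUnit c₁
  · left
    obtain ⟨x₀, -, hx⟩ := key h1 c₂
    refine ⟨x₀, hx, fun y ⟨hy, hy'⟩ => (isUnit_iff_not_p_dvd hk c₁).1 h1 ?_⟩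
    exact (dvd_sub_right (hy.mul_left c₂)).1 (hpr.trans hy')
  · right
    have h2 := ((isCoprime_iff_isUnit_or hk _ _).1 hc).resolve_left h1
    rw [not_isUnit_iff_p_dvd hk] at h1
    obtain ⟨y₀, hy₀, hy⟩ := key h2 c₁
    refine ⟨y₀, fun y => ⟨fun h => (hy y).1 h.2, fun h => ⟨?_, (hy y).2 h⟩⟩, fun x hx => ?_⟩
    · rw [← h2.dvd_mul_left]
      exact (dvd_sub_left h1).1 (hpr.trans ((hy y).2 h))
    · exact (isUnit_iff_not_p_dvd hk c₂).1 h2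
        ((dvd_sub_right (h1.mul_right x)).1 (hpr.trans hx))

end PencilSum

section PencilSumBounds

variable {n : Type*} [Fintype n] [DecidableEq n] {p : ℕ} [hp : Fact p.Prime] {k : ℕ}
  {ψ : AddChar (ZMod (p ^ k)) ℂ} {A B : Matrix n n (ZMod (p ^ k))} {δ c₁ c₂ : ZMod (p ^ k)} {r : ℕ}

open Classical in
theorem norm_pencilSum_le_of_residueClass (hk : 1 ≤ k) (u : n → ZMod (p ^ k)) (hr : 1 ≤ r)
    (hδ : ∀ w, δ * w = 0 ↔ (p : ZMod (p ^ k)) ^ r ∣ w) (hc : IsCoprime c₁ c₂) {T : ℝ}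
    (hT : ∀ x₀, ∑ x with (p : ZMod (p ^ k)) ^ r ∣ x - x₀, ‖lineSum ψ (A + x • B) u‖ ≤ T)
    (hT' : ∀ x₀, ∑ x with (p : ZMod (p ^ k)) ^ r ∣ x - x₀, ‖lineSum ψ (B + x • A) u‖ ≤ T) :
    ‖pencilSum ψ A B u δ c₁ c₂‖ ≤ T := by
  rw [pencilSum_eq_add hk ψ A B u hδ]
  rcases exists_residueClass_or hk hc hr with ⟨x₀, h1, h2⟩ | ⟨y₀, h1, h2⟩
  · rw [Finset.filter_false_of_mem fun y _ => h2 y, Finset.sum_empty, add_zero,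
      Finset.filter_congr fun x _ => h1 x]
    exact (norm_sum_le _ _).trans (hT x₀)
  · rw [Finset.filter_false_of_mem fun y _ => h2 y, Finset.sum_empty, zero_add,
      Finset.filter_congr fun x _ => h1 x]
    exact (norm_sum_le _ _).trans (hT' y₀)

open Classical in
theorem norm_pencilSum_le_of_isUnit (hk : 1 ≤ k) (hψ : ψ.IsPrimitive) (hp2 : p ≠ 2) (hA : A.IsSymm)
    (hB : B.IsSymm)
    (hgood : ∀ x, IsUnit ((pencilDet A B).eval x) ∨ IsUnit ((pencilDet A B).derivative.eval x))
    (hgood' : ∀ x, IsUnit ((pencilDet B A).eval x) ∨ IsUnit ((pencilDet B A).derivative.eval x))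
    (hn : (2 * Fintype.card n + 2) ^ 2 ≤ p) (u : n → ZMod (p ^ k)) (hrk : r ≤ k)
    (hδ : ∀ w, δ * w = 0 ↔ (p : ZMod (p ^ k)) ^ r ∣ w) (hc : IsCoprime c₁ c₂) :
    ‖pencilSum ψ A B u δ c₁ c₂‖ ≤ √(p : ℝ) ^ (k * Fintype.card n + 4 * k - r) := by
  rcases Nat.eq_zero_or_pos r with rfl | hr
  · rw [pencilSum_eq_add hk ψ A B u hδ, tsub_zero]
    have h := norm_sum_lineSum_projectiveLine_le hk hψ hp2 hA hB hgood u hgood' hn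
    simpa only [pow_zero, one_dvd, and_true, Finset.filter_true] using h
  · exact norm_pencilSum_le_of_residueClass hk u hr hδ hc
      (sum_norm_lineSum_le hk hψ hp2 hA hB hgood u hr hrk)
      (sum_norm_lineSum_le hk hψ hp2 hB hA hgood' u hr hrk)

open Classical in
theorem norm_pencilSum_le_of_not_dvd (hk : 1 ≤ k) (hψ : ψ.IsPrimitive) (hA : A.IsSymm)
    (hB : B.IsSymm) {ν : ℕ}
    (hf : ν + 1 ≤ k → ∀ x, (p : ZMod (p ^ k)) ^ (ν + 1) ∣ (pencilDet A B).eval x →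
      ¬ (p : ZMod (p ^ k)) ^ (ν + 1) ∣ (pencilDet A B).derivative.eval x)
    (hf' : ν + 1 ≤ k → ∀ x, (p : ZMod (p ^ k)) ^ (ν + 1) ∣ (pencilDet B A).eval x →
      ¬ (p : ZMod (p ^ k)) ^ (ν + 1) ∣ (pencilDet B A).derivative.eval x)
    (u : n → ZMod (p ^ k)) (hrk : r ≤ k)
    (hδ : ∀ w, δ * w = 0 ↔ (p : ZMod (p ^ k)) ^ r ∣ w) (hc : IsCoprime c₁ c₂) :
    ‖pencilSum ψ A B u δ c₁ c₂‖ ≤ 8 * √(p : ℝ) ^ (4 * ν + 3 + (ν + 1) * Fintype.card n) *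
        √(p : ℝ) ^ (k * Fintype.card n + 4 * k - r) := by
  have h1 := sum_norm_lineSum_le_of_not_dvd hψ hA hB hf u hrk
  have h2 := sum_norm_lineSum_le_of_not_dvd hψ hB hA hf' u hrk
  set T := √(p : ℝ) ^ (4 * ν + 3 + (ν + 1) * Fintype.card n) *
    √(p : ℝ) ^ (k * Fintype.card n + 4 * k - r) with hT
  have hT0 : 0 ≤ T := by positivity
  rw [mul_assoc, ← hT]
  simp only [mul_assoc, ← hT] at h1 h2
  rcases Nat.eq_zero_or_pos r with rfl | hr
  · rw [pencilSum_eq_add hk ψ A B u hδ]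
    refine (norm_add_le _ _).trans ?_
    have h3 := h1 0
    have h4 := h2 0
    simp only [pow_zero, one_dvd, and_true, Finset.filter_true] at h3 h4 ⊢
    have h5 : ∑ y with (p : ZMod (p ^ k)) ∣ y, ‖lineSum ψ (B + y • A) u‖ ≤ 4 * T :=
      (Finset.sum_le_sum_of_subset_of_nonneg (Finset.filter_subset _ _)
        fun _ _ _ => norm_nonneg _).trans h4
    linarith [(norm_sum_le univ fun x => lineSum ψ (A + x • B) u).trans h3,
      (norm_sum_le _ fun y => lineSum ψ (B + y • A) u).trans h5]
  · exact (norm_pencilSum_le_of_residueClass hk u hr hδ hc h1 h2).trans (by linarith)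

end PencilSumBounds

section ProductRings

variable {n : Type*}
  {R S T : Type*} [CommRing R] [CommRing S] [CommRing T]

theorem AddChar.IsPrimitive.compRingEquiv {ψ : AddChar R ℂ} (hψ : ψ.IsPrimitive) (e : R ≃+* S) :
    (ψ.compAddMonoidHom (e.symm : S →+ R)).IsPrimitive := by
  intro a ha h
  refine hψ (a := e.symm a) (by simpa using ha) ?_
  ext x
  have := DFunLike.congr_fun h (e x)
  simpa [AddChar.mulShift_apply] using this

theorem AddChar.IsPrimitive.inl {ψ : AddChar (S × T) ℂ} (hψ : ψ.IsPrimitive) :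
    (ψ.compAddMonoidHom (AddMonoidHom.inl S T)).IsPrimitive := by
  intro a ha h
  refine hψ (a := (a, 0)) (fun h0 => ha (congrArg Prod.fst h0)) ?_
  ext x
  have := DFunLike.congr_fun h x.1
  simpa [AddChar.mulShift_apply, Prod.mul_def] using this

theorem AddChar.IsPrimitive.inr {ψ : AddChar (S × T) ℂ} (hψ : ψ.IsPrimitive) :
    (ψ.compAddMonoidHom (AddMonoidHom.inr S T)).IsPrimitive := by
  intro a ha h
  refine hψ (a := (0, a)) (fun h0 => ha (congrArg Prod.snd h0)) ?_
  ext x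
  have := DFunLike.congr_fun h x.2
  simpa [AddChar.mulShift_apply, Prod.mul_def] using this

theorem map_smul_add_smul (f : R →+* S) (A B : Matrix n n R) (a b : R) :
    (a • A + b • B).map f = f a • A.map f + f b • B.map f := by
  ext i j
  simp

theorem Prod.isCoprime_iff (a b : S × T) :
    IsCoprime a b ↔ IsCoprime a.1 b.1 ∧ IsCoprime a.2 b.2 := by
  refine ⟨fun h => ⟨h.map (RingHom.fst S T), h.map (RingHom.snd S T)⟩, ?_⟩
  rintro ⟨⟨x, y, h⟩, ⟨z, w, h'⟩⟩
  exact ⟨(x, z), (y, w), Prod.ext h h'⟩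

variable [Fintype n]

theorem map_quadratic_add_linear (f : R →+* S) (M : Matrix n n R) (u z : n → R) :
    f (z ⬝ᵥ M *ᵥ z + u ⬝ᵥ z) = (f ∘ z) ⬝ᵥ M.map f *ᵥ (f ∘ z) + (f ∘ u) ⬝ᵥ (f ∘ z) := by
  rw [map_add, map_quadratic, RingHom.map_dotProduct]

variable [Fintype R] [Fintype S] [Fintype T] [DecidableEq n]

theorem quadSum_ringEquiv (ψ : AddChar R ℂ) (e : R ≃+* S) (M : Matrix n n R) (u : n → R) :
    quadSum ψ M u =
      quadSum (ψ.compAddMonoidHom (e.symm : S →+ R)) (M.map (e : R →+* S)) (e ∘ u) := by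
  rw [quadSum, quadSum, ← (Equiv.piCongrRight fun _ : n => e.toEquiv).sum_comp]
  refine Finset.sum_congr rfl fun z _ => ?_
  have h1 := map_quadratic_add_linear (e : R →+* S) M u z
  change _ = ψ (e.symm _)
  congr 1
  rw [RingEquiv.eq_symm_apply]
  exact h1

theorem quadSum_prod (ψ : AddChar (S × T) ℂ) (M : Matrix n n (S × T)) (u : n → S × T) :
    quadSum ψ M u =
      quadSum (ψ.compAddMonoidHom (AddMonoidHom.inl S T)) (M.map (RingHom.fst S T))
        (RingHom.fst S T ∘ u) *
      quadSum (ψ.compAddMonoidHom (AddMonoidHom.inr S T)) (M.map (RingHom.snd S T))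
        (RingHom.snd S T ∘ u) := by
  rw [quadSum, quadSum, quadSum, Finset.sum_mul_sum, ← Finset.sum_product', Finset.univ_product_univ,
    ← (Equiv.arrowProdEquivProdArrow n (fun _ => S) (fun _ => T)).sum_comp]
  refine Finset.sum_congr rfl fun z _ => ?_
  have h1 := map_quadratic_add_linear (RingHom.fst S T) M u z
  have h2 := map_quadratic_add_linear (RingHom.snd S T) M u z
  change _ = ψ (_, 0) * ψ (0, _)
  rw [← AddChar.map_add_eq_mul]
  congr 1
  exact Prod.ext (h1.trans (add_zero _).symm) (h2.trans (zero_add _).symm)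

theorem pencilSum_ringEquiv (ψ : AddChar R ℂ) (e : R ≃+* S) (A B : Matrix n n R) (u : n → R)
    (δ c₁ c₂ : R) :
    pencilSum ψ A B u δ c₁ c₂ =
      pencilSum (ψ.compAddMonoidHom (e.symm : S →+ R)) (A.map (e : R →+* S))
        (B.map (e : R →+* S)) (e ∘ u) (e δ) (e c₁) (e c₂) := by
  rw [pencilSum, pencilSum]
  refine Finset.sum_equiv (Equiv.prodCongr e.toEquiv e.toEquiv) (fun a => ?_) fun a _ => ?_
  · simp only [Finset.mem_filter, Finset.mem_univ, true_and, Equiv.prodCongr_apply, Prod.map_fst,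
      Prod.map_snd, RingEquiv.toEquiv_eq_coe, EquivLike.coe_coe]
    refine and_congr ⟨fun h => h.map (e : R →+* S), fun h => ?_⟩ ?_
    · simpa using h.map (e.symm : S →+* R)
    · rw [← map_mul, ← map_mul, ← map_sub, ← map_mul, map_eq_zero_iff _ e.injective]
  · rw [quadSum_ringEquiv ψ e, map_smul_add_smul]
    rfl

theorem pencilSum_prod (ψ : AddChar (S × T) ℂ) (A B : Matrix n n (S × T)) (u : n → S × T)
    (δ c₁ c₂ : S × T) :
    pencilSum ψ A B u δ c₁ c₂ =
      pencilSum (ψ.compAddMonoidHom (AddMonoidHom.inl S T)) (A.map (RingHom.fst S T))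
        (B.map (RingHom.fst S T)) (RingHom.fst S T ∘ u) δ.1 c₁.1 c₂.1 *
      pencilSum (ψ.compAddMonoidHom (AddMonoidHom.inr S T)) (A.map (RingHom.snd S T))
        (B.map (RingHom.snd S T)) (RingHom.snd S T ∘ u) δ.2 c₁.2 c₂.2 := by
  rw [pencilSum, pencilSum, pencilSum, Finset.sum_mul_sum, ← Finset.sum_product']
  refine Finset.sum_equiv (Equiv.prodProdProdComm S T S T) (fun a => ?_) fun a _ => ?_
  · simp only [Finset.mem_filter, Finset.mem_univ, true_and, Finset.mem_product,
      Equiv.prodProdProdComm_apply]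
    rw [Prod.isCoprime_iff, Prod.ext_iff]
    simp only [Prod.fst_mul, Prod.snd_mul, Prod.fst_sub, Prod.snd_sub, Prod.fst_zero, Prod.snd_zero]
    tauto
  · rw [quadSum_prod, map_smul_add_smul, map_smul_add_smul]
    rfl

end ProductRings

section Multiplicativity

variable {n : Type*} [Fintype n] [DecidableEq n]

theorem exists_natCast_mul_eq_zero_iff {p : ℕ} [hp : Fact p.Prime] {k : ℕ} (d : ℕ) :
    ∃ r ≤ k, p ^ (k - r) = d.gcd (p ^ k) ∧
      ∀ w : ZMod (p ^ k), (d : ZMod (p ^ k)) * w = 0 ↔ (p : ZMod (p ^ k)) ^ r ∣ w := by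
  obtain ⟨j, hj, hg⟩ := (Nat.dvd_prime_pow hp.out).1 (Nat.gcd_dvd_right d (p ^ k))
  refine ⟨k - j, Nat.sub_le _ _, by rw [hg, Nat.sub_sub_self hj], fun w => ?_⟩
  obtain ⟨e, he⟩ : p ^ j ∣ d := hg ▸ Nat.gcd_dvd_left d (p ^ k)
  rw [he, Nat.cast_mul, Nat.cast_pow, mul_assoc, ppow_mul_eq_zero_iff hj]
  rcases hj.eq_or_lt with rfl | hj
  · simp
  have hu : IsUnit (e : ZMod (p ^ k)) := isUnit_natCast_of_not_dvd e fun h => by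
    have h1 : p ^ (j + 1) ∣ d.gcd (p ^ k) :=
      Nat.dvd_gcd (by rw [he, pow_succ]; exact mul_dvd_mul_left _ h) (pow_dvd_pow p hj)
    rw [hg, Nat.pow_dvd_pow_iff_le_right hp.out.one_lt] at h1
    omega
  exact hu.dvd_mul_left

theorem norm_pencilSum_le_of_subsingleton {R : Type*} [CommRing R] [Fintype R] [Subsingleton R]
    (ψ : AddChar R ℂ) (A B : Matrix n n R) (u : n → R) (δ c₁ c₂ : R) :
    ‖pencilSum ψ A B u δ c₁ c₂‖ ≤ 1 := by
  classical
  rw [pencilSum]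
  refine (norm_sum_le _ _).trans ((Finset.sum_le_sum fun a _ => (?_ : _ ≤ (1 : ℝ))).trans ?_)
  · rw [quadSum, Fintype.sum_subsingleton _ 0, AddChar.norm_apply]
  · rw [Finset.sum_const, nsmul_eq_mul, mul_one, Nat.cast_le_one]
    exact Finset.card_le_one_of_subsingleton _

/-- The bound for pencil sums modulo `q`, given the bounds at prime powers. -/
theorem norm_pencilSum_le_prod (M₁ M₂ : Matrix n n ℤ) {K : ℕ → ℝ} (hK : ∀ p, 0 ≤ K p) {N : ℕ}
    (hprime : ∀ p k : ℕ, p.Prime → 1 ≤ k → ∀ [NeZero (p ^ k)],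
      ∀ ψ : AddChar (ZMod (p ^ k)) ℂ, ψ.IsPrimitive → ∀ (u : n → ZMod (p ^ k)) (d : ℕ)
        (c₁ c₂ : ZMod (p ^ k)), IsCoprime c₁ c₂ →
        ‖pencilSum ψ (M₁.map (Int.castRingHom (ZMod (p ^ k))))
          (M₂.map (Int.castRingHom (ZMod (p ^ k)))) u d c₁ c₂‖ ≤
          K p * √(d.gcd (p ^ k) : ℝ) * √((p ^ k : ℕ) : ℝ) ^ N) :
    ∀ (q : ℕ) [NeZero q] (ψ : AddChar (ZMod q) ℂ), ψ.IsPrimitive → ∀ (u : n → ZMod q) (d : ℕ)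
      (c₁ c₂ : ZMod q), IsCoprime c₁ c₂ →
      ‖pencilSum ψ (M₁.map (Int.castRingHom (ZMod q))) (M₂.map (Int.castRingHom (ZMod q)))
        u d c₁ c₂‖ ≤ (∏ p ∈ q.primeFactors, K p) * √(d.gcd q : ℝ) * √(q : ℝ) ^ N := by
  intro q
  induction q using Nat.recOnPosPrimePosCoprime with
  | zero => intro h; exact absurd rfl h.out
  | one =>
    intro _ ψ _ u d c₁ c₂ _
    simpa using norm_pencilSum_le_of_subsingleton ψ _ _ u _ c₁ c₂
  | prime_pow p k hp hk =>
    intro _ ψ hψ u d c₁ c₂ hc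
    rw [Nat.primeFactors_prime_pow (by omega) hp, Finset.prod_singleton]
    exact hprime p k hp hk ψ hψ u d c₁ c₂ hc
  | coprime a b ha hb hab iha ihb =>
    intro _ ψ hψ u d c₁ c₂ hc
    have : NeZero a := ⟨by omega⟩
    have : NeZero b := ⟨by omega⟩
    have e := ZMod.chineseRemainder hab
    have hmap : ∀ {R S : Type} [CommRing R] [CommRing S] (f : R →+* S) (M : Matrix n n ℤ),
        (M.map (Int.castRingHom R)).map f = M.map (Int.castRingHom S) := by
      intro R S _ _ f M
      ext i j
      simp
    have hcop : IsCoprime (e c₁) (e c₂) := hc.map (e : ZMod (a * b) →+* ZMod a × ZMod b)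
    rw [Prod.isCoprime_iff] at hcop
    rw [pencilSum_ringEquiv ψ e, pencilSum_prod, norm_mul]
    simp only [hmap]
    have hψ' := hψ.compRingEquiv e
    have h1 := iha _ hψ'.inl (RingHom.fst _ _ ∘ e ∘ u) d _ _ hcop.1
    have h2 := ihb _ hψ'.inr (RingHom.snd _ _ ∘ e ∘ u) d _ _ hcop.2
    have hd : e (d : ZMod (a * b)) = ((d : ZMod a), (d : ZMod b)) := by
      rw [map_natCast]
      rfl
    rw [hd, hab.primeFactors_mul, Finset.prod_union hab.disjoint_primeFactors, hab.gcd_mul d]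
    push_cast
    rw [Real.sqrt_mul (Nat.cast_nonneg _), Real.sqrt_mul (Nat.cast_nonneg _), mul_pow]
    refine (mul_le_mul h1 h2 (norm_nonneg _)
      (mul_nonneg (mul_nonneg (Finset.prod_nonneg fun p _ => hK p) ?_) ?_)).trans_eq (by ring)
    · positivity
    · positivity

end Multiplicativity

section ExponentialSum

theorem quadEval_eq_dotProduct {s : ℕ} {R : Type*} [CommRing R] (M : Matrix (Fin s) (Fin s) ℤ)
    (x : Fin s → R) : quadEval M x = x ⬝ᵥ M.map (Int.castRingHom R) *ᵥ x := by
  simp only [quadEval, dotProduct, Matrix.mulVec, Matrix.map_apply, Finset.mul_sum,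
    Int.coe_castRingHom]
  exact Finset.sum_congr rfl fun i _ => Finset.sum_congr rfl fun j _ => by ring

theorem intCast_quadEval {s : ℕ} (R : Type*) [CommRing R] (M : Matrix (Fin s) (Fin s) ℤ)
    (x : Fin s → ℤ) : ((quadEval M x : ℤ) : R) = quadEval M fun i => (x i : R) := by
  simp [quadEval]

theorem eqc_eq_stdAddChar (q : ℕ) [NeZero q] (n : ℤ) : eqc q n = ZMod.stdAddChar (n : ZMod q) := by
  rw [ZMod.stdAddChar_coe, eqc, e2pi]
  congr 1
  push_cast
  ring

theorem ZMod.isCoprime_natCast_iff {q : ℕ} (a b : ℕ) :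
    IsCoprime (a : ZMod q) b ↔ (a.gcd b).gcd q = 1 := by
  constructor
  · intro h
    have h1 := h.map (ZMod.castHom (Nat.gcd_dvd_right (a.gcd b) q) (ZMod ((a.gcd b).gcd q)))
    rw [map_natCast, map_natCast,
      (ZMod.natCast_eq_zero_iff a _).2 ((Nat.gcd_dvd_left _ _).trans (Nat.gcd_dvd_left _ _)),
      (ZMod.natCast_eq_zero_iff b _).2 ((Nat.gcd_dvd_left _ _).trans (Nat.gcd_dvd_right _ _)),
      isCoprime_zero_left, isUnit_zero_iff] at h1
    have h2 := (ZMod.natCast_eq_zero_iff 1 ((a.gcd b).gcd q)).1 (by rw [Nat.cast_one, ← h1])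
    exact Nat.dvd_one.1 h2
  · intro h
    obtain ⟨x, y, hxy⟩ := Nat.isCoprime_iff_coprime.2 h
    rw [Nat.gcd_eq_gcd_ab] at hxy
    have h1 := congrArg (Int.cast : ℤ → ZMod q) hxy
    push_cast at h1
    rw [ZMod.natCast_self, mul_zero, add_zero] at h1
    exact ⟨x * a.gcdA b, x * a.gcdB b, by rw [← h1]; ring⟩

theorem sum_piFinset_range_eq {q s : ℕ} [NeZero q] (f : (Fin s → ZMod q) → ℂ) :
    ∑ b ∈ Fintype.piFinset (fun _ : Fin s => Finset.range q), f (fun i => (b i : ZMod q)) =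
      ∑ z, f z := by
  refine Finset.sum_bij' (fun b _ i => (b i : ZMod q)) (fun z _ i => (z i).val) (by simp)
    (fun z _ => ?_) (fun b hb => ?_) (fun z _ => ?_) fun _ _ => rfl
  · simp [ZMod.val_lt]
  · ext i
    exact ZMod.val_cast_of_lt (Finset.mem_range.1 (Fintype.mem_piFinset.1 hb i))
  · ext i
    simp

theorem Sq_eq_pencilSum {s : ℕ} (M₁ M₂ : Matrix (Fin s) (Fin s) ℤ) (q d : ℕ) [NeZero q]
    (c : ℤ × ℤ) (u : Fin s → ℤ) :
    Sq s M₁ M₂ q d c u =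
      pencilSum ZMod.stdAddChar (M₁.map (Int.castRingHom (ZMod q)))
        (M₂.map (Int.castRingHom (ZMod q))) (fun i => (u i : ZMod q)) d c.1 c.2 := by
  rw [Sq, pencilSum]
  refine Finset.sum_bij' (fun a _ => ((a.1 : ZMod q), (a.2 : ZMod q)))
    (fun a _ => (a.1.val, a.2.val)) (fun a ha => ?_) (fun a ha => ?_) (fun a ha => ?_)
    (fun a _ => by simp) fun a _ => ?_
  · simp only [residues, Finset.mem_filter] at ha
    simp only [Finset.mem_filter, Finset.mem_univ, true_and]
    refine ⟨(ZMod.isCoprime_natCast_iff _ _).2 ha.1.2, ?_⟩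
    have := (ZMod.intCast_zmod_eq_zero_iff_dvd _ q).2 ha.2
    exact_mod_cast this
  · simp only [Finset.mem_filter, Finset.mem_univ, true_and] at ha
    simp only [residues, Finset.mem_filter, Finset.mem_product, Finset.mem_range]
    refine ⟨⟨⟨ZMod.val_lt _, ZMod.val_lt _⟩, ?_⟩, ?_⟩
    · rw [← ZMod.isCoprime_natCast_iff]
      simpa using ha.1
    · rw [← ZMod.intCast_zmod_eq_zero_iff_dvd]
      push_cast
      simpa using ha.2
  · simp only [residues, Finset.mem_filter, Finset.mem_product, Finset.mem_range] at ha
    exact Prod.ext (ZMod.val_cast_of_lt ha.1.1.1) (ZMod.val_cast_of_lt ha.1.1.2)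
  · rw [quadSum, ← sum_piFinset_range_eq]
    refine Finset.sum_congr rfl fun b _ => ?_
    rw [eqc_eq_stdAddChar]
    congr 1
    push_cast
    rw [intCast_quadEval, intCast_quadEval, quadEval_eq_dotProduct, quadEval_eq_dotProduct,
      Matrix.add_mulVec, dotProduct_add, smul_quadratic, smul_quadratic]
    simp only [dotProduct, Int.cast_natCast, mul_comm]

end ExponentialSum

section GeneralBound

theorem Finset.prod_le_prod_of_one_le_of_eq_one {ι : Type*} (t T : Finset ι) {K : ι → ℝ}
    (h1 : ∀ i, 1 ≤ K i) (hT : ∀ i, i ∉ T → K i = 1) : ∏ i ∈ t, K i ≤ ∏ i ∈ T, K i := by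
  classical
  have h0 : ∏ i ∈ t ∪ T, K i = ∏ i ∈ T, K i :=
    (Finset.prod_subset Finset.subset_union_right fun i _ hi => hT i hi).symm
  rw [← h0]
  exact Finset.prod_le_prod_of_subset_of_one_le Finset.subset_union_left
    (fun i _ => zero_le_one.trans (h1 i)) fun i _ _ => h1 i

theorem Real.sqrt_natCast_pow (p m : ℕ) : √((p ^ m : ℕ) : ℝ) = √(p : ℝ) ^ m := by
  rw [Nat.cast_pow, Real.sqrt_eq_iff_eq_sq (by positivity) (by positivity), ← pow_mul, mul_comm,
    pow_mul, Real.sq_sqrt (Nat.cast_nonneg p)]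

variable {n : Type*} [Fintype n] [DecidableEq n]

/-- Prime power moduli: the bound holds with constant `1` at all large primes. -/
theorem exists_norm_pencilSum_prime_pow_le {M₁ M₂ : Matrix n n ℤ} (hM₁ : M₁.IsSymm)
    (hM₂ : M₂.IsSymm) {N N' : ℤ} (hN : N ≠ 0) (hN' : N' ≠ 0) {a b a' b' : Polynomial ℤ}
    (hab : a * pencilDet M₁ M₂ + b * (pencilDet M₁ M₂).derivative = Polynomial.C N)
    (hab' : a' * pencilDet M₂ M₁ + b' * (pencilDet M₂ M₁).derivative = Polynomial.C N') :
    ∃ (K : ℕ → ℝ) (P : ℕ), (∀ p, 1 ≤ K p) ∧ (∀ p, P < p → K p = 1) ∧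
      ∀ p k : ℕ, p.Prime → 1 ≤ k → ∀ [NeZero (p ^ k)],
      ∀ ψ : AddChar (ZMod (p ^ k)) ℂ, ψ.IsPrimitive → ∀ (u : n → ZMod (p ^ k)) (d : ℕ)
        (c₁ c₂ : ZMod (p ^ k)), IsCoprime c₁ c₂ →
        ‖pencilSum ψ (M₁.map (Int.castRingHom (ZMod (p ^ k))))
          (M₂.map (Int.castRingHom (ZMod (p ^ k)))) u d c₁ c₂‖ ≤
          K p * √(d.gcd (p ^ k) : ℝ) * √((p ^ k : ℕ) : ℝ) ^ (Fintype.card n + 3) := by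
  set P := N.natAbs + N'.natAbs + (2 * Fintype.card n + 2) ^ 2 + 2 with hP
  set ν := N.natAbs + N'.natAbs with hν
  refine ⟨fun p => if P < p then 1 else
    max 1 (8 * √(p : ℝ) ^ (4 * ν + 3 + (ν + 1) * Fintype.card n)), P, fun p => ?_, fun p hp => ?_,
    fun p k hp hk _ ψ hψ u d c₁ c₂ hc => ?_⟩
  · dsimp only
    split_ifs
    · exact le_rfl
    · exact le_max_left _ _
  · exact if_pos hp
  have : Fact p.Prime := ⟨hp⟩
  obtain ⟨r, hrk, hg, hδ⟩ := exists_natCast_mul_eq_zero_iff (p := p) (k := k) d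
  have hpow : √(d.gcd (p ^ k) : ℝ) * √((p ^ k : ℕ) : ℝ) ^ (Fintype.card n + 3) =
      √(p : ℝ) ^ (k * Fintype.card n + 4 * k - r) := by
    rw [← hg, Real.sqrt_natCast_pow, Real.sqrt_natCast_pow, ← pow_mul, ← pow_add]
    congr 1
    have : k * (Fintype.card n + 3) = k * Fintype.card n + 3 * k := by ring
    omega
  have hA := hM₁.map (Int.castRingHom (ZMod (p ^ k)))
  have hB := hM₂.map (Int.castRingHom (ZMod (p ^ k)))
  rw [mul_assoc, hpow]
  dsimp only
  split_ifs with hPp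
  · rw [one_mul]
    refine norm_pencilSum_le_of_isUnit hk hψ (by omega) hA hB
      (isUnit_eval_or_isUnit_eval_derivative hab hk fun h => ?_)
      (isUnit_eval_or_isUnit_eval_derivative hab' hk fun h => ?_) (by omega) u hrk hδ hc
    · have := Nat.le_of_dvd (Int.natAbs_pos.2 hN) h
      omega
    · have := Nat.le_of_dvd (Int.natAbs_pos.2 hN') h
      omega
  · have hlt : ν < p ^ (ν + 1) :=
      (Nat.lt_pow_self hp.one_lt).trans (Nat.pow_lt_pow_right hp.one_lt (Nat.lt_succ_self ν))
    refine (norm_pencilSum_le_of_not_dvd (ν := ν) hk hψ hA hB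
      (fun h x => not_dvd_eval_derivative_of_natAbs_lt hab hN (by omega) h x)
      (fun h x => not_dvd_eval_derivative_of_natAbs_lt hab' hN' (by omega) h x) u hrk hδ hc).trans ?_
    gcongr
    exact le_max_right _ _

end GeneralBound

/-- the general bound `|S_{q,dc}(u)| ≪ d^{1/2} q^{s/2+3/2}` (Lemma 6.8). -/
theorem statement18 (s : ℕ) (M₁ M₂ : Matrix (Fin s) (Fin s) ℤ)
    (hM₁ : M₁.IsSymm) (hM₂ : M₂.IsSymm) (hns : NonsingularPair s M₁ M₂) :
    ∃ C : ℝ, 0 < C ∧ ∀ q d : ℕ, 1 ≤ q → 1 ≤ d → d ∣ q →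
      ∀ c : ℤ × ℤ, Int.gcd c.1 c.2 = 1 → ∀ u : Fin s → ℤ,
        ‖Sq s M₁ M₂ q d c u‖ ≤
          C * (d : ℝ) ^ ((1 : ℝ) / 2) * (q : ℝ) ^ ((s : ℝ) / 2 + 3 / 2) := by
  have hns' : ∀ x : Fin s → ℂ, x ≠ 0 → x ⬝ᵥ M₁.map (Int.castRingHom ℂ) *ᵥ x = 0 →
      x ⬝ᵥ M₂.map (Int.castRingHom ℂ) *ᵥ x = 0 → LinearIndependent ℂ
        ![M₁.map (Int.castRingHom ℂ) *ᵥ x, M₂.map (Int.castRingHom ℂ) *ᵥ x] := by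
    intro x hx h1 h2
    rw [← quadEval_eq_dotProduct] at h1 h2
    exact hns x hx h1 h2
  obtain ⟨N, hN, a, b, hab⟩ := exists_bezout_pencilDet hM₁ hM₂ hns'
  obtain ⟨N', hN', a', b', hab'⟩ := exists_bezout_pencilDet hM₂ hM₁ fun x hx h2 h1 =>
    LinearIndependent.pair_symm_iff.1 (hns' x hx h1 h2)
  obtain ⟨K, P, hK, hKP, hprime⟩ := exists_norm_pencilSum_prime_pow_le hM₁ hM₂ hN hN' hab hab'
  refine ⟨∏ p ∈ Finset.range (P + 1), K p,
    Finset.prod_pos fun p _ => zero_lt_one.trans_le (hK p), fun q d hq _ hdq c hc u => ?_⟩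
  have : NeZero q := ⟨by omega⟩
  have hcop : IsCoprime (c.1 : ZMod q) c.2 :=
    (Int.isCoprime_iff_gcd_eq_one.2 hc).map (Int.castRingHom (ZMod q))
  rw [Sq_eq_pencilSum]
  refine (norm_pencilSum_le_prod M₁ M₂ (fun p => zero_le_one.trans (hK p)) hprime q _
    (ZMod.isPrimitive_stdAddChar q) _ d _ _ hcop).trans ?_
  have h1 : √(q : ℝ) ^ (Fintype.card (Fin s) + 3) = (q : ℝ) ^ ((s : ℝ) / 2 + 3 / 2) := by
    rw [Fintype.card_fin, Real.sqrt_eq_rpow, ← Real.rpow_natCast, ← Real.rpow_mul (by positivity)]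
    congr 1
    push_cast
    ring
  rw [h1, Nat.gcd_eq_left hdq, Real.sqrt_eq_rpow]
  have h2 := Finset.prod_le_prod_of_one_le_of_eq_one q.primeFactors (Finset.range (P + 1)) hK
    fun p hp => hKP p (by simpa [Nat.lt_succ_iff] using hp)
  exact mul_le_mul_of_nonneg_right (mul_le_mul_of_nonneg_right h2 (by positivity)) (by positivity)
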